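/- Let n ≥ 3 and let D be the collection of bounded nonempty connected open subsets Ω ⊆ ℝⁿ with smooth boundary. Then sup{ σ₁(Ω) · H^{n−1}(∂Ω)^{1/(n−1)} : Ω ∈ D } = sup{ σ₁(Ω) · H^{n−1}(∂Ω)^{1/(n−1)} : Ω ∈ D and ∂Ω is connected }, and both suprema are finite. -/

import Mathlib

open MeasureTheory

/-- The first nonzero Steklov eigenvalue of a domain `Ω ⊆ ℝⁿ`, defined variationally. -/
noncomputable def stekSigma1 {n : ℕ} (Ω : Set (EuclideanSpace ℝ (Fin n))) : ℝ :=
  sInf { q : ℝ | ∃ f : EuclideanSpace ℝ (Fin n) → ℝ, ContDiff ℝ (⊤ : ℕ∞) f ∧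
    (∫ x in frontier Ω, f x ∂(μH[(n : ℝ) - 1])) = 0 ∧
    (0 < ∫ x in frontier Ω, (f x) ^ 2 ∂(μH[(n : ℝ) - 1])) ∧
    q = (∫ x in Ω, ‖gradient f x‖ ^ 2) /
        (∫ x in frontier Ω, (f x) ^ 2 ∂(μH[(n : ℝ) - 1])) }

/-- `Ω` has smooth boundary: near each frontier point, `Ω` is the sublevel set `{g < 0}` of a
smooth function `g` with nonvanishing gradient, and the frontier is `{g = 0}`. -/
def HasSmoothBoundary {n : ℕ} (Ω : Set (EuclideanSpace ℝ (Fin n))) : Prop :=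
  ∀ x ∈ frontier Ω, ∃ U : Set (EuclideanSpace ℝ (Fin n)), IsOpen U ∧ x ∈ U ∧
    ∃ g : EuclideanSpace ℝ (Fin n) → ℝ, ContDiff ℝ (⊤ : ℕ∞) g ∧
      (∀ y ∈ U, gradient g y ≠ 0) ∧
      Ω ∩ U = {y | g y < 0} ∩ U ∧ frontier Ω ∩ U = {y | g y = 0} ∩ U

/-- The normalized first Steklov eigenvalue of `Ω`, i.e.
`σ₁(Ω) · H^{n-1}(∂Ω)^{1/(n-1)}`. -/
noncomputable def normSigma1 {n : ℕ} (Ω : Set (EuclideanSpace ℝ (Fin n))) : ℝ :=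
  stekSigma1 Ω * (μH[(n : ℝ) - 1] (frontier Ω)).toReal ^ ((1 : ℝ) / ((n : ℝ) - 1))

open Set Metric Topology Filter
open scoped NNReal ENNReal ContDiff

section HausdorffComparison

theorem lintegral_image_hausdorff_le {X Y : Type*} [EMetricSpace X] [MeasurableSpace X]
    [BorelSpace X] [EMetricSpace Y] [MeasurableSpace Y] [BorelSpace Y] {Ψ : X → Y} {K : ℝ≥0}
    {s : Set X} (hs : MeasurableSet s) (hΨ : LipschitzOnWith K Ψ s) {d : ℝ} (hd : 0 ≤ d)
    {g : Y → ℝ≥0∞} (hg : Measurable g) :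
    ∫⁻ y in Ψ '' s, g y ∂μH[d] ≤ (K : ℝ≥0∞) ^ d * ∫⁻ x in s, g (Ψ x) ∂μH[d] := by
  have hm : AEMeasurable Ψ ((μH[d] : Measure X).restrict s) :=
    hΨ.continuousOn.aemeasurable₀ hs.nullMeasurableSet
  have key : (μH[d] : Measure Y).restrict (Ψ '' s) ≤
      ((K : ℝ≥0∞) ^ d) • Measure.map Ψ ((μH[d] : Measure X).restrict s) := by
    refine Measure.le_iff.2 fun B hB => ?_
    rw [Measure.restrict_apply hB, Measure.smul_apply, Measure.map_apply_of_aemeasurable hm hB,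
      smul_eq_mul, Measure.restrict_apply' hs, inter_comm B, ← image_inter_preimage,
      inter_comm (Ψ ⁻¹' B)]
    exact (hΨ.mono inter_subset_left).hausdorffMeasure_image_le hd
  calc ∫⁻ y in Ψ '' s, g y ∂μH[d]
      ≤ ∫⁻ y, g y ∂(((K : ℝ≥0∞) ^ d) • Measure.map Ψ ((μH[d] : Measure X).restrict s)) :=
        lintegral_mono' key le_rfl
    _ = _ := by rw [lintegral_smul_measure, lintegral_map' hg.aemeasurable hm, smul_eq_mul]

theorem exists_hausdorff_eq_smul {X : Type*} [NormedAddCommGroup X] [NormedSpace ℝ X]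
    [FiniteDimensional ℝ X] [MeasurableSpace X] [BorelSpace X] (ν : Measure X)
    [ν.IsAddHaarMeasure] :
    ∃ c : ℝ≥0, c ≠ 0 ∧ (μH[(Module.finrank ℝ X : ℝ)] : Measure X) = c • ν := by
  refine ⟨Measure.addHaarScalarFactor μH[(Module.finrank ℝ X : ℝ)] ν,
    ?_, Measure.isAddLeftInvariant_eq_smul _ _⟩
  exact (Measure.addHaarScalarFactor_pos_of_isAddHaarMeasure _ _).ne'

theorem exists_lintegral_image_le {X : Type*} [NormedAddCommGroup X] [NormedSpace ℝ X]
    [FiniteDimensional ℝ X] [MeasurableSpace X] [BorelSpace X] (ν : Measure X)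
    [ν.IsAddHaarMeasure] (Y : Type*) [EMetricSpace Y] [MeasurableSpace Y] [BorelSpace Y]
    (K : ℝ≥0) {d : ℝ} (hd : (Module.finrank ℝ X : ℝ) = d) :
    ∃ C : ℝ≥0, ∀ (Ψ : X → Y) (s : Set X), MeasurableSet s → LipschitzOnWith K Ψ s →
      ∀ g : Y → ℝ≥0∞, Measurable g →
        ∫⁻ y in Ψ '' s, g y ∂μH[d] ≤ C * ∫⁻ x in s, g (Ψ x) ∂ν := by
  obtain ⟨c, -, hc⟩ := exists_hausdorff_eq_smul ν
  refine ⟨K ^ d * c, fun Ψ s hs hΨ g hg => ?_⟩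
  have hd0 : 0 ≤ d := hd ▸ Nat.cast_nonneg _
  refine (lintegral_image_hausdorff_le hs hΨ hd0 hg).trans ?_
  rw [← hd, hc, Measure.restrict_smul, lintegral_smul_measure, ENNReal.smul_def, smul_eq_mul,
    ENNReal.coe_mul, mul_assoc, ← ENNReal.coe_rpow_of_nonneg _ (hd ▸ hd0)]

theorem exists_lintegral_image_haar_le {X Y : Type*} [NormedAddCommGroup X] [NormedSpace ℝ X]
    [FiniteDimensional ℝ X] [MeasurableSpace X] [BorelSpace X] (ν : Measure X)
    [ν.IsAddHaarMeasure] [NormedAddCommGroup Y] [NormedSpace ℝ Y]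
    [FiniteDimensional ℝ Y] [MeasurableSpace Y] [BorelSpace Y] (ν' : Measure Y)
    [ν'.IsAddHaarMeasure] (K : ℝ≥0) (hd : Module.finrank ℝ X = Module.finrank ℝ Y) :
    ∃ C : ℝ≥0, ∀ (Ψ : X → Y) (s : Set X), MeasurableSet s → LipschitzOnWith K Ψ s →
      ∀ g : Y → ℝ≥0∞, Measurable g →
        ∫⁻ y in Ψ '' s, g y ∂ν' ≤ C * ∫⁻ x in s, g (Ψ x) ∂ν := by
  obtain ⟨C, hC⟩ := exists_lintegral_image_le ν Y K (congrArg Nat.cast hd)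
  obtain ⟨c, hc0, hc⟩ := exists_hausdorff_eq_smul ν'
  refine ⟨c⁻¹ * C, fun Ψ s hs hΨ g hg => ?_⟩
  have h := hC Ψ s hs hΨ g hg
  rw [hc, Measure.restrict_smul, lintegral_smul_measure, ENNReal.smul_def, smul_eq_mul] at h
  have h2 := mul_le_mul_right h ((c⁻¹ : ℝ≥0) : ℝ≥0∞)
  rw [← mul_assoc, ← ENNReal.coe_mul, inv_mul_cancel₀ hc0, ENNReal.coe_one, one_mul,
    ← mul_assoc] at h2
  simpa using h2

end HausdorffComparison

section Isoperimetric

theorem volume_image_removeNth_le {m : ℕ} (i : Fin (m + 1))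
    (s : Set (EuclideanSpace ℝ (Fin (m + 1)))) :
    volume ((fun x : EuclideanSpace ℝ (Fin (m + 1)) => fun j : Fin m => x (i.succAbove j)) '' s)
      ≤ μH[(m : ℝ)] s := by
  have hL : LipschitzOnWith 1
      (fun x : EuclideanSpace ℝ (Fin (m + 1)) => fun j : Fin m => x (i.succAbove j)) s := by
    refine (LipschitzWith.of_dist_le_mul fun x y => ?_).lipschitzOnWith
    rw [NNReal.coe_one, one_mul, dist_pi_le_iff dist_nonneg]
    intro j
    rw [dist_eq_norm, dist_eq_norm]
    exact PiLp.norm_apply_le (x - y) (i.succAbove j)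
  have h := hL.hausdorffMeasure_image_le (d := m) (Nat.cast_nonneg _)
  have e := hausdorffMeasure_pi_real (ι := Fin m)
  rw [Fintype.card_fin] at e
  rw [e] at h
  simpa using h

theorem exists_frontier_mem_line {E : Type*} [NormedAddCommGroup E] [NormedSpace ℝ E]
    {Ω : Set E} (hb : Bornology.IsBounded Ω) {x v : E} (hx : x ∈ Ω)
    (hv : v ≠ 0) : ∃ t : ℝ, 0 ≤ t ∧ x + t • v ∈ frontier Ω := by
  obtain ⟨r, hr⟩ := hb.subset_closedBall 0
  have hv' : 0 < ‖v‖ := norm_pos_iff.2 hv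
  let γ : ℝ → E := fun t => x + t • v
  have hγ : Continuous γ := by fun_prop
  obtain ⟨T, hT0, hT⟩ : ∃ T : ℝ, 0 ≤ T ∧ γ T ∉ Ω := by
    refine ⟨(|r| + ‖x‖ + 1) / ‖v‖, by positivity, fun h => ?_⟩
    have h1 := hr h
    rw [mem_closedBall_zero_iff] at h1
    have h2 : ‖((|r| + ‖x‖ + 1) / ‖v‖) • v‖ ≤ ‖γ ((|r| + ‖x‖ + 1) / ‖v‖)‖ + ‖x‖ := by
      have := norm_sub_le (γ ((|r| + ‖x‖ + 1) / ‖v‖)) x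
      simpa [γ] using this
    rw [norm_smul, Real.norm_of_nonneg (by positivity), div_mul_cancel₀ _ hv'.ne'] at h2
    linarith [le_abs_self r]
  have hpre : IsPreconnected (γ '' Icc 0 T) := isPreconnected_Icc.image _ hγ.continuousOn
  have : (γ '' Icc 0 T ∩ frontier Ω).Nonempty := by
    by_contra hne
    rw [not_nonempty_iff_eq_empty] at hne
    have hsub := hpre.subset_of_closure_inter_subset (isOpen_interior (s := Ω)) ⟨x, ?_, ?_⟩ ?_
    · exact hT (interior_subset (hsub ⟨T, ⟨hT0, le_rfl⟩, rfl⟩))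
    · exact ⟨0, ⟨le_rfl, hT0⟩, by simp [γ]⟩
    · by_contra hxi
      have hxf : x ∈ frontier Ω := ⟨subset_closure hx, hxi⟩
      exact (hne ▸ (⟨⟨0, ⟨le_rfl, hT0⟩, by simp [γ]⟩, hxf⟩ : x ∈ γ '' Icc 0 T ∩ frontier Ω)
        : x ∈ (∅ : Set E))
    · rintro y ⟨hy, hyγ⟩
      by_contra hyi
      have hyf : y ∈ frontier Ω := ⟨closure_mono interior_subset hy, hyi⟩
      exact (hne ▸ (⟨hyγ, hyf⟩ : y ∈ γ '' Icc 0 T ∩ frontier Ω) : y ∈ (∅ : Set E))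
  obtain ⟨_, ⟨t, ht, rfl⟩, hf⟩ := this
  exact ⟨t, ht.1, hf⟩

theorem volume_le_frontier_rpow {m : ℕ} (hm : 1 ≤ m) {Ω : Set (EuclideanSpace ℝ (Fin (m + 1)))}
    (ho : IsOpen Ω) (hb : Bornology.IsBounded Ω) :
    volume Ω ≤ (((m + 1 : ℕ) : ℝ≥0∞) * μH[(m : ℝ)] (frontier Ω)) ^ (((m : ℝ) + 1) / m) := by
  classical
  set O : Set (Fin (m + 1) → ℝ) := WithLp.toLp 2 ⁻¹' Ω with hO
  have hOo : IsOpen O := ho.preimage (PiLp.continuous_toLp 2 _)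
  have hvol : volume Ω = volume O :=
    ((PiLp.volume_preserving_toLp (Fin (m + 1))).measure_preimage
      ho.measurableSet.nullMeasurableSet).symm
  let A : Fin (m + 1) → Set (Fin m → ℝ) := fun i => (fun x => i.removeNth x) '' O
  have hAo : ∀ i, IsOpen (A i) := fun i => by
    have : A i = ⋃ t : ℝ, (fun w => (i.insertNth t w : Fin (m + 1) → ℝ)) ⁻¹' O := by
      ext w
      simp only [A, mem_image, mem_iUnion, mem_preimage]
      constructor
      · rintro ⟨x, hx, rfl⟩
        exact ⟨x i, by rwa [Fin.insertNth_self_removeNth]⟩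
      · rintro ⟨t, ht⟩
        exact ⟨_, ht, by simp⟩
    rw [this]
    exact isOpen_iUnion fun t => hOo.preimage
      (continuous_const.finInsertNth i continuous_id)
  have hAvol : ∀ i, volume (A i) ≤ μH[(m : ℝ)] (frontier Ω) := fun i => by
    refine le_trans (measure_mono ?_) (volume_image_removeNth_le i (frontier Ω))
    rintro _ ⟨x, hx, rfl⟩
    obtain ⟨t, -, ht⟩ := exists_frontier_mem_line hb (x := WithLp.toLp 2 x)
      (v := EuclideanSpace.single i (1 : ℝ)) hx (by simp)
    refine ⟨_, ht, ?_⟩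
    ext j
    simp [Fin.removeNth, Fin.succAbove_ne]
  let f : (Fin (m + 1) → ℝ) → ℝ≥0∞ := fun x =>
    ∑ i, (A i).indicator 1 (i.removeNth x) * (Icc (0 : ℝ) 1).indicator 1 (x i)
  have hmeasA : ∀ i, Measurable ((A i).indicator (1 : (Fin m → ℝ) → ℝ≥0∞)) := fun i =>
    measurable_one.indicator (hAo i).measurableSet
  have hmeasI : Measurable ((Icc (0 : ℝ) 1).indicator (1 : ℝ → ℝ≥0∞)) :=
    measurable_one.indicator measurableSet_Icc
  have hrem : ∀ i : Fin (m + 1), Measurable fun x : Fin (m + 1) → ℝ => i.removeNth x := fun i =>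
    measurable_pi_lambda _ fun j => measurable_pi_apply _
  have hf : Measurable f := Finset.measurable_sum _ fun i _ =>
    ((hmeasA i).comp (hrem i)).mul (hmeasI.comp (measurable_pi_apply i))
  have hm0 : (0 : ℝ) < m := by exact_mod_cast hm
  have hp : Real.HolderConjugate (Fintype.card (Fin (m + 1)) : ℝ) (((m : ℝ) + 1) / m) := by
    rw [Fintype.card_fin, Real.holderConjugate_iff]
    push_cast
    constructor
    · linarith
    · field_simp
      ring
  have key := lintegral_prod_lintegral_pow_le (fun _ : Fin (m + 1) => (volume : Measure ℝ)) hp hf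
  rw [← volume_pi] at key
  have hlint : ∫⁻ x, f x ≤ ((m + 1 : ℕ) : ℝ≥0∞) * μH[(m : ℝ)] (frontier Ω) := by
    have hmeas : ∀ i ∈ (Finset.univ : Finset (Fin (m + 1))),
        Measurable fun x : Fin (m + 1) → ℝ =>
          (A i).indicator (1 : (Fin m → ℝ) → ℝ≥0∞) (i.removeNth x) *
            (Icc (0 : ℝ) 1).indicator (1 : ℝ → ℝ≥0∞) (x i) := fun i _ =>
      ((hmeasA i).comp (hrem i)).mul (hmeasI.comp (measurable_pi_apply i))
    change ∫⁻ x, ∑ i, (A i).indicator 1 (i.removeNth x) * (Icc (0 : ℝ) 1).indicator 1 (x i) ≤ _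
    rw [lintegral_finsetSum _ hmeas]
    refine (Finset.sum_le_card_nsmul _ _ (μH[(m : ℝ)] (frontier Ω)) fun i _ => ?_).trans
      (by simp)
    refine le_trans (le_of_eq ?_) (hAvol i)
    have hmp := volume_preserving_piFinSuccAbove (fun _ : Fin (m + 1) => ℝ) i
    have hmz : Measurable fun z : ℝ × (Fin m → ℝ) =>
        (A i).indicator (1 : (Fin m → ℝ) → ℝ≥0∞) z.2 *
          (Icc (0 : ℝ) 1).indicator (1 : ℝ → ℝ≥0∞) z.1 :=
      ((hmeasA i).comp measurable_snd).mul (hmeasI.comp measurable_fst)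
    refine (Eq.trans ?_ (hmp.lintegral_comp hmz)).trans ?_
    · rfl
    · rw [Measure.volume_eq_prod, lintegral_prod _ hmz.aemeasurable]
      simp_rw [lintegral_mul_const _ (hmeasA i), lintegral_indicator_one (hAo i).measurableSet]
      rw [lintegral_const_mul _ hmeasI, lintegral_indicator_one measurableSet_Icc]
      simp
  rw [hvol]
  calc volume O = ∫⁻ x, O.indicator 1 x := (lintegral_indicator_one hOo.measurableSet).symm
    _ ≤ _ := lintegral_mono fun x => ?_
    _ ≤ _ := key
    _ ≤ _ := by gcongr
  by_cases hx : x ∈ O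
  · rw [indicator_of_mem hx]
    refine Finset.one_le_prod' fun i _ => ?_
    refine ENNReal.one_le_rpow ?_ (by
      rw [Fintype.card_fin]; push_cast; simpa using hm0)
    calc (1 : ℝ≥0∞) = ∫⁻ t, (Icc (0 : ℝ) 1).indicator 1 t := by
          rw [lintegral_indicator_one measurableSet_Icc]; simp
      _ ≤ _ := lintegral_mono fun t => ?_
    refine le_trans ?_ (Finset.single_le_sum (fun _ _ => bot_le) (Finset.mem_univ i))
    have hmem : i.removeNth x ∈ A i := ⟨x, hx, rfl⟩
    simp [Fin.removeNth_update, indicator_of_mem hmem]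
  · rw [indicator_of_notMem hx]; exact bot_le

end Isoperimetric

section RayleighQuotient

theorem integrableOn_of_continuous_of_isCompact {X : Type*} [TopologicalSpace X]
    [MeasurableSpace X] [BorelSpace X] [T2Space X] {μ : Measure X} {s : Set X} (hs : IsCompact s)
    (hμ : μ s ≠ ⊤) {f : X → ℝ} (hf : Continuous f) : IntegrableOn f s μ := by
  obtain ⟨C, hC⟩ := hs.exists_bound_of_continuousOn hf.continuousOn
  exact Measure.integrableOn_of_bounded hμ hf.aestronglyMeasurable
    ((ae_restrict_iff' hs.measurableSet).2 (ae_of_all _ hC))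

variable {n : ℕ} {Ω : Set (EuclideanSpace ℝ (Fin n))}

theorem stekSigma1_nonneg (Ω : Set (EuclideanSpace ℝ (Fin n))) : 0 ≤ stekSigma1 Ω := by
  refine Real.sInf_nonneg ?_
  rintro q ⟨f, -, -, h, rfl⟩
  exact div_nonneg (integral_nonneg fun _ => sq_nonneg _) h.le

theorem normSigma1_nonneg (Ω : Set (EuclideanSpace ℝ (Fin n))) : 0 ≤ normSigma1 Ω :=
  mul_nonneg (stekSigma1_nonneg Ω) (by positivity)

theorem stekSigma1_mul_le (hb : Bornology.IsBounded Ω)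
    (hfin : μH[(n : ℝ) - 1] (frontier Ω) ≠ ⊤) (h0 : μH[(n : ℝ) - 1] (frontier Ω) ≠ 0)
    {f : EuclideanSpace ℝ (Fin n) → ℝ} (hf : ContDiff ℝ (⊤ : ℕ∞) f) :
    stekSigma1 Ω * ((∫ x in frontier Ω, (f x) ^ 2 ∂(μH[(n : ℝ) - 1])) -
      (∫ x in frontier Ω, f x ∂(μH[(n : ℝ) - 1])) ^ 2 / (μH[(n : ℝ) - 1]).real (frontier Ω)) ≤
      ∫ x in Ω, ‖gradient f x‖ ^ 2 := by
  set μ : Measure (EuclideanSpace ℝ (Fin n)) := μH[(n : ℝ) - 1]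
  have hK : IsCompact (frontier Ω) := hb.isCompact_closure.of_isClosed_subset isClosed_frontier
    frontier_subset_closure
  set M := μ.real (frontier Ω) with hM
  have hM0 : 0 < M := ENNReal.toReal_pos h0 hfin
  set a := ∫ x in frontier Ω, f x ∂μ with ha
  set V := (∫ x in frontier Ω, (f x) ^ 2 ∂μ) - a ^ 2 / M with hV
  have hgrad : 0 ≤ ∫ x in Ω, ‖gradient f x‖ ^ 2 := integral_nonneg fun _ => sq_nonneg _
  rcases le_or_gt V 0 with h | h
  · exact (mul_nonpos_of_nonneg_of_nonpos (stekSigma1_nonneg Ω) h).trans hgrad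
  have hi1 : IntegrableOn f (frontier Ω) μ :=
    integrableOn_of_continuous_of_isCompact hK hfin hf.continuous
  have hi2 : IntegrableOn (fun x => f x ^ 2) (frontier Ω) μ :=
    integrableOn_of_continuous_of_isCompact hK hfin (hf.continuous.pow 2)
  have hic : ∀ c : ℝ, IntegrableOn (fun _ => c) (frontier Ω) μ := fun c =>
    integrableOn_of_continuous_of_isCompact hK hfin continuous_const
  have hc : ∀ c : ℝ, ∫ x in frontier Ω, c ∂μ = c * M := fun c => by
    rw [setIntegral_const, smul_eq_mul, mul_comm]
  have hm : ∫ x in frontier Ω, (f x - a / M) ∂μ = 0 := by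
    rw [integral_sub hi1 (hic _), hc]
    field_simp
    simp [ha]
  have hv : ∫ x in frontier Ω, (f x - a / M) ^ 2 ∂μ = V := by
    have : ∀ x, (f x - a / M) ^ 2 = f x ^ 2 - (2 * (a / M)) * f x + (a / M) ^ 2 := fun x => by ring
    simp_rw [this]
    have hi3 : IntegrableOn (fun x => 2 * (a / M) * f x) (frontier Ω) μ := hi1.const_mul _
    have hi4 : IntegrableOn (fun x => f x ^ 2 - 2 * (a / M) * f x) (frontier Ω) μ := hi2.sub hi3
    rw [integral_add hi4 (hic _), integral_sub hi2 hi3,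
      integral_const_mul, hc, hV]
    field_simp
    ring
  have hle : stekSigma1 Ω ≤ (∫ x in Ω, ‖gradient f x‖ ^ 2) / V := by
    refine csInf_le ⟨0, ?_⟩ ⟨fun x => f x - a / M, hf.sub contDiff_const, hm, hv ▸ h, ?_⟩
    · rintro q ⟨f, -, -, h, rfl⟩
      exact div_nonneg (integral_nonneg fun _ => sq_nonneg _) h.le
    · rw [hv]
      simp [gradient, fderiv_sub_const]
  rwa [le_div_iff₀ h] at hle

end RayleighQuotient

section Concentration

theorem exists_cover_closedBall (X : Type*) [NormedAddCommGroup X] [NormedSpace ℝ X]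
    [FiniteDimensional ℝ X] : ∃ K : ℕ, 0 < K ∧ ∀ (x : X) (r : ℝ), 0 < r →
      ∃ t : Finset X, t.card ≤ K ∧ closedBall x (2 * r) ⊆ ⋃ y ∈ t, closedBall y (r / 2) := by
  obtain ⟨t, -, htf, ht⟩ := (isCompact_closedBall (0 : X) 2).finite_cover_balls
    (e := 1 / 2) (by norm_num)
  lift t to Finset X using htf
  refine ⟨t.card + 1, Nat.succ_pos _, fun x r hr => ?_⟩
  classical
  refine ⟨t.image fun y => x + r • y, Finset.card_image_le.trans (Nat.le_succ _), fun z hz => ?_⟩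
  have h1 : r⁻¹ • (z - x) ∈ closedBall (0 : X) 2 := by
    rw [mem_closedBall_zero_iff, norm_smul, norm_inv, Real.norm_of_nonneg hr.le,
      inv_mul_le_iff₀ hr, mul_comm]
    rwa [mem_closedBall, dist_eq_norm] at hz
  obtain ⟨y, hy, hyz⟩ := mem_iUnion₂.1 (ht h1)
  refine mem_iUnion₂.2 ⟨x + r • y, Finset.mem_image_of_mem _ hy, ?_⟩
  rw [mem_ball, dist_eq_norm] at hyz
  rw [mem_closedBall, dist_eq_norm]
  have : z - (x + r • y) = r • (r⁻¹ • (z - x) - y) := by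
    rw [smul_sub, smul_inv_smul₀ hr.ne']; abel
  rw [this, norm_smul, Real.norm_of_nonneg hr.le]
  nlinarith

theorem exists_concentration_ball {X : Type*} [MetricSpace X] [ProperSpace X]
    [MeasurableSpace X] [BorelSpace X] (ν : Measure X) [IsFiniteMeasure ν] [NullSingletonClass ν]
    {x₀ : X} {R : ℝ} (hR : 0 < R) (hν : ν (closedBall x₀ R)ᶜ = 0) {c : ℝ≥0∞} (hc0 : c ≠ 0)
    (hc : c ≤ ν univ) :
    ∃ (x : X) (r : ℝ), 0 < r ∧ c ≤ ν (closedBall x r) ∧ ∀ y, ν (closedBall y (r / 2)) < c := by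
  classical
  have hloc : ∀ x : X, ∃ ε > 0, ν (closedBall x ε) < c := fun x => by
    have h1 : Tendsto (fun k : ℕ => ν (closedBall x (1 / ((k : ℝ) + 1)))) atTop
        (𝓝 (ν (⋂ k : ℕ, closedBall x (1 / ((k : ℝ) + 1))))) := by
      refine tendsto_measure_iInter_atTop (fun k => measurableSet_closedBall.nullMeasurableSet)
        (fun i j hij => closedBall_subset_closedBall ?_) ⟨0, measure_ne_top _ _⟩
      exact Nat.one_div_le_one_div hij
    have h2 : (⋂ k : ℕ, closedBall x (1 / ((k : ℝ) + 1))) = {x} := by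
      refine Subset.antisymm (fun y hy => ?_) ?_
      · have h3 : dist y x ≤ 0 := ge_of_tendsto' tendsto_one_div_add_atTop_nhds_zero_nat
          fun k => mem_closedBall.1 (mem_iInter.1 hy k)
        exact dist_le_zero.1 h3
      · rintro y rfl
        exact mem_iInter.2 fun k => mem_closedBall_self (by positivity)
    rw [h2, measure_singleton] at h1
    obtain ⟨k, hk⟩ := (h1.eventually_lt_const (pos_iff_ne_zero.2 hc0)).exists
    exact ⟨_, by positivity, hk⟩
  choose ε hε hεc using hloc
  obtain ⟨δ, hδ, hleb⟩ := lebesgue_number_lemma_of_metric (isCompact_closedBall x₀ (R + 1))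
    (c := fun x => ball x (ε x)) (fun x => isOpen_ball)
    (fun x _ => mem_iUnion.2 ⟨x, mem_ball_self (hε x)⟩)
  have hsmall : ∀ r : ℝ, r < δ → r ≤ 1 → ∀ y, ν (closedBall y r) < c := by
    intro r hrδ hr1 y
    by_cases hy : y ∈ closedBall x₀ (R + 1)
    · obtain ⟨i, hi⟩ := hleb y hy
      exact (measure_mono (((closedBall_subset_ball hrδ).trans hi).trans
        ball_subset_closedBall)).trans_lt (hεc i)
    · refine lt_of_le_of_lt (measure_mono fun z hz => ?_) (hν.trans_lt (pos_iff_ne_zero.2 hc0))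
      intro hzR
      apply hy
      rw [mem_closedBall] at *
      linarith [dist_triangle_left y x₀ z]
  have hex : ∃ k : ℕ, ∀ y, ν (closedBall y (R / 2 ^ k)) < c := by
    have : Tendsto (fun k : ℕ => R * (1 / 2 : ℝ) ^ k) atTop (𝓝 (R * 0)) :=
      (tendsto_pow_atTop_nhds_zero_of_lt_one (by norm_num) (by norm_num)).const_mul R
    rw [mul_zero] at this
    obtain ⟨k, hk⟩ := (this.eventually_lt_const (lt_min hδ one_pos)).exists
    refine ⟨k, hsmall _ ?_ ?_⟩
    · simpa [div_eq_mul_inv] using hk.trans_le (min_le_left _ _)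
    · simpa [div_eq_mul_inv] using (hk.trans_le (min_le_right _ _)).le
  have h0 : Nat.find hex ≠ 0 := fun h => by
    have h1 := Nat.find_spec hex x₀
    rw [h, pow_zero, div_one] at h1
    refine h1.not_ge (hc.trans ?_)
    rw [← union_compl_self (closedBall x₀ R)]
    exact (measure_union_le _ _).trans (by rw [hν, add_zero])
  obtain ⟨k, hk⟩ := Nat.exists_eq_succ_of_ne_zero h0
  have hnot := Nat.find_min hex (m := k) (by omega)
  push Not at hnot
  obtain ⟨x, hx⟩ := hnot
  refine ⟨x, R / 2 ^ k, by positivity, hx, ?_⟩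
  have := Nat.find_spec hex
  rw [hk] at this
  intro y
  have h2 := this y
  rwa [Nat.succ_eq_add_one, pow_succ, ← div_div] at h2

end Concentration

section UpperBound

theorem norm_gradient_eq {F : Type*} [NormedAddCommGroup F] [InnerProductSpace ℝ F]
    [CompleteSpace F] (f : F → ℝ) (x : F) : ‖gradient f x‖ = ‖fderiv ℝ f x‖ := by
  simp [gradient]

theorem exists_scaled_cutoff (X : Type*) [NormedAddCommGroup X] [InnerProductSpace ℝ X]
    [FiniteDimensional ℝ X] : ∃ L : ℝ, 0 < L ∧ ∀ (x : X) (r : ℝ), 0 < r →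
      ∃ φ : X → ℝ, ContDiff ℝ (⊤ : ℕ∞) φ ∧ (∀ y, 0 ≤ φ y) ∧ (∀ y, φ y ≤ 1) ∧
        (∀ y ∈ closedBall x r, φ y = 1) ∧ (∀ y ∉ closedBall x (2 * r), φ y = 0) ∧
        ∀ y, ‖fderiv ℝ φ y‖ ≤ L / r := by
  let b : ContDiffBump (0 : X) := ⟨1, 2, one_pos, one_lt_two⟩
  have hb : ContDiff ℝ (⊤ : ℕ∞) b := b.contDiff
  obtain ⟨L, hL⟩ := (b.hasCompactSupport.fderiv (𝕜 := ℝ)).exists_bound_of_continuous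
    (hb.continuous_fderiv (by simp))
  refine ⟨|L| + 1, by positivity, fun x r hr => ⟨fun y => b (r⁻¹ • (y - x)), ?_, fun y => b.nonneg,
    fun y => b.le_one, fun y hy => b.one_of_mem_closedBall ?_, fun y hy => b.zero_of_le_dist ?_,
    fun y => ?_⟩⟩
  · exact hb.comp ((contDiff_id.sub contDiff_const).const_smul _)
  · rw [mem_closedBall, dist_eq_norm] at hy
    rw [mem_closedBall_zero_iff, norm_smul, norm_inv, Real.norm_of_nonneg hr.le,
      inv_mul_le_iff₀ hr]
    simpa [b] using hy
  · rw [mem_closedBall, dist_eq_norm, not_le] at hy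
    rw [dist_zero_right, norm_smul, norm_inv, Real.norm_of_nonneg hr.le, le_inv_mul_iff₀ hr]
    simp only [b]
    linarith
  · have h1 : HasFDerivAt (fun y : X => r⁻¹ • (y - x)) (r⁻¹ • ContinuousLinearMap.id ℝ X) y :=
      ((hasFDerivAt_id y).sub_const x).const_smul _
    have h2 := ((hb.differentiable (by simp)) (r⁻¹ • (y - x))).hasFDerivAt.comp y h1
    have h3 : fderiv ℝ (fun y => b (r⁻¹ • (y - x))) y = r⁻¹ • fderiv ℝ b (r⁻¹ • (y - x)) := by
      refine Eq.trans h2.fderiv ?_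
      ext v
      simp
    rw [h3, norm_smul, norm_inv, Real.norm_of_nonneg hr.le, div_eq_inv_mul]
    gcongr
    exact (hL _).trans (by linarith [le_abs_self L])

theorem sub_sq_div_ge {X : Type*} [MeasurableSpace X] {ν : Measure X} [IsFiniteMeasure ν]
    {φ : X → ℝ} {B : Set X} (hB : MeasurableSet B) (h1 : Integrable φ ν)
    (h2 : Integrable (fun y => φ y ^ 2) ν) (h0 : ∀ y ∉ B, φ y = 0) (hM : 0 < ν.real univ)
    (hν : ν.real B ≤ ν.real univ / 2) :
    (∫ y, φ y ^ 2 ∂ν) / 2 ≤ (∫ y, φ y ^ 2 ∂ν) - (∫ y, φ y ∂ν) ^ 2 / ν.real univ := by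
  set a := ∫ y, φ y ∂ν
  set M := ν.real univ
  set t := 2 * a / M with ht
  have hI : Integrable (fun y => 2 * t * φ y - B.indicator (fun _ => t ^ 2) y) ν :=
    (h1.const_mul _).sub ((integrable_const _).indicator hB)
  have key : ∫ y, (2 * t * φ y - B.indicator (fun _ => t ^ 2) y) ∂ν ≤ ∫ y, φ y ^ 2 ∂ν := by
    refine integral_mono hI h2 fun y => ?_
    by_cases hy : y ∈ B
    · simp only [indicator_of_mem hy]
      nlinarith [sq_nonneg (φ y - t)]
    · simp [indicator_of_notMem hy, h0 y hy]
  rw [integral_sub (h1.const_mul _) ((integrable_const _).indicator hB), integral_const_mul,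
    integral_indicator_const _ hB, smul_eq_mul] at key
  have h3 : ν.real B * t ^ 2 ≤ M / 2 * t ^ 2 := by gcongr
  have h4 : 2 * t * a - M / 2 * t ^ 2 = 2 * (a ^ 2 / M) := by
    rw [ht]; field_simp; ring
  linarith

theorem exists_normSigma1_le {m : ℕ} (hm : 1 ≤ m) : ∃ C : ℝ,
    ∀ Ω : Set (EuclideanSpace ℝ (Fin (m + 1))), IsOpen Ω → Bornology.IsBounded Ω →
      normSigma1 Ω ≤ C := by
  obtain ⟨K, hK0, hK⟩ := exists_cover_closedBall (EuclideanSpace ℝ (Fin (m + 1)))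
  obtain ⟨L, hL0, hL⟩ := exists_scaled_cutoff (EuclideanSpace ℝ (Fin (m + 1)))
  set κ : ℝ := volume.real (closedBall (0 : EuclideanSpace ℝ (Fin (m + 1))) 1) with hκ
  set C₁ : ℝ := ((m : ℝ) + 1) ^ (((m : ℝ) + 1) / m) with hC₁
  have hm0 : (0 : ℝ) < m := by exact_mod_cast hm
  have hC₁0 : 0 < C₁ := by positivity
  have hκ0 : 0 ≤ κ := measureReal_nonneg
  refine ⟨4 * K * L ^ 2 * (C₁ + κ * 2 ^ (m + 1)), fun Ω ho hb => ?_⟩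
  have hd : (((m + 1 : ℕ) : ℝ) - 1) = m := by push_cast; ring
  by_cases htriv : (μH[(m : ℝ)] (frontier Ω)) = 0 ∨ (μH[(m : ℝ)] (frontier Ω)) = ⊤
  · have : normSigma1 Ω = 0 := by
      rw [normSigma1, hd]
      rcases htriv with h | h <;> simp [h, hm0.ne']
    rw [this]
    positivity
  push Not at htriv
  obtain ⟨h0, hfin⟩ := htriv
  set μ : Measure (EuclideanSpace ℝ (Fin (m + 1))) := μH[(m : ℝ)] with hμ
  set ν := μ.restrict (frontier Ω) with hν
  have hfr : IsCompact (frontier Ω) := hb.isCompact_closure.of_isClosed_subset isClosed_frontier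
    frontier_subset_closure
  have hνu : ν univ = μ (frontier Ω) := Measure.restrict_apply_univ _
  have : IsFiniteMeasure ν := ⟨by rw [hνu]; exact hfin.lt_top⟩
  have : NullSingletonClass μ := Measure.nullSingletonClass_hausdorff _ hm0
  obtain ⟨R, hR0, hR⟩ : ∃ R : ℝ, 0 < R ∧ frontier Ω ⊆ closedBall 0 R := by
    obtain ⟨R, hR⟩ := hfr.isBounded.subset_closedBall 0
    exact ⟨|R| + 1, by positivity, hR.trans (closedBall_subset_closedBall
      (by linarith [le_abs_self R]))⟩
  have hKinv : (K : ℝ≥0∞)⁻¹ * K = 1 :=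
    ENNReal.inv_mul_cancel (by exact_mod_cast hK0.ne') (ENNReal.natCast_ne_top K)
  obtain ⟨x, r, hr, hx, hsmall⟩ := exists_concentration_ball ν hR0 (x₀ := 0)
    (by rw [Measure.restrict_apply measurableSet_closedBall.compl, ← sdiff_eq_compl_inter,
          sdiff_eq_empty.2 hR, measure_empty])
    (c := ν univ / 2 * (K : ℝ≥0∞)⁻¹)
    (mul_ne_zero (ENNReal.div_ne_zero.2 ⟨hνu ▸ h0, by simp⟩) (by simp))
    (by
      calc ν univ / 2 * (K : ℝ≥0∞)⁻¹ ≤ ν univ * 1 := by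
            gcongr
            · exact ENNReal.half_le_self
            · exact ENNReal.inv_le_one.2 (by exact_mod_cast hK0)
        _ = ν univ := mul_one _)
  obtain ⟨t, htc, ht⟩ := hK x r hr
  have hbig : ν (closedBall x (2 * r)) ≤ ν univ / 2 := by
    calc ν (closedBall x (2 * r)) ≤ ∑ y ∈ t, ν (closedBall y (r / 2)) :=
          (measure_mono ht).trans (measure_biUnion_finset_le _ _)
      _ ≤ t.card • (ν univ / 2 * (K : ℝ≥0∞)⁻¹) :=
          Finset.sum_le_card_nsmul _ _ _ fun y _ => (hsmall y).le
      _ ≤ K * (ν univ / 2 * (K : ℝ≥0∞)⁻¹) := by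
          rw [nsmul_eq_mul]
          gcongr
      _ = ν univ / 2 := by
          rw [mul_comm, mul_assoc, hKinv, mul_one]
  set M := ν.real univ with hM
  have hM0 : 0 < M := ENNReal.toReal_pos (hνu ▸ h0) (measure_ne_top _ _)
  have hbig' : ν.real (closedBall x (2 * r)) ≤ M / 2 := by
    have := ENNReal.toReal_mono (by simp [ENNReal.div_eq_top, measure_ne_top]) hbig
    simpa [Measure.real, hM, ENNReal.toReal_div] using this
  have hx' : M / (2 * K) ≤ ν.real (closedBall x r) := by
    have := ENNReal.toReal_mono (measure_ne_top _ _) hx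
    simpa [Measure.real, hM, ENNReal.toReal_div, ENNReal.toReal_mul, div_eq_mul_inv, mul_assoc,
      mul_comm, mul_left_comm]
      using this
  obtain ⟨φ, hφ, hφ0, hφ1, hφin, hφout, hφL⟩ := hL x r hr
  have hi1 : Integrable φ ν := integrableOn_of_continuous_of_isCompact hfr hfin hφ.continuous
  have hi2 : Integrable (fun y => φ y ^ 2) ν :=
    integrableOn_of_continuous_of_isCompact hfr hfin (hφ.continuous.pow 2)
  have hlow : M / (2 * K) ≤ ∫ y, φ y ^ 2 ∂ν := by
    refine hx'.trans ?_
    rw [← one_mul (ν.real (closedBall x r)), mul_comm, ← smul_eq_mul,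
      ← integral_indicator_const _ measurableSet_closedBall]
    refine integral_mono ((integrable_const _).indicator measurableSet_closedBall) hi2 fun y => ?_
    by_cases hy : y ∈ closedBall x r
    · simp [indicator_of_mem hy, hφin y hy]
    · simp only [indicator_of_notMem hy]; positivity
  have hvar := sub_sq_div_ge measurableSet_closedBall hi1 hi2 hφout hM0 hbig'
  have hmain := stekSigma1_mul_le hb (by rw [hd]; exact hfin) (by rw [hd]; exact h0) hφ
  rw [hd] at hmain
  have hMμ : M = μ.real (frontier Ω) := by rw [hM, Measure.real, hνu, Measure.real]
  rw [← hμ, ← hMμ] at hmain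
  set σ := stekSigma1 Ω with hσ
  have hσ0 : 0 ≤ σ := stekSigma1_nonneg Ω
  set a : ℝ := M ^ (1 / (m : ℝ)) with ha
  have ha0 : 0 < a := by positivity
  have hvolΩ : volume.real Ω ≤ C₁ * a ^ (m + 1) := by
    have h1 := volume_le_frontier_rpow hm ho hb
    rw [← hμ, ← hνu] at h1
    have h2 := ENNReal.toReal_mono (ENNReal.rpow_ne_top_of_nonneg (by positivity)
      (ENNReal.mul_ne_top (ENNReal.natCast_ne_top _) (measure_ne_top _ _))) h1
    rw [← ENNReal.toReal_rpow, ENNReal.toReal_mul, Real.mul_rpow (by simp) (by simp)] at h2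
    refine h2.trans (le_of_eq ?_)
    rw [hC₁, ha, ← Real.rpow_natCast (M ^ _), ← Real.rpow_mul hM0.le]
    rw [ENNReal.toReal_natCast]
    congr 2
    · push_cast; ring
    · push_cast; field_simp
  have hvolB : volume.real (closedBall x (2 * r)) = κ * 2 ^ (m + 1) * r ^ (m + 1) := by
    rw [Measure.real, Measure.addHaar_closedBall' _ _ (by positivity), ENNReal.toReal_mul,
      ENNReal.toReal_ofReal (by positivity), hκ, Measure.real, finrank_euclideanSpace_fin]
    ring
  have hgr : ∫ y in Ω, ‖gradient φ y‖ ^ 2 ≤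
      (L / r) ^ 2 * volume.real (Ω ∩ closedBall x (2 * r)) := by
    rw [setIntegral_eq_of_subset_of_forall_sdiff_eq_zero ho.measurableSet
      (inter_subset_left (t := closedBall x (2 * r)))]
    · have hlt : volume (Ω ∩ closedBall x (2 * r)) < ⊤ :=
        (measure_mono inter_subset_left).trans_lt hb.measure_lt_top
      have := norm_setIntegral_le_of_norm_le_const (f := fun y => ‖gradient φ y‖ ^ 2)
        (C := (L / r) ^ 2) hlt (fun y _ => by
          rw [norm_pow, norm_norm, norm_gradient_eq]
          gcongr
          exact hφL y)
      exact (le_abs_self _).trans this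
    · rintro y ⟨hy1, hy2⟩
      have hy : y ∉ closedBall x (2 * r) := fun h => hy2 ⟨hy1, h⟩
      have : φ =ᶠ[𝓝 y] fun _ => 0 := by
        filter_upwards [isClosed_closedBall.isOpen_compl.mem_nhds hy] with z hz using hφout z hz
      rw [norm_gradient_eq, this.fderiv_eq]
      simp
  have hσM : σ * (M / (4 * K)) ≤ (L / r) ^ 2 * volume.real (Ω ∩ closedBall x (2 * r)) := by
    refine le_trans ?_ (hmain.trans hgr)
    refine mul_le_mul_of_nonneg_left (le_trans ?_ hvar) hσ0
    refine le_trans (le_of_eq ?_) (div_le_div_of_nonneg_right hlow two_pos.le)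
    field_simp
    norm_num
  have hvol2 : volume.real (Ω ∩ closedBall x (2 * r)) ≤
      (C₁ + κ * 2 ^ (m + 1)) * (r ^ 2 * a ^ (m - 1)) := by
    obtain ⟨k, rfl⟩ : ∃ k, m = k + 1 := ⟨m - 1, by omega⟩
    rw [Nat.add_sub_cancel]
    rcases le_total r a with h | h
    · calc _ ≤ volume.real (closedBall x (2 * r)) :=
            measureReal_mono inter_subset_right measure_closedBall_lt_top.ne
        _ = κ * 2 ^ (k + 1 + 1) * (r ^ 2 * r ^ k) := by rw [hvolB]; ring
        _ ≤ _ := by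
            gcongr
            linarith
    · calc _ ≤ volume.real Ω := measureReal_mono inter_subset_left hb.measure_lt_top.ne
        _ ≤ C₁ * (a ^ 2 * a ^ k) := hvolΩ.trans (le_of_eq (by ring))
        _ ≤ _ := by
            gcongr
            linarith [show 0 ≤ κ * 2 ^ (k + 1 + 1) by positivity]
  have hMa : M = a ^ (m - 1) * a := by
    rw [← pow_succ, Nat.sub_add_cancel hm, ha, ← Real.rpow_natCast, ← Real.rpow_mul hM0.le,
      one_div_mul_cancel hm0.ne', Real.rpow_one]
  have hfinal : normSigma1 Ω = σ * a := by
    rw [normSigma1, hd, ha, hMμ]; rfl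
  rw [hfinal]
  have h5 : σ * (M / (4 * K)) ≤ (L / r) ^ 2 * ((C₁ + κ * 2 ^ (m + 1)) * (r ^ 2 * a ^ (m - 1))) :=
    hσM.trans (by gcongr)
  have hK1 : (0 : ℝ) < K := by exact_mod_cast hK0
  have hP : 0 < a ^ (m - 1) := by positivity
  have h6 : (L / r) ^ 2 * ((C₁ + κ * 2 ^ (m + 1)) * (r ^ 2 * a ^ (m - 1))) =
      L ^ 2 * (C₁ + κ * 2 ^ (m + 1)) * a ^ (m - 1) := by
    field_simp
  rw [h6] at h5
  nth_rw 1 [hMa] at h5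
  have h7 : σ * a / (4 * K) * a ^ (m - 1) ≤ L ^ 2 * (C₁ + κ * 2 ^ (m + 1)) * a ^ (m - 1) := by
    refine le_trans (le_of_eq ?_) h5
    ring
  have h8 := le_of_mul_le_mul_right h7 hP
  rw [div_le_iff₀ (by positivity)] at h8
  linarith

end UpperBound

section OneDimensional

theorem sq_lintegral_mul_le {X : Type*} [MeasurableSpace X] {μ : Measure X} {f g : X → ℝ≥0∞}
    (hf : AEMeasurable f μ) (hg : AEMeasurable g μ) :
    (∫⁻ x, f x * g x ∂μ) ^ 2 ≤ (∫⁻ x, f x ^ 2 ∂μ) * ∫⁻ x, g x ^ 2 ∂μ := by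
  have h := ENNReal.lintegral_mul_le_Lp_mul_Lq μ Real.HolderConjugate.two_two hf hg
  have h2 := pow_le_pow_left₀ bot_le h 2
  have e : ∀ a : ℝ≥0∞, (a ^ (2⁻¹ : ℝ)) ^ 2 = a := fun a => by
    rw [← ENNReal.rpow_natCast, ← ENNReal.rpow_mul]; norm_num
  simpa [mul_pow, e] using h2

theorem enorm_add_sq_le {a b : ℝ≥0∞} : (a + b) ^ 2 ≤ 2 * a ^ 2 + 2 * b ^ 2 := by
  rcases eq_or_ne a ⊤ with rfl | ha
  · simp
  rcases eq_or_ne b ⊤ with rfl | hb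
  · simp
  lift a to ℝ≥0 using ha
  lift b to ℝ≥0 using hb
  norm_cast
  rw [← NNReal.coe_le_coe]
  push_cast
  nlinarith [sq_nonneg ((a : ℝ) - b)]

theorem enorm_sq_le_weighted {u u' : ℝ → ℝ} (hu : ∀ t, HasDerivAt u (u' t) t)
    (hc : Continuous u') {w : ℝ → ℝ≥0∞} (hw : Measurable w) {a b : ℝ} (hab : a ≤ b)
    (hw0 : ∀ t ∈ Ioc a b, w t ≠ 0 ∧ w t ≠ ⊤) :
    ‖u a‖ₑ ^ 2 ≤ 2 * ‖u b‖ₑ ^ 2 +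
      2 * ((∫⁻ t in Ioc a b, (w t)⁻¹ ^ 2) * ∫⁻ t in Ioc a b, (w t * ‖u' t‖ₑ) ^ 2) := by
  have h1 : u b - u a = ∫ t in a..b, u' t :=
    (intervalIntegral.integral_eq_sub_of_hasDerivAt (fun t _ => hu t)
      (hc.intervalIntegrable a b)).symm
  have h2 : ‖u b - u a‖ₑ ≤ ∫⁻ t in Ioc a b, (w t)⁻¹ * (w t * ‖u' t‖ₑ) := by
    rw [h1, intervalIntegral.integral_of_le hab]
    refine (enorm_integral_le_lintegral_enorm _).trans (le_of_eq ?_)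
    refine setLIntegral_congr_fun measurableSet_Ioc fun t ht => ?_
    rw [← mul_assoc, ENNReal.inv_mul_cancel (hw0 t ht).1 (hw0 t ht).2, one_mul]
  have hcm : Measurable fun t => ‖u' t‖ₑ := hc.measurable.enorm
  have h3 := sq_lintegral_mul_le (μ := volume.restrict (Ioc a b)) hw.inv.aemeasurable
    (hw.mul hcm).aemeasurable
  have h4 : ‖u a‖ₑ ≤ ‖u b‖ₑ + ‖u b - u a‖ₑ := by
    have : u a = u b - (u b - u a) := by ring
    conv_lhs => rw [this]
    exact enorm_sub_le
  calc ‖u a‖ₑ ^ 2 ≤ (‖u b‖ₑ + ‖u b - u a‖ₑ) ^ 2 := by gcongr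
    _ ≤ 2 * ‖u b‖ₑ ^ 2 + 2 * ‖u b - u a‖ₑ ^ 2 := enorm_add_sq_le
    _ ≤ _ := by
      gcongr
      exact (pow_le_pow_left₀ bot_le h2 2).trans h3

theorem enorm_sq_le_segment {X : Type*} [NormedAddCommGroup X] [NormedSpace ℝ X] {F : X → ℝ}
    (hF : ContDiff ℝ 1 F) (x v : X) {τ : ℝ} (hτ : 0 ≤ τ) :
    ‖F x‖ₑ ^ 2 ≤ 2 * ‖F (x + τ • v)‖ₑ ^ 2 +
      2 * (ENNReal.ofReal τ * (‖v‖ₑ ^ 2 * ∫⁻ t in Ioc 0 τ, ‖fderiv ℝ F (x + t • v)‖ₑ ^ 2)) := by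
  have hγ : ∀ t : ℝ, HasDerivAt (fun t : ℝ => x + t • v) v t := fun t => by
    simpa using ((hasDerivAt_id t).smul_const v).const_add x
  have hu : ∀ t : ℝ, HasDerivAt (fun t : ℝ => F (x + t • v)) (fderiv ℝ F (x + t • v) v) t :=
    fun t => ((hF.differentiable one_ne_zero) _).hasFDerivAt.comp_hasDerivAt t (hγ t)
  have hdc : Continuous (fderiv ℝ F) := hF.continuous_fderiv one_ne_zero
  have hc : Continuous fun t : ℝ => fderiv ℝ F (x + t • v) v := by fun_prop
  have h := enorm_sq_le_weighted hu hc (w := fun _ => 1) measurable_const hτ (by simp)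
  simp only [zero_smul, add_zero, inv_one, one_pow, one_mul, lintegral_const,
    Measure.restrict_apply MeasurableSet.univ, univ_inter, Real.volume_Ioc, sub_zero] at h
  refine h.trans ?_
  gcongr
  have hm : Measurable fun t : ℝ => ‖fderiv ℝ F (x + t • v)‖ₑ ^ 2 :=
    (Continuous.measurable (by fun_prop : Continuous fun t : ℝ => fderiv ℝ F (x + t • v))).enorm.pow_const
      2
  rw [← lintegral_const_mul _ hm]
  refine lintegral_mono fun t => ?_
  rw [mul_comm, ← mul_pow]
  gcongr
  exact ContinuousLinearMap.le_opENorm _ _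

end OneDimensional

section Friedrichs

theorem exists_first_frontier_mem_line {E : Type*} [NormedAddCommGroup E] [NormedSpace ℝ E]
    {Ω : Set E} (ho : IsOpen Ω) (hb : Bornology.IsBounded Ω) {x v : E} (hx : x ∈ Ω)
    (hv : v ≠ 0) :
    ∃ t : ℝ, 0 ≤ t ∧ x + t • v ∈ frontier Ω ∧ ∀ s, 0 ≤ s → s < t → x + s • v ∈ Ω := by
  have hγ : Continuous fun t : ℝ => x + t • v := by fun_prop
  set S : Set ℝ := Ici 0 ∩ (fun t : ℝ => x + t • v) ⁻¹' frontier Ω with hS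
  have hSc : IsClosed S := isClosed_Ici.inter (isClosed_frontier.preimage hγ)
  have hSn : S.Nonempty := by
    obtain ⟨t, ht, h⟩ := exists_frontier_mem_line hb hx hv
    exact ⟨t, ht, h⟩
  have hSb : BddBelow S := ⟨0, fun t ht => ht.1⟩
  have hmem := hSc.csInf_mem hSn hSb
  refine ⟨sInf S, hmem.1, hmem.2, fun s hs hst => ?_⟩
  have hpre : IsPreconnected ((fun t : ℝ => x + t • v) '' Ico 0 (sInf S)) :=
    isPreconnected_Ico.image _ hγ.continuousOn
  refine hpre.subset_of_closure_inter_subset ho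
    ⟨x, ⟨0, ⟨le_rfl, hs.trans_lt hst⟩, by simp⟩, hx⟩ ?_ ⟨s, ⟨hs, hst⟩, rfl⟩
  rintro _ ⟨hy, ⟨t, ht, rfl⟩⟩
  by_contra hn
  have hf : x + t • v ∈ frontier Ω := ⟨hy, by rwa [ho.interior_eq]⟩
  exact ht.2.not_ge (csInf_le hSb ⟨ht.1, hf⟩)

theorem exists_fiber_bound {X Y : Type*} [TopologicalSpace X] [MeasurableSpace X] [BorelSpace X]
    [T2Space X] [TopologicalSpace Y] [T2Space Y] [MeasurableSpace Y] [BorelSpace Y] {μ : Measure X}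
    {ν : Measure Y} {p : X → Y} (hp : Continuous p) (hν : ∀ s : Set X, ν (p '' s) ≤ μ s)
    {K : Set X} (hK : IsCompact K) {G : X → ℝ} (hG : Continuous G) (hG0 : ∀ x, 0 ≤ G x) :
    ∃ M : Y → ℝ≥0∞, Measurable M ∧ (∀ z ∈ K, ENNReal.ofReal (G z) ≤ M (p z)) ∧
      ∫⁻ w, M w ∂ν ≤ ∫⁻ z in K, ENNReal.ofReal (G z) ∂μ := by
  obtain ⟨C, hC⟩ := hK.exists_bound_of_continuousOn hG.continuousOn
  set M : Y → ℝ := fun w => sSup (G '' (K ∩ p ⁻¹' {w})) with hM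
  have hbdd : ∀ w, BddAbove (G '' (K ∩ p ⁻¹' {w})) := fun w => ⟨C, by
    rintro _ ⟨z, hz, rfl⟩
    exact (le_abs_self _).trans (hC z hz.1)⟩
  have hM0 : ∀ w, 0 ≤ M w := fun w => Real.sSup_nonneg (by
    rintro _ ⟨z, -, rfl⟩
    exact hG0 z)
  have hlev : ∀ t : ℝ, 0 ≤ t → {w | t < M w} = p '' (K ∩ {z | t < G z}) := by
    intro t ht
    ext w
    constructor
    · intro hw
      have hne : (G '' (K ∩ p ⁻¹' {w})).Nonempty := by
        by_contra h
        rw [not_nonempty_iff_eq_empty] at h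
        simp only [mem_ofPred_eq, hM, h, Real.sSup_empty] at hw
        linarith
      obtain ⟨_, ⟨z, hz, rfl⟩, hzt⟩ := exists_lt_of_lt_csSup hne hw
      exact ⟨z, ⟨hz.1, hzt⟩, hz.2⟩
    · rintro ⟨z, ⟨hz, hzt⟩, rfl⟩
      exact lt_of_lt_of_le hzt (le_csSup (hbdd _) ⟨z, ⟨hz, rfl⟩, rfl⟩)
  have hmeasM : Measurable M := by
    refine measurable_of_Ioi fun t => ?_
    rcases lt_or_ge t 0 with ht | ht
    · have : M ⁻¹' Ioi t = univ := eq_univ_of_forall fun w => ht.trans_le (hM0 w)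
      rw [this]
      exact MeasurableSet.univ
    · have h1 : M ⁻¹' Ioi t = ⋃ n : ℕ, p '' (K ∩ {z | t + 1 / ((n : ℝ) + 1) ≤ G z}) := by
        rw [← image_iUnion, ← inter_iUnion]
        refine (hlev t ht).trans ?_
        congr 2
        ext z
        simp only [mem_ofPred_eq, mem_iUnion]
        constructor
        · intro h
          obtain ⟨n, hn⟩ := exists_nat_one_div_lt (sub_pos.2 h)
          exact ⟨n, by linarith⟩
        · rintro ⟨n, hn⟩
          have : (0 : ℝ) < 1 / ((n : ℝ) + 1) := by positivity
          linarith
      rw [h1]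
      refine MeasurableSet.iUnion fun n => IsCompact.measurableSet ?_
      exact (hK.inter_right (isClosed_le continuous_const hG)).image hp
  refine ⟨fun w => ENNReal.ofReal (M w), hmeasM.ennreal_ofReal, fun z hz => ?_, ?_⟩
  · exact ENNReal.ofReal_le_ofReal (le_csSup (hbdd _) ⟨z, ⟨hz, rfl⟩, rfl⟩)
  · rw [lintegral_eq_lintegral_meas_lt ν (ae_of_all _ hM0) hmeasM.aemeasurable,
      lintegral_eq_lintegral_meas_lt (μ.restrict K) (ae_of_all _ hG0) hG.measurable.aemeasurable]
    refine setLIntegral_mono' measurableSet_Ioi fun t ht => ?_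
    rw [hlev t (le_of_lt ht), Measure.restrict_apply' hK.measurableSet, inter_comm]
    exact hν _

theorem exists_friedrichs (m : ℕ) (r : ℝ) : ∃ C : ℝ≥0,
    ∀ Ω : Set (EuclideanSpace ℝ (Fin (m + 1))), IsOpen Ω → Ω ⊆ closedBall 0 r →
      ∀ F : EuclideanSpace ℝ (Fin (m + 1)) → ℝ, ContDiff ℝ 1 F →
        ∫⁻ x in Ω, ‖F x‖ₑ ^ 2 ≤ C * ((∫⁻ x in frontier Ω, ‖F x‖ₑ ^ 2 ∂μH[(m : ℝ)]) +
          ∫⁻ x in Ω, ‖fderiv ℝ F x‖ₑ ^ 2) := by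
  refine ⟨Real.toNNReal (2 * r) * (2 + 2 * Real.toNNReal (2 * r)), fun Ω ho hΩ F hF => ?_⟩
  have hb : Bornology.IsBounded Ω := isBounded_closedBall.subset hΩ
  have hfr : frontier Ω ⊆ closedBall 0 r :=
    frontier_subset_closure.trans (closure_minimal hΩ isClosed_closedBall)
  have hfrc : IsCompact (frontier Ω) := (isCompact_closedBall 0 r).of_isClosed_subset
    isClosed_frontier hfr
  let p : EuclideanSpace ℝ (Fin (m + 1)) → Fin m → ℝ := fun x j => x (Fin.succAbove 0 j)
  have hp : Continuous p := by fun_prop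
  obtain ⟨M, hMm, hM, hMint⟩ := exists_fiber_bound (μ := μH[(m : ℝ)]) (ν := volume) hp
    (volume_image_removeNth_le 0) hfrc (G := fun x => F x ^ 2) (hF.continuous.pow 2)
    (fun x => sq_nonneg _)
  have hsq : ∀ x, ENNReal.ofReal (F x ^ 2) = ‖F x‖ₑ ^ 2 := fun x => by
    rw [← sq_abs, ENNReal.ofReal_pow (abs_nonneg _), Real.enorm_eq_ofReal_abs]
  simp only [hsq] at hM hMint
  let e : EuclideanSpace ℝ (Fin (m + 1)) ≃ᵐ ℝ × (Fin m → ℝ) :=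
    (MeasurableEquiv.toLp 2 (Fin (m + 1) → ℝ)).symm.trans
      (MeasurableEquiv.piFinSuccAbove (fun _ => ℝ) 0)
  have he : MeasurePreserving e volume volume :=
    (volume_preserving_piFinSuccAbove (fun _ => ℝ) 0).comp
      (PiLp.volume_preserving_ofLp (Fin (m + 1)))
  have hex : ∀ x, e x = (x 0, p x) := fun x => rfl
  set v : EuclideanSpace ℝ (Fin (m + 1)) := EuclideanSpace.single 0 1 with hv
  have hline : ∀ (x : EuclideanSpace ℝ (Fin (m + 1))) (s : ℝ),
      e (x + s • v) = (x 0 + s, p x) := fun x s => by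
    rw [hex]
    refine Prod.ext ?_ ?_
    · simp [hv]
    · ext j
      simp [p, hv]
  have hv1 : ‖v‖ = 1 := by simp [hv]
  set h : EuclideanSpace ℝ (Fin (m + 1)) → ℝ≥0∞ := Ω.indicator fun x => ‖fderiv ℝ F x‖ₑ ^ 2 with hh
  have hdm : Measurable fun x => ‖fderiv ℝ F x‖ₑ ^ 2 :=
    (hF.continuous_fderiv one_ne_zero).measurable.enorm.pow_const 2
  have hhm : Measurable h := hdm.indicator ho.measurableSet
  set J : (Fin m → ℝ) → ℝ≥0∞ := fun w => ∫⁻ s : ℝ, h (e.symm (s, w)) with hJ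
  have hem : Measurable fun z : ℝ × (Fin m → ℝ) => h (e.symm z) := hhm.comp e.symm.measurable
  have hJm : Measurable J := hem.lintegral_prod_left'
  have hpt : ∀ x ∈ Ω, ‖F x‖ₑ ^ 2 ≤
      2 * M (p x) + 2 * (ENNReal.ofReal (2 * r) * J (p x)) := by
    intro x hx
    obtain ⟨t, ht0, htf, hts⟩ := exists_first_frontier_mem_line ho hb hx
      (v := v) (by rw [← norm_ne_zero_iff, hv1]; exact one_ne_zero)
    have ht2 : t ≤ 2 * r := by
      have h1 := hfr htf
      have h2 := hΩ hx
      rw [mem_closedBall_zero_iff] at h1 h2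
      have h3 := norm_sub_le (x + t • v) x
      rw [add_sub_cancel_left, norm_smul, hv1, Real.norm_of_nonneg ht0] at h3
      linarith
    refine (enorm_sq_le_segment hF x v ht0).trans ?_
    have hpz : p (x + t • v) = p x := congrArg Prod.snd (hline x t)
    have hve : ‖v‖ₑ = 1 := by rw [← ofReal_norm, hv1, ENNReal.ofReal_one]
    rw [hve, one_pow, one_mul]
    gcongr
    · rw [← hpz]; exact hM _ htf
    · calc ∫⁻ s in Ioc 0 t, ‖fderiv ℝ F (x + s • v)‖ₑ ^ 2
          = ∫⁻ s in Ioo 0 t, ‖fderiv ℝ F (x + s • v)‖ₑ ^ 2 :=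
            (setLIntegral_congr Ioo_ae_eq_Ioc).symm
        _ ≤ ∫⁻ s in Ioo 0 t, h (x + s • v) := by
            refine setLIntegral_mono' measurableSet_Ioo fun s hs => ?_
            rw [hh, indicator_of_mem (hts s hs.1.le hs.2)]
        _ ≤ ∫⁻ s, h (x + s • v) := setLIntegral_le_lintegral _ _
        _ = ∫⁻ s, h (e.symm (x 0 + s, p x)) := by
            refine lintegral_congr fun s => ?_
            rw [← hline x s, e.symm_apply_apply]
        _ = J (p x) := lintegral_add_left_eq_self (fun s => h (e.symm (s, p x))) (x 0)
  have hx0 : ∀ x ∈ Ω, x 0 ∈ Icc (-r) r := fun x hx => by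
    have h1 := hΩ hx
    rw [mem_closedBall_zero_iff] at h1
    exact abs_le.1 ((PiLp.norm_apply_le x 0).trans h1)
  have hmJ : Measurable fun w => 2 * M w + 2 * (ENNReal.ofReal (2 * r) * J w) := by fun_prop
  set H : ℝ × (Fin m → ℝ) → ℝ≥0∞ := fun z =>
    (Icc (-r) r).indicator (1 : ℝ → ℝ≥0∞) z.1 *
      (2 * M z.2 + 2 * (ENNReal.ofReal (2 * r) * J z.2)) with hH
  have hone : Measurable ((Icc (-r) r).indicator (1 : ℝ → ℝ≥0∞)) :=
    measurable_one.indicator measurableSet_Icc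
  have hHm : Measurable H := (hone.comp measurable_fst).mul (hmJ.comp measurable_snd)
  have hJint : ∫⁻ w, J w = ∫⁻ x in Ω, ‖fderiv ℝ F x‖ₑ ^ 2 := by
    rw [← lintegral_indicator ho.measurableSet]
    have h1 := he.symm e |>.lintegral_comp hhm
    rw [← h1, Measure.volume_eq_prod, lintegral_prod_symm _ hem.aemeasurable]
  calc ∫⁻ x in Ω, ‖F x‖ₑ ^ 2 ≤ ∫⁻ x in Ω, H (e x) := by
        refine setLIntegral_mono' ho.measurableSet fun x hx => ?_
        rw [hH]
        simp only [hex, indicator_of_mem (hx0 x hx), Pi.one_apply, one_mul]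
        exact hpt x hx
    _ ≤ ∫⁻ x, H (e x) := setLIntegral_le_lintegral _ _
    _ = ∫⁻ z, H z := he.lintegral_comp hHm
    _ = ENNReal.ofReal (2 * r) * (2 * (∫⁻ w, M w) +
          2 * (ENNReal.ofReal (2 * r) * ∫⁻ w, J w)) := by
        rw [Measure.volume_eq_prod, lintegral_prod_symm _ hHm.aemeasurable]
        simp only [hH]
        simp_rw [lintegral_mul_const _ hone, lintegral_indicator_one measurableSet_Icc]
        rw [lintegral_const_mul _ hmJ, lintegral_add_left (by fun_prop), lintegral_const_mul _ hMm,
          lintegral_const_mul _ (by fun_prop), lintegral_const_mul _ hJm, Real.volume_Icc]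
        congr 2
        ring
    _ ≤ _ := by
        rw [hJint]
        have e1 : ENNReal.ofReal (2 * r) = ((Real.toNNReal (2 * r) : ℝ≥0) : ℝ≥0∞) := rfl
        rw [e1]
        push_cast
        rw [mul_assoc]
        gcongr
        set A := ∫⁻ x in Ω, ‖fderiv ℝ F x‖ₑ ^ 2
        set B := ∫⁻ x in frontier Ω, ‖F x‖ₑ ^ 2 ∂μH[(m : ℝ)]
        set k : ℝ≥0∞ := ((Real.toNNReal (2 * r) : ℝ≥0) : ℝ≥0∞)
        calc 2 * (∫⁻ w, M w) + 2 * (k * A) ≤ 2 * B + 2 * (k * A) := by gcongr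
          _ ≤ 2 * B + 2 * (k * A) + (2 * k * B + 2 * A) := le_self_add
          _ = _ := by ring

end Friedrichs

section Perturbation

theorem exists_admissible {m : ℕ} (hm : 1 ≤ m) {K : Set (EuclideanSpace ℝ (Fin (m + 1)))}
    (hK : IsCompact K) (h0 : μH[(m : ℝ)] K ≠ 0) (hfin : μH[(m : ℝ)] K ≠ ⊤) :
    ∃ f : EuclideanSpace ℝ (Fin (m + 1)) → ℝ, ContDiff ℝ (⊤ : ℕ∞) f ∧
      (∫ x in K, f x ∂μH[(m : ℝ)]) = 0 ∧ 0 < ∫ x in K, f x ^ 2 ∂μH[(m : ℝ)] := by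
  set μ : Measure (EuclideanSpace ℝ (Fin (m + 1))) := μH[(m : ℝ)] with hμ
  by_contra! hcon
  have : NullSingletonClass μ :=
    Measure.nullSingletonClass_hausdorff _ (by exact_mod_cast hm)
  have hI : ∀ {f : EuclideanSpace ℝ (Fin (m + 1)) → ℝ}, Continuous f → IntegrableOn f K μ :=
    fun hf => integrableOn_of_continuous_of_isCompact hK hfin hf
  set M := μ.real K with hM
  have hM0 : 0 < M := ENNReal.toReal_pos h0 hfin
  let c : EuclideanSpace ℝ (Fin (m + 1)) := WithLp.toLp 2 fun i => (∫ x in K, x i ∂μ) / M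
  have hz : ∀ i, ∀ᵐ x ∂μ.restrict K, x i = c i := by
    intro i
    have hcd : ContDiff ℝ (⊤ : ℕ∞) fun x : EuclideanSpace ℝ (Fin (m + 1)) => x i - c i :=
      (contDiff_piLp_apply (p := 2) (i := i)).sub contDiff_const
    have h1 : ∫ x in K, (x i - c i) ∂μ = 0 := by
      rw [integral_sub (hI (by fun_prop)) (hI continuous_const), setIntegral_const, smul_eq_mul,
        ← hM]
      simp only [c]
      field_simp
      simp
    have h2 := hcon _ hcd h1
    have h3 : ∫ x in K, (x i - c i) ^ 2 ∂μ = 0 :=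
      le_antisymm h2 (integral_nonneg fun _ => sq_nonneg _)
    rw [integral_eq_zero_iff_of_nonneg (fun _ => sq_nonneg _)
      (hI (hcd.continuous.pow 2))] at h3
    filter_upwards [h3] with x hx
    have := pow_eq_zero_iff (two_ne_zero) |>.1 hx
    linarith
  have hall : ∀ᵐ x ∂μ.restrict K, x = c := by
    filter_upwards [ae_all_iff.2 hz] with x hx
    ext i
    exact hx i
  have hne : ∀ᵐ x ∂μ.restrict K, x ≠ c := by
    rw [ae_iff]
    simp
  have hfalse : ∀ᵐ _ ∂μ.restrict K, False := by
    filter_upwards [hall, hne] with x h1 h2 using h2 h1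
  rw [ae_iff] at hfalse
  simp [h0] at hfalse

theorem ofReal_setIntegral_sq {X : Type*} [MeasurableSpace X] {μ : Measure X} {s : Set X}
    {g : X → ℝ} (hg : IntegrableOn (fun x => g x ^ 2) s μ) :
    ENNReal.ofReal (∫ x in s, g x ^ 2 ∂μ) = ∫⁻ x in s, ‖g x‖ₑ ^ 2 ∂μ := by
  rw [ofReal_integral_eq_lintegral_ofReal hg (ae_of_all _ fun _ => sq_nonneg _)]
  refine lintegral_congr fun x => ?_
  rw [← sq_abs, ENNReal.ofReal_pow (abs_nonneg _), Real.enorm_eq_ofReal_abs]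

theorem sq_setIntegral_mul_le {X : Type*} [MeasurableSpace X] {μ : Measure X} {s : Set X}
    {f g : X → ℝ} (hf : IntegrableOn (fun x => f x ^ 2) s μ)
    (hg : IntegrableOn (fun x => g x ^ 2) s μ) (hfm : AEStronglyMeasurable f (μ.restrict s))
    (hgm : AEStronglyMeasurable g (μ.restrict s)) :
    (∫ x in s, f x * g x ∂μ) ^ 2 ≤ (∫ x in s, f x ^ 2 ∂μ) * ∫ x in s, g x ^ 2 ∂μ := by
  have h1 : ‖∫ x in s, f x * g x ∂μ‖ₑ ^ 2 ≤
      ENNReal.ofReal ((∫ x in s, f x ^ 2 ∂μ) * ∫ x in s, g x ^ 2 ∂μ) := by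
    rw [ENNReal.ofReal_mul (integral_nonneg fun _ => sq_nonneg _), ofReal_setIntegral_sq hf,
      ofReal_setIntegral_sq hg]
    refine le_trans (pow_le_pow_left₀ bot_le (enorm_integral_le_lintegral_enorm _) 2) ?_
    simp_rw [enorm_mul]
    exact sq_lintegral_mul_le hfm.enorm hgm.enorm
  rw [Real.enorm_eq_ofReal_abs, ← ENNReal.ofReal_pow (abs_nonneg _), sq_abs] at h1
  exact (ENNReal.ofReal_le_ofReal_iff (mul_nonneg (integral_nonneg fun _ => sq_nonneg _)
    (integral_nonneg fun _ => sq_nonneg _))).1 h1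

end Perturbation

section Perturbation

/-- `Ω'` arises from `Ω` by a modification which takes place where the cutoff `P` differs from `1`
and which is `ε`-small for Dirichlet and boundary energies. -/
structure IsSmallModification {m : ℕ} (Ω Ω' : Set (EuclideanSpace ℝ (Fin (m + 1))))
    (P : EuclideanSpace ℝ (Fin (m + 1)) → ℝ) (ε : ℝ≥0) : Prop where
  isOpen : IsOpen Ω'
  subset : Ω' ⊆ Ω
  contDiff : ContDiff ℝ (⊤ : ℕ∞) P
  nonneg : ∀ x, 0 ≤ P x
  le_one : ∀ x, P x ≤ 1
  mem_of_ne_zero : ∀ x ∈ Ω, P x ≠ 0 → x ∈ Ω'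
  mem_frontier_iff : ∀ x, P x ≠ 0 → (x ∈ frontier Ω ↔ x ∈ frontier Ω')
  lintegral_cutoff_le : ∀ f : EuclideanSpace ℝ (Fin (m + 1)) → ℝ, ContDiff ℝ (⊤ : ℕ∞) f →
    ∫⁻ x in Ω', (‖f x‖ₑ * ‖fderiv ℝ P x‖ₑ) ^ 2 ≤
      ε * ((∫⁻ x in Ω', ‖f x‖ₑ ^ 2) + ∫⁻ x in Ω', ‖fderiv ℝ f x‖ₑ ^ 2)
  lintegral_frontier_le : ∀ f : EuclideanSpace ℝ (Fin (m + 1)) → ℝ, ContDiff ℝ (⊤ : ℕ∞) f →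
    ∫⁻ x in frontier Ω' ∩ {x | P x ≠ 1}, ‖f x‖ₑ ^ 2 ∂μH[(m : ℝ)] ≤
      ε * ((∫⁻ x in Ω', ‖f x‖ₑ ^ 2) + ∫⁻ x in Ω', ‖fderiv ℝ f x‖ₑ ^ 2)
  measure_frontier_le : μH[(m : ℝ)] (frontier Ω ∩ {x | P x ≠ 1}) ≤ ε

theorem IsSmallModification.rayleigh_le {m : ℕ} {Ω Ω' : Set (EuclideanSpace ℝ (Fin (m + 1)))}
    {P : EuclideanSpace ℝ (Fin (m + 1)) → ℝ} {ε : ℝ≥0} (h : IsSmallModification Ω Ω' P ε)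
    (hΩ : IsOpen Ω) (hb : Bornology.IsBounded Ω) (h0 : μH[(m : ℝ)] (frontier Ω) ≠ 0)
    (hfin : μH[(m : ℝ)] (frontier Ω) ≠ ⊤) {C : ℝ≥0}
    (hC : ∀ F : EuclideanSpace ℝ (Fin (m + 1)) → ℝ, ContDiff ℝ 1 F →
        ∫⁻ x in Ω', ‖F x‖ₑ ^ 2 ≤ C * ((∫⁻ x in frontier Ω', ‖F x‖ₑ ^ 2 ∂μH[(m : ℝ)]) +
          ∫⁻ x in Ω', ‖fderiv ℝ F x‖ₑ ^ 2))
    {s : ℝ} (hs0 : 0 < s) (hs : ε * (C + 1) ≤ s ^ 2)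
    (hsM : s ^ 2 * volume.real Ω ≤ (μH[(m : ℝ)]).real (frontier Ω))
    (hfin' : μH[(m : ℝ)] (frontier Ω') ≠ ⊤)
    {f : EuclideanSpace ℝ (Fin (m + 1)) → ℝ} (hf : ContDiff ℝ (⊤ : ℕ∞) f)
    (hf0 : (∫ x in frontier Ω', f x ∂μH[(m : ℝ)]) = 0) :
    stekSigma1 Ω * ((∫ x in frontier Ω', f x ^ 2 ∂μH[(m : ℝ)]) - 2 * s ^ 2 *
        ((∫ x in Ω', ‖gradient f x‖ ^ 2) + ∫ x in frontier Ω', f x ^ 2 ∂μH[(m : ℝ)])) ≤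
      (1 + s) * (∫ x in Ω', ‖gradient f x‖ ^ 2) + (s ^ 2 + s) *
        ((∫ x in Ω', ‖gradient f x‖ ^ 2) + ∫ x in frontier Ω', f x ^ 2 ∂μH[(m : ℝ)]) := by
  obtain ⟨ho, hsub, hP, hP0, hP1, hPΩ, hPf, hcut, hbd, -⟩ := h
  simp only [norm_gradient_eq]
  set μ : Measure (EuclideanSpace ℝ (Fin (m + 1))) := μH[(m : ℝ)] with hμ
  have hb' : Bornology.IsBounded Ω' := hb.subset hsub
  have hK : ∀ {U : Set (EuclideanSpace ℝ (Fin (m + 1)))}, Bornology.IsBounded U →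
      IsCompact (frontier U) := fun hU =>
    hU.isCompact_closure.of_isClosed_subset isClosed_frontier frontier_subset_closure
  have hI : ∀ {g : EuclideanSpace ℝ (Fin (m + 1)) → ℝ}, Continuous g →
      IntegrableOn g (frontier Ω') μ := fun hg =>
    integrableOn_of_continuous_of_isCompact (hK hb') hfin' hg
  have hV : ∀ {g : EuclideanSpace ℝ (Fin (m + 1)) → ℝ}, Continuous g →
      IntegrableOn g Ω' volume := fun hg =>
    (hg.continuousOn.integrableOn_compact hb'.isCompact_closure).mono_set subset_closure
  have hfc : Continuous f := hf.continuous
  have hPc : Continuous P := hP.continuous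
  have hdf : Continuous (fderiv ℝ f) := hf.continuous_fderiv (by simp)
  have hdP : Continuous (fderiv ℝ P) := hP.continuous_fderiv (by simp)
  set a := ∫ x in Ω', ‖fderiv ℝ f x‖ ^ 2 with ha
  set b := ∫ x in frontier Ω', f x ^ 2 ∂μ with hbdef
  have ha0 : 0 ≤ a := integral_nonneg fun _ => sq_nonneg _
  have hb0 : 0 ≤ b := integral_nonneg fun _ => sq_nonneg _
  set D := frontier Ω' ∩ {x | P x ≠ 1} with hD
  have hDm : MeasurableSet D :=
    isClosed_frontier.measurableSet.inter (isOpen_ne_fun hPc continuous_const).measurableSet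
  have hDsub : D ⊆ frontier Ω' := inter_subset_left
  -- the error bounds in terms of real integrals
  have hofa : ENNReal.ofReal a = ∫⁻ x in Ω', ‖fderiv ℝ f x‖ₑ ^ 2 := by
    rw [ha, ofReal_setIntegral_sq (hV (by fun_prop))]
    simp
  have hofb : ENNReal.ofReal b = ∫⁻ x in frontier Ω', ‖f x‖ₑ ^ 2 ∂μ :=
    ofReal_setIntegral_sq (hI (by fun_prop))
  have hfried := hC f (hf.of_le (by exact_mod_cast le_top))
  rw [← hofa, ← hofb] at hfried
  have herr : (ε : ℝ≥0∞) * ((∫⁻ x in Ω', ‖f x‖ₑ ^ 2) + ENNReal.ofReal a) ≤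
      ENNReal.ofReal (s ^ 2 * (a + b)) := by
    calc (ε : ℝ≥0∞) * ((∫⁻ x in Ω', ‖f x‖ₑ ^ 2) + ENNReal.ofReal a)
        ≤ ε * (C * (ENNReal.ofReal b + ENNReal.ofReal a) +
            (ENNReal.ofReal b + ENNReal.ofReal a)) := by
          gcongr
          exact le_add_self
      _ = ENNReal.ofReal (ε * (C + 1) * (a + b)) := by
          have e : ENNReal.ofReal (ε * (C + 1)) = ε * (C + 1) := by
            rw [ENNReal.ofReal_mul (by positivity), ENNReal.ofReal_add (by positivity) one_pos.le,
              ENNReal.ofReal_coe_nnreal, ENNReal.ofReal_coe_nnreal, ENNReal.ofReal_one]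
          rw [← ENNReal.ofReal_add hb0 ha0, ENNReal.ofReal_mul (by positivity), e, add_comm b]
          ring
      _ ≤ _ := ENNReal.ofReal_le_ofReal (by gcongr)
  have hcut' : ∫ x in Ω', (f x * ‖fderiv ℝ P x‖) ^ 2 ≤ s ^ 2 * (a + b) := by
    rw [← ENNReal.ofReal_le_ofReal_iff (by positivity),
      ofReal_setIntegral_sq (hV (by fun_prop))]
    have := hcut f hf
    rw [← hofa] at this
    simpa [enorm_mul] using this.trans herr
  have hbd' : ∫ x in D, f x ^ 2 ∂μ ≤ s ^ 2 * (a + b) := by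
    rw [← ENNReal.ofReal_le_ofReal_iff (by positivity),
      ofReal_setIntegral_sq ((hI (by fun_prop)).mono_set hDsub)]
    have := hbd f hf
    rw [← hofa] at this
    exact this.trans herr
  have hμD : μ.real D ≤ μ.real (frontier Ω) := by
    refine le_trans ?_ hsM
    have h1 := hbd (fun _ => 1) contDiff_const
    simp only [enorm_one, one_pow, lintegral_const, Measure.restrict_apply MeasurableSet.univ,
      univ_inter, one_mul, fderiv_fun_const, Pi.zero_apply] at h1
    rw [show ‖(0 : EuclideanSpace ℝ (Fin (m + 1)) →L[ℝ] ℝ)‖ₑ = 0 by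
        rw [← ofReal_norm, norm_zero, ENNReal.ofReal_zero],
      zero_pow two_ne_zero, zero_mul, add_zero] at h1
    have h2 : ENNReal.toReal (μ D) ≤ ε * volume.real Ω' := by
      have := ENNReal.toReal_mono (ENNReal.mul_ne_top ENNReal.coe_ne_top hb'.measure_lt_top.ne) h1
      simpa [Measure.real] using this
    have h3 : volume.real Ω' ≤ volume.real Ω := measureReal_mono hsub hb.measure_lt_top.ne
    have h4 : (ε : ℝ) ≤ s ^ 2 := by nlinarith [ε.2, C.2, mul_nonneg ε.2 C.2]
    exact h2.trans (mul_le_mul h4 h3 measureReal_nonneg (sq_nonneg _))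
  -- the test function `P * f`
  have htransfer : ∀ g : EuclideanSpace ℝ (Fin (m + 1)) → ℝ, (∀ x, P x = 0 → g x = 0) →
      ∫ x in frontier Ω, g x ∂μ = ∫ x in frontier Ω', g x ∂μ := by
    intro g hg
    have e : frontier Ω ∩ {x | P x ≠ 0} = frontier Ω' ∩ {x | P x ≠ 0} := by
      ext x
      constructor
      · rintro ⟨h1, h2⟩; exact ⟨(hPf x h2).1 h1, h2⟩
      · rintro ⟨h1, h2⟩; exact ⟨(hPf x h2).2 h1, h2⟩
    rw [setIntegral_eq_of_subset_of_forall_sdiff_eq_zero isClosed_frontier.measurableSet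
      (inter_subset_left (t := {x | P x ≠ 0})),
      setIntegral_eq_of_subset_of_forall_sdiff_eq_zero (s := frontier Ω' ∩ {x | P x ≠ 0})
        (t := frontier Ω') isClosed_frontier.measurableSet inter_subset_left, e]
    · rintro x ⟨hx1, hx2⟩
      by_contra hgx
      exact hx2 ⟨hx1, fun hP => hgx (hg x hP)⟩
    · rintro x ⟨hx1, hx2⟩
      by_contra hgx
      exact hx2 ⟨hx1, fun hP => hgx (hg x hP)⟩
  have hoffD : ∀ x ∈ frontier Ω' \ D, P x = 1 := by
    rintro x ⟨hx1, hx2⟩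
    by_contra hne
    exact hx2 ⟨hx1, hne⟩
  have hF2 : b - s ^ 2 * (a + b) ≤ ∫ x in frontier Ω, (P x * f x) ^ 2 ∂μ := by
    rw [htransfer _ fun x hx => by simp [hx]]
    have h1 : b - ∫ x in frontier Ω', (P x * f x) ^ 2 ∂μ =
        ∫ x in D, (f x ^ 2 - (P x * f x) ^ 2) ∂μ := by
      rw [hbdef, ← integral_sub (hI (by fun_prop)) (hI (by fun_prop))]
      refine setIntegral_eq_of_subset_of_forall_sdiff_eq_zero isClosed_frontier.measurableSet hDsub
        fun x hx => ?_
      rw [hoffD x hx]; ring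
    have h2 : ∫ x in D, (f x ^ 2 - (P x * f x) ^ 2) ∂μ ≤ ∫ x in D, f x ^ 2 ∂μ :=
      integral_mono ((hI (by fun_prop)).mono_set hDsub) ((hI (by fun_prop)).mono_set hDsub)
        fun x => by simp only; nlinarith [sq_nonneg (P x * f x)]
    linarith
  have hF1 : (∫ x in frontier Ω, P x * f x ∂μ) ^ 2 / μ.real (frontier Ω) ≤ s ^ 2 * (a + b) := by
    have hM0 : 0 < μ.real (frontier Ω) := ENNReal.toReal_pos h0 hfin
    rw [div_le_iff₀ hM0, htransfer _ fun x hx => by simp [hx]]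
    have h1 : ∫ x in frontier Ω', P x * f x ∂μ = ∫ x in D, (P x - 1) * f x ∂μ := by
      rw [← setIntegral_eq_of_subset_of_forall_sdiff_eq_zero isClosed_frontier.measurableSet hDsub
        fun x hx => by rw [hoffD x hx]; ring]
      simp_rw [sub_mul, one_mul]
      rw [integral_sub (hI (by fun_prop)) (hI (by fun_prop)), hf0, sub_zero]
    rw [h1]
    have h2 := sq_setIntegral_mul_le (μ := μ) (s := D) (f := fun x => P x - 1) (g := f)
      ((hI (by fun_prop)).mono_set hDsub) ((hI (by fun_prop)).mono_set hDsub)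
      (by fun_prop) (by fun_prop)
    refine h2.trans ?_
    rw [mul_comm]
    refine mul_le_mul hbd' ?_ (integral_nonneg fun _ => sq_nonneg _) (by positivity)
    refine le_trans ?_ hμD
    have h3 : ∫ x in D, (P x - 1) ^ 2 ∂μ ≤ ∫ _ in D, 1 ∂μ :=
      integral_mono ((hI (by fun_prop)).mono_set hDsub) ((hI continuous_const).mono_set hDsub)
        fun x => by simp only; nlinarith [hP0 x, hP1 x]
    simpa using h3
  have hPf : ContDiff ℝ (⊤ : ℕ∞) fun x => P x * f x := hP.mul hf
  have hgrad : ∫ x in Ω, ‖gradient (fun x => P x * f x) x‖ ^ 2 ≤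
      (1 + s) * a + (s ^ 2 + s) * (a + b) := by
    simp only [norm_gradient_eq]
    have hdP0 : ∀ x, P x = 0 → fderiv ℝ P x = 0 := fun x hx =>
      IsLocalMin.fderiv_eq_zero (Eventually.of_forall fun y => by rw [hx]; exact hP0 y)
    have hder : ∀ x, fderiv ℝ (fun x => P x * f x) x = P x • fderiv ℝ f x + f x • fderiv ℝ P x :=
      fun x => fderiv_fun_mul (hP.differentiable (by simp) x) (hf.differentiable (by simp) x)
    have e1 : ∫ x in Ω, ‖fderiv ℝ (fun x => P x * f x) x‖ ^ 2 =
        ∫ x in Ω', ‖fderiv ℝ (fun x => P x * f x) x‖ ^ 2 := by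
      refine setIntegral_eq_of_subset_of_forall_sdiff_eq_zero hΩ.measurableSet hsub ?_
      rintro x ⟨hx, hx'⟩
      have hx0 : P x = 0 := by
        by_contra hne
        exact hx' (hPΩ x hx hne)
      simp [hder, hx0, hdP0 x hx0]
    rw [e1]
    have hpt : ∀ x, ‖fderiv ℝ (fun x => P x * f x) x‖ ^ 2 ≤
        (1 + s) * ‖fderiv ℝ f x‖ ^ 2 + (1 + 1 / s) * (f x * ‖fderiv ℝ P x‖) ^ 2 := by
      intro x
      have h1 : ‖fderiv ℝ (fun x => P x * f x) x‖ ≤ ‖fderiv ℝ f x‖ + |f x| * ‖fderiv ℝ P x‖ := by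
        rw [hder]
        refine (norm_add_le _ _).trans (add_le_add ?_ ?_)
        · rw [norm_smul, Real.norm_of_nonneg (hP0 x)]
          exact mul_le_of_le_one_left (norm_nonneg _) (hP1 x)
        · rw [norm_smul, Real.norm_eq_abs]
      set u := ‖fderiv ℝ f x‖
      have h2 : (f x * ‖fderiv ℝ P x‖) ^ 2 = (|f x| * ‖fderiv ℝ P x‖) ^ 2 := by
        rw [mul_pow, mul_pow, sq_abs]
      rw [h2]
      set w := |f x| * ‖fderiv ℝ P x‖
      calc ‖fderiv ℝ (fun x => P x * f x) x‖ ^ 2 ≤ (u + w) ^ 2 :=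
            pow_le_pow_left₀ (norm_nonneg _) h1 2
        _ ≤ (u + w) ^ 2 + (s * u - w) ^ 2 / s := by
            have : 0 ≤ (s * u - w) ^ 2 / s := by positivity
            linarith
        _ = _ := by field_simp; ring
    have hdPf : Continuous (fderiv ℝ fun x => P x * f x) := hPf.continuous_fderiv (by simp)
    calc ∫ x in Ω', ‖fderiv ℝ (fun x => P x * f x) x‖ ^ 2
        ≤ ∫ x in Ω', ((1 + s) * ‖fderiv ℝ f x‖ ^ 2 +
            (1 + 1 / s) * (f x * ‖fderiv ℝ P x‖) ^ 2) :=
          integral_mono (hV (by fun_prop)) (hV (by fun_prop)) hpt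
      _ = (1 + s) * a + (1 + 1 / s) * ∫ x in Ω', (f x * ‖fderiv ℝ P x‖) ^ 2 := by
          rw [integral_add (hV (by fun_prop)) (hV (by fun_prop)), integral_const_mul,
            integral_const_mul]
      _ ≤ (1 + s) * a + (1 + 1 / s) * (s ^ 2 * (a + b)) := by gcongr
      _ = _ := by field_simp
  have hd : (((m + 1 : ℕ) : ℝ) - 1) = m := by push_cast; ring
  have hmain := stekSigma1_mul_le hb (by rw [hd]; exact hfin) (by rw [hd]; exact h0) hPf
  rw [hd, ← hμ] at hmain
  refine le_trans (mul_le_mul_of_nonneg_left ?_ (stekSigma1_nonneg Ω)) (hmain.trans hgrad)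
  linarith

end Perturbation

section Perturbation

theorem IsSmallModification.measure_frontier_ne_top {m : ℕ}
    {Ω Ω' : Set (EuclideanSpace ℝ (Fin (m + 1)))}
    {P : EuclideanSpace ℝ (Fin (m + 1)) → ℝ} {ε : ℝ≥0} (h : IsSmallModification Ω Ω' P ε)
    (hb : Bornology.IsBounded Ω) (hfin : μH[(m : ℝ)] (frontier Ω) ≠ ⊤) :
    μH[(m : ℝ)] (frontier Ω') ≠ ⊤ := by
  have hsub : frontier Ω' ⊆ frontier Ω ∪ (frontier Ω' ∩ {x | P x ≠ 1}) := by
    intro x hx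
    by_cases hP : P x = 1
    · exact Or.inl ((h.mem_frontier_iff x (by simp [hP])).2 hx)
    · exact Or.inr ⟨hx, hP⟩
  have h1 := h.lintegral_frontier_le (fun _ => 1) contDiff_const
  simp only [enorm_one, one_pow, lintegral_const, Measure.restrict_apply MeasurableSet.univ,
    univ_inter, one_mul, fderiv_fun_const, Pi.zero_apply] at h1
  rw [show ‖(0 : EuclideanSpace ℝ (Fin (m + 1)) →L[ℝ] ℝ)‖ₑ = 0 by
    rw [← ofReal_norm, norm_zero, ENNReal.ofReal_zero], zero_pow two_ne_zero, zero_mul,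
    add_zero] at h1
  have h2 : μH[(m : ℝ)] (frontier Ω' ∩ {x | P x ≠ 1}) ≠ ⊤ :=
    (h1.trans_lt (ENNReal.mul_lt_top ENNReal.coe_lt_top
      (hb.subset h.subset).measure_lt_top)).ne
  exact ((measure_mono hsub).trans_lt ((measure_union_le _ _).trans_lt
    (ENNReal.add_lt_top.2 ⟨hfin.lt_top, h2.lt_top⟩))).ne

theorem IsSmallModification.sub_le_measure_frontier {m : ℕ}
    {Ω Ω' : Set (EuclideanSpace ℝ (Fin (m + 1)))}
    {P : EuclideanSpace ℝ (Fin (m + 1)) → ℝ} {ε : ℝ≥0} (h : IsSmallModification Ω Ω' P ε)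
    (hfin' : μH[(m : ℝ)] (frontier Ω') ≠ ⊤) :
    (μH[(m : ℝ)]).real (frontier Ω) - ε ≤ (μH[(m : ℝ)]).real (frontier Ω') := by
  have hsub : frontier Ω ⊆ frontier Ω' ∪ (frontier Ω ∩ {x | P x ≠ 1}) := by
    intro x hx
    by_cases hP : P x = 1
    · exact Or.inl ((h.mem_frontier_iff x (by simp [hP])).1 hx)
    · exact Or.inr ⟨hx, hP⟩
  have h1 : μH[(m : ℝ)] (frontier Ω) ≤ μH[(m : ℝ)] (frontier Ω') + ε :=
    (measure_mono hsub).trans ((measure_union_le _ _).trans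
      (add_le_add le_rfl h.measure_frontier_le))
  have h2 := ENNReal.toReal_mono (ENNReal.add_ne_top.2 ⟨hfin', ENNReal.coe_ne_top⟩) h1
  rw [ENNReal.toReal_add hfin' ENNReal.coe_ne_top, ENNReal.coe_toReal] at h2
  simp only [Measure.real]
  linarith

/-- The normalized Steklov eigenvalue is lower semicontinuous under small modifications. -/
theorem exists_lt_normSigma1 {m : ℕ} (hm : 1 ≤ m) {Ω : Set (EuclideanSpace ℝ (Fin (m + 1)))}
    (hΩ : IsOpen Ω) (hb : Bornology.IsBounded Ω) (h0 : μH[(m : ℝ)] (frontier Ω) ≠ 0)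
    (hfin : μH[(m : ℝ)] (frontier Ω) ≠ ⊤) {c : ℝ} (hc0 : 0 ≤ c) (hc : c < normSigma1 Ω) :
    ∃ ε : ℝ≥0, 0 < ε ∧ ∀ Ω' P, IsSmallModification Ω Ω' P ε → c < normSigma1 Ω' := by
  have hd : (((m + 1 : ℕ) : ℝ) - 1) = m := by push_cast; ring
  obtain ⟨r, hr⟩ := hb.subset_closedBall 0
  obtain ⟨C, hC⟩ := exists_friedrichs m r
  set M := (μH[(m : ℝ)]).real (frontier Ω) with hM
  have hM0 : 0 < M := ENNReal.toReal_pos h0 hfin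
  set σ := stekSigma1 Ω with hσ
  have hσ0 : 0 ≤ σ := stekSigma1_nonneg Ω
  have hm0 : (0 : ℝ) < 1 / m := by positivity
  have hns : normSigma1 Ω = σ * M ^ ((1 : ℝ) / m) := by
    rw [normSigma1, hd]; rfl
  let h : ℝ → ℝ := fun s => (σ * (1 - 2 * s ^ 2) - s ^ 2 - s) /
    (1 + 2 * s + s ^ 2 + 2 * σ * s ^ 2)
  have hcont : ContinuousAt (fun s : ℝ => h s * (M - s ^ 2) ^ ((1 : ℝ) / m)) 0 := by
    refine ContinuousAt.mul (ContinuousAt.div (by fun_prop) (by fun_prop) (by simp)) ?_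
    exact ContinuousAt.rpow_const (by fun_prop) (Or.inr hm0.le)
  have hev1 : ∀ᶠ s in 𝓝 (0 : ℝ), c < h s * (M - s ^ 2) ^ ((1 : ℝ) / m) := by
    refine hcont.eventually_const_lt ?_
    simpa [h, hns] using hc
  have hev2 : ∀ᶠ s in 𝓝 (0 : ℝ), s ^ 2 < M := by
    have h1 : ContinuousAt (fun s : ℝ => s ^ 2) 0 := by fun_prop
    exact h1.tendsto.eventually_lt_const (by simpa using hM0)
  have hev3 : ∀ᶠ s in 𝓝 (0 : ℝ), s ^ 2 * volume.real Ω < M := by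
    have h1 : ContinuousAt (fun s : ℝ => s ^ 2 * volume.real Ω) 0 := by fun_prop
    exact h1.tendsto.eventually_lt_const (by simpa using hM0)
  obtain ⟨s, ⟨⟨hs1, hs2⟩, hs3⟩, hs0⟩ := (((hev1.and hev2).and hev3).filter_mono
    nhdsWithin_le_nhds |>.and (self_mem_nhdsWithin (s := Ioi (0 : ℝ)))).exists
  have hs0 : 0 < s := hs0
  have hpos : 0 < s ^ 2 / (C + 1) := by positivity
  refine ⟨(s ^ 2 / (C + 1)).toNNReal, Real.toNNReal_pos.2 hpos, fun Ω' P hmod => ?_⟩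
  set ε : ℝ≥0 := (s ^ 2 / (C + 1)).toNNReal with hε
  have hεC : (ε : ℝ) * (C + 1) = s ^ 2 := by
    rw [hε, Real.coe_toNNReal _ hpos.le]; field_simp
  have hε1 : (ε : ℝ) ≤ s ^ 2 := by nlinarith [ε.2, C.2, mul_nonneg ε.2 C.2]
  have hfin' := hmod.measure_frontier_ne_top hb hfin
  have hM' := hmod.sub_le_measure_frontier hfin'
  set M' := (μH[(m : ℝ)]).real (frontier Ω') with hMd
  have hM'1 : M - s ^ 2 ≤ M' := by linarith
  have hM'0 : 0 < M' := by linarith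
  have hh : 0 < h s := by
    have h1 : 0 < h s * (M - s ^ 2) ^ ((1 : ℝ) / m) := hc0.trans_lt hs1
    exact pos_of_mul_pos_left h1 (Real.rpow_nonneg (by linarith) _)
  have hb' := hb.subset hmod.subset
  have hK : IsCompact (frontier Ω') :=
    hb'.isCompact_closure.of_isClosed_subset isClosed_frontier frontier_subset_closure
  have hle : h s ≤ stekSigma1 Ω' := by
    rw [stekSigma1, hd]
    refine le_csInf ?_ ?_
    · obtain ⟨f, hf, hf1, hf2⟩ := exists_admissible hm hK
        (fun h => hM'0.ne' (by simp [hMd, Measure.real, h])) hfin'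
      exact ⟨_, f, hf, hf1, hf2, rfl⟩
    · rintro q ⟨f, hf, hf1, hf2, rfl⟩
      have key := hmod.rayleigh_le hΩ hb h0 hfin
        (fun F hF => hC Ω' hmod.isOpen (hmod.subset.trans hr) F hF) hs0 hεC.le hs3.le hfin' hf hf1
      rw [div_le_div_iff₀ (by positivity) hf2]
      linarith
  have e : normSigma1 Ω' = stekSigma1 Ω' * M' ^ ((1 : ℝ) / m) := by
    rw [normSigma1, hd]; rfl
  rw [e]
  refine hs1.trans_le (mul_le_mul hle ?_ (Real.rpow_nonneg (by linarith) _) (hh.le.trans hle))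
  exact Real.rpow_le_rpow (by linarith) hM'1 hm0.le

end Perturbation

section Trace

variable {X : Type*} [NormedAddCommGroup X] [NormedSpace ℝ X]

theorem ofReal_mul_enorm_sq_le_segment {V : Type*} [NormedAddCommGroup V] [NormedSpace ℝ V]
    {F : V → ℝ} (hF : ContDiff ℝ 1 F) (x v : V) (τ₀ : ℝ) :
    ENNReal.ofReal τ₀ * ‖F x‖ₑ ^ 2 ≤ 2 * (∫⁻ t in Ioc 0 τ₀, ‖F (x + t • v)‖ₑ ^ 2) +
      2 * (ENNReal.ofReal τ₀ ^ 2 * (‖v‖ₑ ^ 2 *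
        ∫⁻ t in Ioc 0 τ₀, ‖fderiv ℝ F (x + t • v)‖ₑ ^ 2)) := by
  have hFc : Continuous F := hF.continuous
  calc ENNReal.ofReal τ₀ * ‖F x‖ₑ ^ 2 = ∫⁻ _ in Ioc 0 τ₀, ‖F x‖ₑ ^ 2 := by
        simp [mul_comm]
    _ ≤ ∫⁻ t in Ioc 0 τ₀, (2 * ‖F (x + t • v)‖ₑ ^ 2 + 2 * (ENNReal.ofReal τ₀ * (‖v‖ₑ ^ 2 *
          ∫⁻ t in Ioc 0 τ₀, ‖fderiv ℝ F (x + t • v)‖ₑ ^ 2))) := by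
        refine setLIntegral_mono' measurableSet_Ioc fun t ht => ?_
        refine (enorm_sq_le_segment hF x v ht.1.le).trans ?_
        gcongr
        exacts [ht.2, ht.2]
    _ = _ := by
        rw [lintegral_add_right _ measurable_const, lintegral_const_mul' _ _ (by simp)]
        simp only [lintegral_const, Measure.restrict_apply MeasurableSet.univ, univ_inter,
          Real.volume_Ioc, sub_zero]
        ring

theorem lintegral_lintegral_shear [FiniteDimensional ℝ X] [MeasurableSpace X] [BorelSpace X]
    (ν : Measure X) [ν.IsAddHaarMeasure] (v : X) (ς : ℝ) {G : X × ℝ → ℝ≥0∞} (hG : Measurable G) :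
    ∫⁻ p, (∫⁻ s : ℝ, G (p + (ς * s) • v, s)) ∂ν = ∫⁻ y, G y ∂(ν.prod volume) := by
  rw [lintegral_lintegral_swap (by fun_prop), lintegral_prod_symm' _ hG]
  congr 1 with s
  exact lintegral_add_right_eq_self (fun p => G (p, s)) _

theorem lintegral_segment_le_line {G : X × ℝ → ℝ≥0∞} (v p : X) {ς : ℝ} (hς : ς = 1 ∨ ς = -1)
    (t τ₀ : ℝ) {Q : Set (X × ℝ)}
    (hQ : ∀ τ ∈ Ioc 0 τ₀, (p + (ς * t) • v, t) + τ • (v, ς) ∈ Q) :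
    ∫⁻ τ in Ioc 0 τ₀, G ((p + (ς * t) • v, t) + τ • (v, ς)) ≤
      ∫⁻ s : ℝ, Q.indicator G (p + (ς * s) • v, s) := by
  have e : ∀ τ : ℝ, (p + (ς * t) • v, t) + τ • (v, ς) =
      (p + (ς * (t + ς * τ)) • v, t + ς * τ) := fun τ => by
    have : ς * ς = 1 := by rcases hς with rfl | rfl <;> norm_num
    ext
    · have : ς * (t + ς * τ) = ς * t + τ := by linear_combination τ * this
      simp [this, add_smul, add_assoc]
    · simp [mul_comm]
  calc ∫⁻ τ in Ioc 0 τ₀, G ((p + (ς * t) • v, t) + τ • (v, ς))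
      ≤ ∫⁻ τ in Ioc 0 τ₀, Q.indicator G (p + (ς * (t + ς * τ)) • v, t + ς * τ) := by
        refine setLIntegral_mono' measurableSet_Ioc fun τ hτ => ?_
        rw [← e, indicator_of_mem (hQ τ hτ)]
    _ ≤ ∫⁻ τ, Q.indicator G (p + (ς * (t + ς * τ)) • v, t + ς * τ) := setLIntegral_le_lintegral _ _
    _ = _ := by
        rcases hς with rfl | rfl
        · simp only [one_mul]
          exact lintegral_add_left_eq_self
            (fun s => Q.indicator G (p + s • v, s)) t
        · simp only [neg_one_mul, ← sub_eq_add_neg]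
          exact lintegral_sub_left_eq_self (fun s => Q.indicator G (p + (-s) • v, s)) t

/-- A trace inequality on sets satisfying a cone condition in the direction `(v, ς)`. -/
theorem exists_trace_le [FiniteDimensional ℝ X] [MeasurableSpace X] [BorelSpace X]
    (ν : Measure X) [ν.IsAddHaarMeasure] (Y : Type*) [EMetricSpace Y] [MeasurableSpace Y]
    [BorelSpace Y] {d : ℝ} (hd : (Module.finrank ℝ X : ℝ) = d)
    (v : X) {ς : ℝ} (hς : ς = 1 ∨ ς = -1) {c : ℝ} (hc : 0 < c) (L : ℝ≥0) :
    ∃ C : ℝ≥0, ∀ (Θ : X × ℝ → Y) (S : Set (X × ℝ)), IsCompact S → LipschitzOnWith L Θ S →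
      (∀ y₁ ∈ S, ∀ y₂ ∈ S, ∀ τ : ℝ, 0 ≤ τ → y₂.2 - y₁.2 = ς * τ →
        ‖y₂.1 - y₁.1 - τ • v‖ ≤ c * τ → τ = 0) →
      ∀ (Q : Set (X × ℝ)), MeasurableSet Q → ∀ τ₀ : ℝ≥0, 0 < τ₀ →
      (∀ y ∈ S, ∀ τ ∈ Ioc (0 : ℝ) τ₀, y + τ • (v, ς) ∈ Q) →
      ∀ f : Y → ℝ, Measurable f → ∀ F : X × ℝ → ℝ, ContDiff ℝ 1 F → (∀ y ∈ S, f (Θ y) = F y) →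
        ∫⁻ y in Θ '' S, ‖f y‖ₑ ^ 2 ∂μH[d] ≤
          C * ((τ₀ : ℝ≥0∞)⁻¹ * (∫⁻ y in Q, ‖F y‖ₑ ^ 2 ∂(ν.prod volume)) +
            τ₀ * ∫⁻ y in Q, ‖fderiv ℝ F y‖ₑ ^ 2 ∂(ν.prod volume)) := by
  set k : ℝ≥0 := (c⁻¹).toNNReal with hk
  have hkc : (k : ℝ) = c⁻¹ := Real.coe_toNNReal _ (by positivity)
  obtain ⟨C, hC⟩ := exists_lintegral_image_le ν Y (L * (1 + k * (‖v‖₊ + 1))) hd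
  refine ⟨C * (2 * (1 + ‖((v, ς) : X × ℝ)‖₊ ^ 2)),
    fun Θ S hS hΘ hcone Q hQ τ₀ hτ₀ hSQ f hf F hF hfF => ?_⟩
  have hςsq : ς * ς = 1 := by rcases hς with rfl | rfl <;> norm_num
  -- projecting along the cone direction
  let π : X × ℝ → X := fun y => y.1 - (ς * y.2) • v
  have hπ : Continuous π := by fun_prop
  have hlip1 : ∀ y₁ ∈ S, ∀ y₂ ∈ S, |y₂.2 - y₁.2| ≤ k * ‖π y₂ - π y₁‖ := by
    have key : ∀ y₁ ∈ S, ∀ y₂ ∈ S, 0 ≤ ς * (y₂.2 - y₁.2) →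
        ς * (y₂.2 - y₁.2) ≤ k * ‖π y₂ - π y₁‖ := by
      intro y₁ h₁ y₂ h₂ h0
      by_contra! hlt
      have e : π y₂ - π y₁ = y₂.1 - y₁.1 - (ς * (y₂.2 - y₁.2)) • v := by
        simp only [π, mul_sub, sub_smul]; abel
      have h1 : ‖π y₂ - π y₁‖ ≤ c * (ς * (y₂.2 - y₁.2)) := by
        rw [hkc, inv_mul_lt_iff₀ hc] at hlt
        exact hlt.le
      have h2 := hcone y₁ h₁ y₂ h₂ _ h0 (by linear_combination -(y₂.2 - y₁.2) * hςsq) (e ▸ h1)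
      rw [h2] at hlt
      exact absurd hlt (not_lt.2 (by positivity))
    intro y₁ h₁ y₂ h₂
    have habs : |y₂.2 - y₁.2| = |ς * (y₂.2 - y₁.2)| := by
      rw [abs_mul]; rcases hς with rfl | rfl <;> simp
    rw [habs]
    rcases le_total 0 (ς * (y₂.2 - y₁.2)) with h | h
    · rw [abs_of_nonneg h]; exact key y₁ h₁ y₂ h₂ h
    · rw [abs_of_nonpos h, norm_sub_rev]
      have := key y₂ h₂ y₁ h₁ (by linarith)
      linarith
  choose! sec hsecS hsec using fun p (hp : p ∈ π '' S) => hp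
  have hPm : MeasurableSet (π '' S) := (hS.image hπ).isClosed.measurableSet
  have hseclip : LipschitzOnWith (1 + k * (‖v‖₊ + 1)) sec (π '' S) := by
    refine LipschitzOnWith.of_dist_le_mul fun p₂ hp₂ p₁ hp₁ => ?_
    have h1 := hlip1 _ (hsecS p₁ hp₁) _ (hsecS p₂ hp₂)
    rw [hsec p₁ hp₁, hsec p₂ hp₂] at h1
    have e : (sec p₂).1 - (sec p₁).1 = (p₂ - p₁) + (ς * ((sec p₂).2 - (sec p₁).2)) • v := by
      have h2 := hsec p₁ hp₁
      have h3 := hsec p₂ hp₂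
      simp only [π] at h2 h3
      rw [sub_eq_iff_eq_add.1 h2, sub_eq_iff_eq_add.1 h3, mul_sub, sub_smul]
      abel
    have habs : |ς * ((sec p₂).2 - (sec p₁).2)| = |(sec p₂).2 - (sec p₁).2| := by
      rw [abs_mul]; rcases hς with rfl | rfl <;> simp
    rw [Prod.dist_eq, dist_eq_norm (sec p₂).1, e, dist_eq_norm p₂, Real.dist_eq]
    push_cast
    have hk0 : 0 ≤ (k : ℝ) * ‖p₂ - p₁‖ := by positivity
    refine max_le ?_ (h1.trans ?_)
    · refine (norm_add_le _ _).trans ?_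
      rw [norm_smul, Real.norm_eq_abs, habs]
      nlinarith [mul_le_mul_of_nonneg_right h1 (norm_nonneg v)]
    · nlinarith [mul_nonneg hk0 (norm_nonneg v), norm_nonneg (p₂ - p₁)]
  have himg : sec '' (π '' S) = S := by
    refine Subset.antisymm (image_subset_iff.2 hsecS) fun y hy => ?_
    have hp : π y ∈ π '' S := mem_image_of_mem π hy
    refine ⟨π y, hp, ?_⟩
    have h1 := hlip1 _ (hsecS _ hp) _ hy
    rw [hsec _ hp, sub_self, norm_zero, mul_zero] at h1
    have h2 : y.2 = (sec (π y)).2 := by linarith [abs_nonpos_iff.1 h1]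
    refine Prod.ext ?_ h2.symm
    have h3 := hsec _ hp
    simp only [π] at h3 h2
    rw [← h2] at h3
    exact sub_left_inj.1 h3
  have hlip : LipschitzOnWith (L * (1 + k * (‖v‖₊ + 1))) (Θ ∘ sec) (π '' S) :=
    hΘ.comp hseclip hsecS
  have hFc : Continuous F := hF.continuous
  have hdF : Continuous (fderiv ℝ F) := hF.continuous_fderiv one_ne_zero
  have hτ : (τ₀ : ℝ≥0∞) ≠ 0 := by simpa using hτ₀.ne'
  set D : ℝ≥0∞ := ((‖((v, ς) : X × ℝ)‖₊ : ℝ≥0) : ℝ≥0∞) ^ 2 with hD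
  set I := ∫⁻ y in Q, ‖F y‖ₑ ^ 2 ∂(ν.prod volume) with hI
  set J := ∫⁻ y in Q, ‖fderiv ℝ F y‖ₑ ^ 2 ∂(ν.prod volume) with hJ
  let A : (X × ℝ → ℝ≥0∞) → X → ℝ≥0∞ := fun G p => ∫⁻ s : ℝ, Q.indicator G (p + (ς * s) • v, s)
  have hA : ∀ G : X × ℝ → ℝ≥0∞, Measurable G → Measurable (A G) ∧
      ∫⁻ p in π '' S, A G p ∂ν ≤ ∫⁻ y in Q, G y ∂(ν.prod volume) := by
    intro G hG
    have hm : Measurable (Q.indicator G) := hG.indicator hQ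
    refine ⟨Measurable.lintegral_prod_right'
      (f := fun q : X × ℝ => Q.indicator G (q.1 + (ς * q.2) • v, q.2)) (by fun_prop), ?_⟩
    refine (setLIntegral_le_lintegral _ _).trans ?_
    rw [lintegral_lintegral_shear ν v ς hm, lintegral_indicator hQ]
  obtain ⟨hA1m, hA1⟩ := hA (fun y => ‖F y‖ₑ ^ 2) (by fun_prop)
  obtain ⟨hA2m, hA2⟩ := hA (fun y => ‖fderiv ℝ F y‖ₑ ^ 2) (by fun_prop)
  have hpt : ∀ p ∈ π '' S, ‖f (Θ (sec p))‖ₑ ^ 2 ≤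
      2 * ((τ₀ : ℝ≥0∞)⁻¹ * A (fun y => ‖F y‖ₑ ^ 2) p) +
      2 * (τ₀ * (D * A (fun y => ‖fderiv ℝ F y‖ₑ ^ 2) p)) := by
    intro p hp
    rw [hfF _ (hsecS p hp)]
    have e : sec p = (p + (ς * (sec p).2) • v, (sec p).2) := by
      refine Prod.ext ?_ rfl
      exact sub_eq_iff_eq_add.1 (hsec p hp)
    have hQ' : ∀ τ ∈ Ioc (0 : ℝ) τ₀,
        (p + (ς * (sec p).2) • v, (sec p).2) + τ • (v, ς) ∈ Q := by
      rw [← e]; exact hSQ _ (hsecS p hp)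
    have h1 := ofReal_mul_enorm_sq_le_segment hF (sec p) ((v, ς) : X × ℝ) τ₀
    rw [ENNReal.ofReal_coe_nnreal] at h1
    have h2 : (τ₀ : ℝ≥0∞) * ‖F (sec p)‖ₑ ^ 2 ≤ 2 * A (fun y => ‖F y‖ₑ ^ 2) p +
        2 * ((τ₀ : ℝ≥0∞) ^ 2 * (D * A (fun y => ‖fderiv ℝ F y‖ₑ ^ 2) p)) := by
      refine h1.trans ?_
      have h3 := lintegral_segment_le_line (G := fun y => ‖F y‖ₑ ^ 2) v p hς _ _ hQ'
      have h4 := lintegral_segment_le_line (G := fun y => ‖fderiv ℝ F y‖ₑ ^ 2) v p hς _ _ hQ'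
      rw [← e] at h3 h4
      exact add_le_add (mul_le_mul_right h3 _) (mul_le_mul_right (mul_le_mul_right
        (mul_le_mul_right h4 _) _) _)
    calc ‖F (sec p)‖ₑ ^ 2 = (τ₀ : ℝ≥0∞)⁻¹ * (τ₀ * ‖F (sec p)‖ₑ ^ 2) := by
          rw [← mul_assoc, ENNReal.inv_mul_cancel hτ ENNReal.coe_ne_top, one_mul]
      _ ≤ (τ₀ : ℝ≥0∞)⁻¹ * _ := mul_le_mul_right h2 _
      _ = 2 * ((τ₀ : ℝ≥0∞)⁻¹ * A (fun y => ‖F y‖ₑ ^ 2) p) +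
          (τ₀ : ℝ≥0∞)⁻¹ * τ₀ * (2 * (τ₀ * (D * A (fun y => ‖fderiv ℝ F y‖ₑ ^ 2) p))) := by ring
      _ = _ := by rw [ENNReal.inv_mul_cancel hτ ENNReal.coe_ne_top, one_mul]
  calc ∫⁻ y in Θ '' S, ‖f y‖ₑ ^ 2 ∂μH[d]
      = ∫⁻ y in (Θ ∘ sec) '' (π '' S), ‖f y‖ₑ ^ 2 ∂μH[d] := by rw [image_comp, himg]
    _ ≤ C * ∫⁻ p in π '' S, ‖f (Θ (sec p))‖ₑ ^ 2 ∂ν :=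
        hC _ _ hPm hlip (fun y => ‖f y‖ₑ ^ 2) (by fun_prop)
    _ ≤ C * ∫⁻ p in π '' S, (2 * ((τ₀ : ℝ≥0∞)⁻¹ * A (fun y => ‖F y‖ₑ ^ 2) p) +
          2 * (τ₀ * (D * A (fun y => ‖fderiv ℝ F y‖ₑ ^ 2) p))) ∂ν := by
        exact mul_le_mul_right (setLIntegral_mono' hPm hpt) _
    _ = C * (2 * ((τ₀ : ℝ≥0∞)⁻¹ * ∫⁻ p in π '' S, A (fun y => ‖F y‖ₑ ^ 2) p ∂ν) +
          2 * (τ₀ * (D * ∫⁻ p in π '' S, A (fun y => ‖fderiv ℝ F y‖ₑ ^ 2) p ∂ν))) := by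
        rw [lintegral_add_left (by fun_prop), lintegral_const_mul _ (by fun_prop),
          lintegral_const_mul _ (by fun_prop), lintegral_const_mul _ (by fun_prop),
          lintegral_const_mul _ (by fun_prop), lintegral_const_mul _ (by fun_prop)]
    _ ≤ C * (2 * ((τ₀ : ℝ≥0∞)⁻¹ * I) + 2 * (τ₀ * (D * J))) := by gcongr
    _ ≤ C * (2 * (1 + D) * ((τ₀ : ℝ≥0∞)⁻¹ * I + τ₀ * J)) := by
        refine mul_le_mul_right ?_ _
        calc 2 * ((τ₀ : ℝ≥0∞)⁻¹ * I) + 2 * (τ₀ * (D * J)) ≤ 2 * ((τ₀ : ℝ≥0∞)⁻¹ * I) +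
              2 * (τ₀ * (D * J)) + (2 * D * ((τ₀ : ℝ≥0∞)⁻¹ * I) + 2 * (τ₀ * J)) := le_self_add
          _ = _ := by ring
    _ = _ := by
        rw [← mul_assoc]
        push_cast
        rfl

end Trace

section Dilation

variable {X : Type*} [NormedAddCommGroup X] [NormedSpace ℝ X]

theorem lintegral_dilation_le [FiniteDimensional ℝ X] [MeasurableSpace X] [BorelSpace X]
    (ν : Measure X) [ν.IsAddHaarMeasure] (hd : 2 ≤ Module.finrank ℝ X) {l : ℝ} (hl : 1 ≤ l)
    {G : X × ℝ → ℝ≥0∞} (hG : Measurable G) :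
    ∫⁻ y : X × ℝ, G (l • y.1, y.2) ∂(ν.prod volume) ≤
      ENNReal.ofReal ((l ^ 2)⁻¹) * ∫⁻ y, G y ∂(ν.prod volume) := by
  have hl0 : 0 < l := by linarith
  rw [lintegral_prod_symm' _ (by fun_prop), lintegral_prod_symm' _ hG,
    ← lintegral_const_mul' _ _ ENNReal.ofReal_ne_top]
  refine lintegral_mono fun s => ?_
  have hGs : Measurable fun z => G (z, s) := by fun_prop
  have h1 : ∫⁻ z, G (l • z, s) ∂ν = ∫⁻ z, G (z, s) ∂(Measure.map (l • ·) ν) :=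
    (lintegral_map hGs (measurable_const_smul l)).symm
  simp only
  rw [h1, Measure.map_addHaar_smul ν hl0.ne', lintegral_smul_measure, smul_eq_mul]
  gcongr
  rw [abs_of_pos (by positivity)]
  gcongr

theorem lintegral_inv_Ioc {b : ℝ} (hb : 1 ≤ b) :
    ∫⁻ t in Ioc 1 b, ENNReal.ofReal t⁻¹ = ENNReal.ofReal (Real.log b) := by
  have h0 : (0 : ℝ) ∉ uIcc 1 b := by
    rw [uIcc_of_le hb]; simp
  have hi : IntervalIntegrable (fun t : ℝ => t⁻¹) volume 1 b :=
    (intervalIntegral.intervalIntegrable_inv (fun t ht => by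
      rintro rfl; exact h0 ht) continuousOn_id)
  rw [← ofReal_integral_eq_lintegral_ofReal ((intervalIntegrable_iff_integrableOn_Ioc_of_le hb).1 hi)
    ((ae_restrict_iff' measurableSet_Ioc).2 (ae_of_all _ fun t ht => by
      have := ht.1; simp only [Pi.zero_apply]; positivity)),
    ← intervalIntegral.integral_of_le hb, integral_inv h0, div_one]

theorem lintegral_inv_pow_Ioi {b : ℝ} (hb : 0 < b) :
    ∫⁻ t in Ioi b, ENNReal.ofReal ((t ^ 3)⁻¹) = ENNReal.ofReal ((b ^ 2)⁻¹ / 2) := by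
  have e : ∀ t ∈ Ioi b, (t ^ 3)⁻¹ = t ^ (-3 : ℝ) := fun t ht => by
    rw [Real.rpow_neg (hb.trans ht).le]; norm_cast
  rw [setLIntegral_congr_fun measurableSet_Ioi fun t ht => by rw [e t ht],
    ← ofReal_integral_eq_lintegral_ofReal (integrableOn_Ioi_rpow_of_lt (by norm_num) hb)
    ((ae_restrict_iff' measurableSet_Ioi).2 (ae_of_all _ fun t ht =>
      Real.rpow_nonneg (hb.trans ht).le _)), integral_Ioi_rpow_of_lt (by norm_num) hb]
  congr 1
  rw [show (-3 : ℝ) + 1 = -(2 : ℕ) by norm_num, Real.rpow_neg hb.le, Real.rpow_natCast]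
  push_cast
  ring

theorem enorm_sq_le_dilation {F : X × ℝ → ℝ} (hF : ContDiff ℝ 1 F) (y : X × ℝ) {b : ℝ}
    (hb : 1 ≤ b) :
    ‖F y‖ₑ ^ 2 ≤ 2 * ‖F (b • y.1, y.2)‖ₑ ^ 2 + 2 * (ENNReal.ofReal (Real.log b) *
      ∫⁻ t in Ioc 1 b, ENNReal.ofReal t * (‖fderiv ℝ F (t • y.1, y.2)‖ₑ ^ 2 * ‖y.1‖ₑ ^ 2)) := by
  have hγ : ∀ t : ℝ, HasDerivAt (fun t : ℝ => (t • y.1, y.2)) (y.1, 0) t := fun t => by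
    refine HasDerivAt.prodMk ?_ (hasDerivAt_const _ _)
    simpa using (hasDerivAt_id t).smul_const y.1
  have hdF : Continuous (fderiv ℝ F) := hF.continuous_fderiv one_ne_zero
  have h1 := enorm_sq_le_weighted (u := fun t => F (t • y.1, y.2))
    (u' := fun t => fderiv ℝ F (t • y.1, y.2) (y.1, 0))
    (fun t => ((hF.differentiable one_ne_zero) _).hasFDerivAt.comp_hasDerivAt t (hγ t))
    (by fun_prop) (w := fun t => ENNReal.ofReal (√t)) (by fun_prop) hb
    (fun t ht => ⟨by
      have : 0 < t := by linarith [ht.1]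
      simpa using this, ENNReal.ofReal_ne_top⟩)
  simp only [one_smul] at h1
  refine h1.trans ?_
  rw [← lintegral_inv_Ioc hb]
  refine add_le_add le_rfl (mul_le_mul_right (mul_le_mul' ?_ ?_) _)
  · refine setLIntegral_mono' measurableSet_Ioc fun t ht => ?_
    have : 0 < t := by linarith [ht.1]
    rw [← ENNReal.ofReal_inv_of_pos (by positivity), ← ENNReal.ofReal_pow (by positivity),
      inv_pow, Real.sq_sqrt this.le]
  · refine setLIntegral_mono' measurableSet_Ioc fun t ht => ?_
    have : 0 < t := by linarith [ht.1]
    rw [mul_pow, ← ENNReal.ofReal_pow (by positivity), Real.sq_sqrt this.le, ← mul_pow]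
    gcongr
    refine (ContinuousLinearMap.le_opENorm _ _).trans ?_
    gcongr
    simp [enorm_eq_nnnorm, Prod.nnnorm_def]

/-- Decay of the mass of a function near the axis of a set closed under outward dilations. -/
theorem lintegral_near_axis_le [FiniteDimensional ℝ X] [MeasurableSpace X] [BorelSpace X]
    (ν : Measure X) [ν.IsAddHaarMeasure] (hd : 2 ≤ Module.finrank ℝ X) {D : Set (X × ℝ)}
    (hD : MeasurableSet D)
    (hDl : ∀ y ∈ D, ∀ l : ℝ, 1 ≤ l → l * ‖y.1‖ ≤ 1 → (l • y.1, y.2) ∈ D)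
    {F : X × ℝ → ℝ} (hF : ContDiff ℝ 1 F) {b : ℝ} (hb : 1 ≤ b) :
    ∫⁻ y in D ∩ {y | ‖y.1‖ ≤ b⁻¹}, ‖F y‖ₑ ^ 2 ∂(ν.prod volume) ≤
      2 * ENNReal.ofReal ((b ^ 2)⁻¹) *
        ((∫⁻ y in D ∩ {y | ‖y.1‖ ≤ 1}, ‖F y‖ₑ ^ 2 ∂(ν.prod volume)) +
          ENNReal.ofReal (Real.log b) *
            ∫⁻ y in D ∩ {y | ‖y.1‖ ≤ 1}, ‖fderiv ℝ F y‖ₑ ^ 2 ∂(ν.prod volume)) := by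
  have hb0 : 0 < b := by linarith
  have hFc : Continuous F := hF.continuous
  have hdF : Continuous (fderiv ℝ F) := hF.continuous_fderiv one_ne_zero
  set D₁ : Set (X × ℝ) := D ∩ {y | ‖y.1‖ ≤ 1} with hD₁
  have hD₁m : MeasurableSet D₁ := hD.inter (measurableSet_le (by fun_prop) (by fun_prop))
  have hDbm : MeasurableSet (D ∩ {y : X × ℝ | ‖y.1‖ ≤ b⁻¹}) :=
    hD.inter (measurableSet_le (by fun_prop) (by fun_prop))
  set G₁ : X × ℝ → ℝ≥0∞ := D₁.indicator fun y => ‖F y‖ₑ ^ 2 with hG₁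
  set G₂ : X × ℝ → ℝ≥0∞ := D₁.indicator fun y => ‖fderiv ℝ F y‖ₑ ^ 2 * ‖y.1‖ₑ ^ 2 with hG₂
  have hG₁m : Measurable G₁ := Measurable.indicator (by fun_prop) hD₁m
  have hG₂m : Measurable G₂ := Measurable.indicator (by fun_prop) hD₁m
  -- the kernel appearing in the second term
  let H : X × ℝ → ℝ → ℝ≥0∞ := fun y t =>
    ({y : X × ℝ | ‖y.1‖ ≤ t * b⁻¹}.indicator G₂ y)
  have hpt : ∀ y ∈ D ∩ {y : X × ℝ | ‖y.1‖ ≤ b⁻¹}, ‖F y‖ₑ ^ 2 ≤ 2 * G₁ (b • y.1, y.2) +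
      2 * (ENNReal.ofReal (Real.log b) *
        ∫⁻ t in Ioc 1 b, ENNReal.ofReal (t⁻¹) * H (t • y.1, y.2) t) := by
    rintro y ⟨hyD, hy : ‖y.1‖ ≤ b⁻¹⟩
    have hmem : ∀ t ∈ Icc 1 b, (t • y.1, y.2) ∈ D₁ := by
      intro t ht
      have ht0 : 0 < t := by linarith [ht.1]
      have h1 : t * ‖y.1‖ ≤ 1 := by
        calc t * ‖y.1‖ ≤ b * b⁻¹ := by gcongr; exact ht.2
          _ = 1 := mul_inv_cancel₀ hb0.ne'
      refine ⟨hDl y hyD t ht.1 h1, ?_⟩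
      change ‖t • y.1‖ ≤ 1
      rwa [norm_smul, Real.norm_of_nonneg ht0.le]
    refine (enorm_sq_le_dilation hF y hb).trans ?_
    rw [hG₁, indicator_of_mem (hmem b ⟨hb, le_rfl⟩)]
    refine add_le_add le_rfl (mul_le_mul_right (mul_le_mul_right ?_ _) _)
    refine setLIntegral_mono' measurableSet_Ioc fun t ht => ?_
    have ht0 : 0 < t := by linarith [ht.1]
    have hin : (t • y.1, y.2) ∈ {y : X × ℝ | ‖y.1‖ ≤ t * b⁻¹} := by
      change ‖t • y.1‖ ≤ t * b⁻¹
      rw [norm_smul, Real.norm_of_nonneg ht0.le]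
      gcongr
    simp only [H]
    rw [indicator_of_mem hin, hG₂, indicator_of_mem (hmem t ⟨ht.1.le, ht.2⟩)]
    simp only [enorm_smul, mul_pow]
    rw [Real.enorm_of_nonneg ht0.le, ← ENNReal.ofReal_pow ht0.le]
    have e : ENNReal.ofReal t⁻¹ * ENNReal.ofReal (t ^ 2) = ENNReal.ofReal t := by
      rw [← ENNReal.ofReal_mul (by positivity)]; congr 1; field_simp
    refine le_of_eq ?_
    rw [← e]; ring
  have hHm : Measurable (Function.uncurry H) := by
    have : Function.uncurry H = {q : (X × ℝ) × ℝ | ‖q.1.1‖ ≤ q.2 * b⁻¹}.indicator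
        fun q => G₂ q.1 := by
      ext q; rfl
    rw [this]
    exact Measurable.indicator (by fun_prop)
      (measurableSet_le (f := fun q : (X × ℝ) × ℝ => ‖q.1.1‖) (g := fun q => q.2 * b⁻¹)
        (by fun_prop) (by fun_prop))
  have hHt : ∀ t, Measurable fun y => H y t :=
    fun t => hHm.comp (measurable_id.prodMk measurable_const)
  have hHm' : Measurable fun q : (X × ℝ) × ℝ => H (q.2 • q.1.1, q.1.2) q.2 :=
    hHm.comp (g := Function.uncurry H) (f := fun q : (X × ℝ) × ℝ => ((q.2 • q.1.1, q.1.2), q.2))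
      (by fun_prop)
  have hsecond : ∫⁻ y, (∫⁻ t in Ioc 1 b, ENNReal.ofReal (t⁻¹) * H (t • y.1, y.2) t)
      ∂(ν.prod volume) ≤ ENNReal.ofReal ((b ^ 2)⁻¹) *
        ∫⁻ y in D₁, ‖fderiv ℝ F y‖ₑ ^ 2 ∂(ν.prod volume) := by
    calc ∫⁻ y, (∫⁻ t in Ioc 1 b, ENNReal.ofReal (t⁻¹) * H (t • y.1, y.2) t) ∂(ν.prod volume)
        = ∫⁻ t in Ioc 1 b, ENNReal.ofReal (t⁻¹) *
            ∫⁻ y, H (t • y.1, y.2) t ∂(ν.prod volume) := by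
          rw [lintegral_lintegral_swap]
          · congr 1 with t
            exact lintegral_const_mul' _ _ ENNReal.ofReal_ne_top
          · exact (Measurable.mul (by fun_prop) hHm').aemeasurable
      _ ≤ ∫⁻ t in Ioc 1 b, ENNReal.ofReal (t⁻¹) * (ENNReal.ofReal ((t ^ 2)⁻¹) *
            ∫⁻ y, H y t ∂(ν.prod volume)) := by
          refine setLIntegral_mono' measurableSet_Ioc fun t ht => ?_
          gcongr
          exact lintegral_dilation_le ν hd ht.1.le (hHt t)
      _ = ∫⁻ y, (∫⁻ t in Ioc 1 b, ENNReal.ofReal ((t ^ 3)⁻¹) * H y t) ∂(ν.prod volume) := by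
          rw [lintegral_lintegral_swap (f := fun (y : X × ℝ) t => ENNReal.ofReal ((t ^ 3)⁻¹) * H y t)
            (Measurable.mul (by fun_prop) hHm).aemeasurable]
          refine setLIntegral_congr_fun measurableSet_Ioc fun t ht => ?_
          have ht0 : 0 < t := by linarith [ht.1]
          rw [lintegral_const_mul' _ _ ENNReal.ofReal_ne_top, ← mul_assoc,
            ← ENNReal.ofReal_mul (by positivity)]
          congr 2
          rw [← mul_inv]; congr 1; ring
      _ ≤ ∫⁻ y, D₁.indicator (fun y => ENNReal.ofReal ((b ^ 2)⁻¹) * ‖fderiv ℝ F y‖ₑ ^ 2) y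
            ∂(ν.prod volume) := by
          refine lintegral_mono fun y => ?_
          by_cases hy : y ∈ D₁
          swap
          · have : ∀ t, H y t = 0 := fun t => by
              simp only [H, hG₂]
              rw [indicator_apply, indicator_of_notMem hy]; simp
            simp [this]
          rw [indicator_of_mem hy]
          have hHy : ∀ t, H y t ≤ (Ici (‖y.1‖ * b)).indicator
              (fun _ => ‖fderiv ℝ F y‖ₑ ^ 2 * ‖y.1‖ₑ ^ 2) t := by
            intro t
            simp only [H, hG₂]
            by_cases ht : ‖y.1‖ ≤ t * b⁻¹
            · have : ‖y.1‖ * b ≤ t := by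
                rwa [← div_eq_mul_inv, le_div_iff₀ hb0] at ht
              rw [indicator_of_mem (s := Ici (‖y.1‖ * b)) this]
              rw [indicator_of_mem (s := {y : X × ℝ | ‖y.1‖ ≤ t * b⁻¹}) ht, indicator_of_mem hy]
            · rw [indicator_of_notMem (s := {y : X × ℝ | ‖y.1‖ ≤ t * b⁻¹}) ht]
              exact bot_le
          rcases eq_or_ne y.1 0 with h0 | h0
          · refine le_trans (le_of_eq ?_) bot_le
            refine (lintegral_congr fun t => ?_).trans lintegral_zero
            have := hHy t
            simp only [h0, enorm_zero] at this
            have h2 : H y t = 0 := by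
              refine le_antisymm (this.trans ?_) bot_le
              rw [indicator_apply]; split_ifs <;> simp
            rw [h2, mul_zero]
          have hn : 0 < ‖y.1‖ := norm_pos_iff.2 h0
          have hnb : 0 < ‖y.1‖ * b := by positivity
          calc ∫⁻ t in Ioc 1 b, ENNReal.ofReal ((t ^ 3)⁻¹) * H y t
              ≤ ∫⁻ t, (Ici (‖y.1‖ * b)).indicator (fun t => ENNReal.ofReal ((t ^ 3)⁻¹) *
                  (‖fderiv ℝ F y‖ₑ ^ 2 * ‖y.1‖ₑ ^ 2)) t := by
                refine (setLIntegral_le_lintegral _ _).trans (lintegral_mono fun t => ?_)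
                refine (mul_le_mul_right (hHy t) _).trans (le_of_eq ?_)
                simp only [indicator_apply]
                split_ifs <;> simp
            _ = ENNReal.ofReal (((‖y.1‖ * b) ^ 2)⁻¹ / 2) *
                  (‖fderiv ℝ F y‖ₑ ^ 2 * ‖y.1‖ₑ ^ 2) := by
                rw [lintegral_indicator measurableSet_Ici, setLIntegral_congr Ioi_ae_eq_Ici.symm,
                  lintegral_mul_const' _ _ (ENNReal.mul_ne_top (by simp) (by simp)),
                  lintegral_inv_pow_Ioi hnb]
            _ ≤ _ := by
                rw [mul_comm (‖fderiv ℝ F y‖ₑ ^ 2), ← mul_assoc]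
                gcongr
                rw [← ofReal_norm, ← ENNReal.ofReal_pow (norm_nonneg _),
                  ← ENNReal.ofReal_mul (by positivity)]
                refine ENNReal.ofReal_le_ofReal ?_
                have : ((‖y.1‖ * b) ^ 2)⁻¹ / 2 * ‖y.1‖ ^ 2 = (b ^ 2)⁻¹ / 2 := by
                  field_simp
                rw [this]
                have : 0 < (b ^ 2)⁻¹ := by positivity
                linarith
      _ = _ := by
          rw [lintegral_indicator hD₁m, lintegral_const_mul' _ _ ENNReal.ofReal_ne_top]
  calc ∫⁻ y in D ∩ {y | ‖y.1‖ ≤ b⁻¹}, ‖F y‖ₑ ^ 2 ∂(ν.prod volume)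
      ≤ ∫⁻ y in D ∩ {y | ‖y.1‖ ≤ b⁻¹}, (2 * G₁ (b • y.1, y.2) +
        2 * (ENNReal.ofReal (Real.log b) *
        ∫⁻ t in Ioc 1 b, ENNReal.ofReal (t⁻¹) * H (t • y.1, y.2) t)) ∂(ν.prod volume) :=
        setLIntegral_mono' hDbm hpt
    _ ≤ ∫⁻ y, (2 * G₁ (b • y.1, y.2) + 2 * (ENNReal.ofReal (Real.log b) *
        ∫⁻ t in Ioc 1 b, ENNReal.ofReal (t⁻¹) * H (t • y.1, y.2) t)) ∂(ν.prod volume) :=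
        setLIntegral_le_lintegral _ _
    _ = 2 * (∫⁻ y, G₁ (b • y.1, y.2) ∂(ν.prod volume)) + 2 * (ENNReal.ofReal (Real.log b) *
        ∫⁻ y, (∫⁻ t in Ioc 1 b, ENNReal.ofReal (t⁻¹) * H (t • y.1, y.2) t) ∂(ν.prod volume)) := by
        rw [lintegral_add_left (by fun_prop), lintegral_const_mul' _ _ (by simp),
          lintegral_const_mul' _ _ (by simp), lintegral_const_mul' _ _ (by simp)]
    _ ≤ 2 * (ENNReal.ofReal ((b ^ 2)⁻¹) *
          ∫⁻ y in D₁, ‖F y‖ₑ ^ 2 ∂(ν.prod volume)) + 2 * (ENNReal.ofReal (Real.log b) *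
        (ENNReal.ofReal ((b ^ 2)⁻¹) *
        ∫⁻ y in D₁, ‖fderiv ℝ F y‖ₑ ^ 2 ∂(ν.prod volume))) := by
        gcongr
        refine (lintegral_dilation_le ν hd hb hG₁m).trans (le_of_eq ?_)
        rw [hG₁, lintegral_indicator hD₁m]
    _ = _ := by ring

end Dilation

section AxisCutoff

theorem enorm_sum_sq_le_of_disjoint {ι V : Type*} [NormedAddCommGroup V] (s : Finset ι)
    (u : ι → V) (h : ∀ i ∈ s, ∀ j ∈ s, u i ≠ 0 → u j ≠ 0 → i = j) :
    ‖∑ i ∈ s, u i‖ₑ ^ 2 ≤ ∑ i ∈ s, ‖u i‖ₑ ^ 2 := by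
  by_cases h0 : ∀ i ∈ s, u i = 0
  · rw [Finset.sum_eq_zero h0]; simp
  · push Not at h0
    obtain ⟨i, hi, hne⟩ := h0
    rw [Finset.sum_eq_single i (fun j hj hji => by
      by_contra hj0
      exact hji (h j hj i hi hj0 hne)) (fun hi' => absurd hi hi')]
    exact Finset.single_le_sum (f := fun i => ‖u i‖ₑ ^ 2) (fun _ _ => bot_le) hi

/-- Functions vanishing near the axis of codimension at least two and with small weighted
energy: the axis has capacity zero, uniformly in sets closed under outward dilations. -/
theorem exists_axis_cutoff {X : Type*} [NormedAddCommGroup X] [InnerProductSpace ℝ X]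
    [FiniteDimensional ℝ X] [MeasurableSpace X] [BorelSpace X]
    (ν : Measure X) [ν.IsAddHaarMeasure] (hd : 2 ≤ Module.finrank ℝ X) (K : ℕ) {ε : ℝ≥0}
    (hε : 0 < ε) :
    ∃ (η : X → ℝ) (ρ : ℝ), 0 < ρ ∧ ContDiff ℝ (⊤ : ℕ∞) η ∧ (∀ x, 0 ≤ η x) ∧ (∀ x, η x ≤ 1) ∧
      (∀ x, ‖x‖ ≤ ρ → η x = 0) ∧ (∀ x, ((2 : ℝ) ^ K)⁻¹ < ‖x‖ → η x = 1) ∧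
      ∀ D : Set (X × ℝ), MeasurableSet D →
        (∀ y ∈ D, ∀ l : ℝ, 1 ≤ l → l * ‖y.1‖ ≤ 1 → (l • y.1, y.2) ∈ D) →
        ∀ F : X × ℝ → ℝ, ContDiff ℝ 1 F →
          ∫⁻ y in D, (‖F y‖ₑ * ‖fderiv ℝ η y.1‖ₑ) ^ 2 ∂(ν.prod volume) ≤
            ε * ((∫⁻ y in D ∩ {y | ‖y.1‖ ≤ 1}, ‖F y‖ₑ ^ 2 ∂(ν.prod volume)) +
              ∫⁻ y in D ∩ {y | ‖y.1‖ ≤ 1}, ‖fderiv ℝ F y‖ₑ ^ 2 ∂(ν.prod volume)) := by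
  obtain ⟨L, hL0, hL⟩ := exists_scaled_cutoff X
  have hb0 : ∀ i : ℕ, (0 : ℝ) < 2 ^ (K + i) := fun i => by positivity
  have hb1 : ∀ i : ℕ, (1 : ℝ) ≤ 2 ^ (K + i) := fun i => one_le_pow₀ (by norm_num)
  choose φ hφ hφ0 hφ1 hφin hφout hφd using fun i : ℕ =>
    hL 0 (((2 : ℝ) ^ (K + i))⁻¹ / 2) (by positivity)
  have hsupp : ∀ i x, fderiv ℝ (φ i) x ≠ 0 →
      ((2 : ℝ) ^ (K + i))⁻¹ / 2 < ‖x‖ ∧ ‖x‖ ≤ ((2 : ℝ) ^ (K + i))⁻¹ := by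
    intro i x hx
    constructor
    · by_contra! hle
      refine hx (IsLocalMax.fderiv_eq_zero (Eventually.of_forall fun y => ?_))
      rw [hφin i x (by simpa using hle)]
      exact hφ1 i y
    · by_contra! hlt
      refine hx (IsLocalMin.fderiv_eq_zero (Eventually.of_forall fun y => ?_))
      rw [hφout i x (by rw [mem_closedBall_zero_iff, not_le]; linarith)]
      exact hφ0 i y
  have hdisj : ∀ i j x, fderiv ℝ (φ i) x ≠ 0 → fderiv ℝ (φ j) x ≠ 0 → i = j := by
    have key : ∀ i j x, fderiv ℝ (φ i) x ≠ 0 → fderiv ℝ (φ j) x ≠ 0 → ¬ i < j := by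
      intro i j x hi hj hij
      have h1 := (hsupp i x hi).1
      have h2 := (hsupp j x hj).2
      have h3 : ((2 : ℝ) ^ (K + j))⁻¹ ≤ ((2 : ℝ) ^ (K + i))⁻¹ / 2 := by
        rw [div_eq_mul_inv, ← mul_inv, ← pow_succ]
        exact inv_anti₀ (by positivity) (pow_le_pow_right₀ one_le_two (by omega))
      linarith
    intro i j x hi hj
    exact le_antisymm (not_lt.1 (key j i x hj hi)) (not_lt.1 (key i j x hi hj))
  -- choice of the number of scales
  obtain ⟨M, hM⟩ : ∃ M : ℕ, 8 * L ^ 2 * (K + 1) / ε + 1 ≤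
      ∑ i ∈ Finset.range M, (1 / ((i : ℝ) + 1)) :=
    (Real.tendsto_sum_range_one_div_nat_succ_atTop.eventually_ge_atTop _).exists
  set H : ℝ := ∑ i ∈ Finset.range M, (1 / ((i : ℝ) + 1)) with hH
  have hε' : (0 : ℝ) < ε := hε
  have hH1 : 8 * L ^ 2 * (K + 1) ≤ ε * H := by
    have : 8 * L ^ 2 * (K + 1) / ε ≤ H := by linarith
    rw [div_le_iff₀ hε'] at this
    linarith
  have hH0 : 0 < H := by
    have : 0 ≤ 8 * L ^ 2 * (K + 1) / ε := by positivity
    linarith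
  let a : ℕ → ℝ := fun i => H⁻¹ * (1 / ((i : ℝ) + 1))
  have ha0 : ∀ i, 0 ≤ a i := fun i => by positivity
  have hasum : ∑ i ∈ Finset.range M, a i = 1 := by
    rw [← Finset.mul_sum, ← hH, inv_mul_cancel₀ hH0.ne']
  let η : X → ℝ := fun x => 1 - ∑ i ∈ Finset.range M, a i * φ i x
  have hfd : ∀ x, fderiv ℝ η x = -∑ i ∈ Finset.range M, a i • fderiv ℝ (φ i) x := by
    intro x
    have h1 : HasFDerivAt η (-∑ i ∈ Finset.range M, a i • fderiv ℝ (φ i) x) x := by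
      refine (HasFDerivAt.fun_sum fun i _ => ?_).const_sub 1
      exact (((hφ i).differentiable (by simp)) x).hasFDerivAt.const_mul (a i)
    exact h1.fderiv
  refine ⟨η, ((2 : ℝ) ^ (K + M))⁻¹ / 2, by positivity,
    contDiff_const.sub (ContDiff.sum fun i _ => contDiff_const.mul (hφ i)),
    fun x => ?_, fun x => ?_, fun x hx => ?_, fun x hx => ?_, ?_⟩
  · refine sub_nonneg.2 ?_
    rw [← hasum]
    exact Finset.sum_le_sum fun i _ => mul_le_of_le_one_right (ha0 i) (hφ1 i x)
  · exact sub_le_self _ (Finset.sum_nonneg fun i _ => mul_nonneg (ha0 i) (hφ0 i x))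
  · refine sub_eq_zero.2 ?_
    rw [← hasum]
    refine Finset.sum_congr rfl fun i hi => ?_
    rw [hφin i x, mul_one]
    rw [mem_closedBall_zero_iff]
    refine hx.trans ?_
    gcongr
    · norm_num
    · exact (Finset.mem_range.1 hi).le
  · refine sub_eq_self.2 (Finset.sum_eq_zero fun i _ => ?_)
    rw [hφout i x, mul_zero]
    rw [mem_closedBall_zero_iff, not_le]
    refine lt_of_le_of_lt ?_ hx
    rw [mul_div_cancel₀ _ two_ne_zero]
    gcongr
    · norm_num
    · omega
  · intro D hD hDl F hF
    have hFc : Continuous F := hF.continuous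
    set N := ∫⁻ y in D ∩ {y | ‖y.1‖ ≤ 1}, ‖F y‖ₑ ^ 2 ∂(ν.prod volume) with hN
    set A := ∫⁻ y in D ∩ {y | ‖y.1‖ ≤ 1}, ‖fderiv ℝ F y‖ₑ ^ 2 ∂(ν.prod volume) with hA
    have hDm : ∀ c : ℝ, MeasurableSet {y : X × ℝ | ‖y.1‖ ≤ c} := fun c =>
      measurableSet_le (by fun_prop) (by fun_prop)
    have hterm : ∀ i, ∫⁻ y in D, ‖F y‖ₑ ^ 2 * ‖a i • fderiv ℝ (φ i) y.1‖ₑ ^ 2 ∂(ν.prod volume) ≤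
        ENNReal.ofReal (8 * L ^ 2 * (K + 1) * H⁻¹ * a i) * (N + A) := by
      intro i
      set c : ℝ := ((2 : ℝ) ^ (K + i))⁻¹ with hc
      have hc0 : 0 < c := by positivity
      have hlog : Real.log (2 ^ (K + i)) ≤ (K + 1) * (i + 1) := by
        rw [Real.log_pow]
        have h2 : Real.log 2 ≤ 1 := by linarith [Real.log_two_lt_d9]
        push_cast
        have hKi : (0 : ℝ) ≤ K * i := by positivity
        calc ((K : ℝ) + i) * Real.log 2 ≤ (K + i) * 1 := by gcongr
          _ ≤ _ := by linarith
      have hone : (1 : ℝ) ≤ (K + 1) * (i + 1) := by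
        have hKi : (0 : ℝ) ≤ K * i := by positivity
        have : (0 : ℝ) ≤ K := by positivity
        have : (0 : ℝ) ≤ i := by positivity
        linarith
      have hax := lintegral_near_axis_le ν hd hD hDl hF (hb1 i)
      rw [← hN, ← hA, ← hc] at hax
      calc ∫⁻ y in D, ‖F y‖ₑ ^ 2 * ‖a i • fderiv ℝ (φ i) y.1‖ₑ ^ 2 ∂(ν.prod volume)
          ≤ ∫⁻ y in D, {y : X × ℝ | ‖y.1‖ ≤ c}.indicator
              (fun y => ENNReal.ofReal (a i * (2 * L / c)) ^ 2 * ‖F y‖ₑ ^ 2) y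
                ∂(ν.prod volume) := by
            refine setLIntegral_mono' hD fun y _ => ?_
            by_cases hy : fderiv ℝ (φ i) y.1 = 0
            · rw [hy, smul_zero, show ‖(0 : X →L[ℝ] ℝ)‖ₑ = 0 by
                rw [← ofReal_norm, norm_zero, ENNReal.ofReal_zero]]
              simp
            · rw [indicator_of_mem (s := {y : X × ℝ | ‖y.1‖ ≤ c}) (hsupp i _ hy).2, mul_comm]
              gcongr
              rw [← ofReal_norm, norm_smul, Real.norm_of_nonneg (ha0 i)]
              refine ENNReal.ofReal_le_ofReal (mul_le_mul_of_nonneg_left ?_ (ha0 i))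
              refine (hφd i y.1).trans (le_of_eq ?_)
              rw [← hc]; field_simp
        _ = ENNReal.ofReal (a i * (2 * L / c)) ^ 2 *
              ∫⁻ y in D ∩ {y | ‖y.1‖ ≤ c}, ‖F y‖ₑ ^ 2 ∂(ν.prod volume) := by
            rw [lintegral_indicator (hDm c), lintegral_const_mul' _ _ (by simp),
              Measure.restrict_restrict (hDm c), inter_comm]
        _ ≤ ENNReal.ofReal (a i * (2 * L / c)) ^ 2 * (2 * ENNReal.ofReal
              ((((2 : ℝ) ^ (K + i)) ^ 2)⁻¹) *
              (N + ENNReal.ofReal (Real.log (2 ^ (K + i))) * A)) := by gcongr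
        _ ≤ ENNReal.ofReal (a i * (2 * L / c)) ^ 2 * (2 * ENNReal.ofReal
              ((((2 : ℝ) ^ (K + i)) ^ 2)⁻¹) *
              (ENNReal.ofReal ((K + 1) * (i + 1)) * N +
                ENNReal.ofReal ((K + 1) * (i + 1)) * A)) := by
            gcongr
            exact le_mul_of_one_le_left bot_le (ENNReal.one_le_ofReal.2 hone)
        _ = ENNReal.ofReal (8 * L ^ 2 * (K + 1) * H⁻¹ * a i) * (N + A) := by
            rw [← mul_add, ← mul_assoc, ← mul_assoc]
            congr 1
            rw [← ENNReal.ofReal_pow (by positivity), ← ENNReal.ofReal_ofNat,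
              ← ENNReal.ofReal_mul (by positivity), ← ENNReal.ofReal_mul (by positivity),
              ← ENNReal.ofReal_mul (by positivity)]
            congr 1
            simp only [a, hc]
            field_simp
            ring
    calc ∫⁻ y in D, (‖F y‖ₑ * ‖fderiv ℝ η y.1‖ₑ) ^ 2 ∂(ν.prod volume)
        ≤ ∫⁻ y in D, ∑ i ∈ Finset.range M, ‖F y‖ₑ ^ 2 * ‖a i • fderiv ℝ (φ i) y.1‖ₑ ^ 2
            ∂(ν.prod volume) := by
          refine setLIntegral_mono' hD fun y _ => ?_
          rw [mul_pow, ← Finset.mul_sum, hfd, enorm_neg]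
          gcongr
          refine enorm_sum_sq_le_of_disjoint _ _ fun i _ j _ hi hj => ?_
          exact hdisj i j y.1 (fun h => hi (by rw [h, smul_zero]))
            (fun h => hj (by rw [h, smul_zero]))
      _ = ∑ i ∈ Finset.range M, ∫⁻ y in D, ‖F y‖ₑ ^ 2 * ‖a i • fderiv ℝ (φ i) y.1‖ₑ ^ 2
            ∂(ν.prod volume) := by
          refine lintegral_finsetSum _ fun i _ => ?_
          have h1 : Continuous (fderiv ℝ (φ i)) := (hφ i).continuous_fderiv (by simp)
          fun_prop
      _ ≤ ∑ i ∈ Finset.range M, ENNReal.ofReal (8 * L ^ 2 * (K + 1) * H⁻¹ * a i) * (N + A) :=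
          Finset.sum_le_sum fun i _ => hterm i
      _ = ENNReal.ofReal (8 * L ^ 2 * (K + 1) * H⁻¹) * (N + A) := by
          rw [← Finset.sum_mul, ← ENNReal.ofReal_sum_of_nonneg fun i _ =>
            mul_nonneg (by positivity) (ha0 i), ← Finset.mul_sum, hasum, mul_one]
      _ ≤ _ := by
          gcongr
          rw [← ENNReal.ofReal_coe_nnreal]
          refine ENNReal.ofReal_le_ofReal ?_
          rwa [← div_eq_mul_inv, div_le_iff₀ hH0]

end AxisCutoff

section Profile

theorem hasDerivAt_expNegInvGlue {t : ℝ} (ht : 0 < t) :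
    ∃ c, 0 < c ∧ HasDerivAt expNegInvGlue c t := by
  have h := expNegInvGlue.hasDerivAt_polynomial_eval_inv_mul 1 t
  simp only [Polynomial.eval_one, one_mul] at h
  refine ⟨_, ?_, h⟩
  have := expNegInvGlue.pos_of_pos ht
  simp only [Polynomial.derivative_one, sub_zero, mul_one, Polynomial.eval_pow,
    Polynomial.eval_X]
  positivity

theorem strictMonoOn_expNegInvGlue : StrictMonoOn expNegInvGlue (Ici 0) := by
  refine strictMonoOn_of_deriv_pos (convex_Ici 0)
    (expNegInvGlue.contDiff (n := 0)).continuous.continuousOn fun t ht => ?_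
  rw [interior_Ici] at ht
  obtain ⟨c, hc, h⟩ := hasDerivAt_expNegInvGlue ht
  rwa [h.deriv]

/-- A smooth function on the line, symmetric about `1/2`, positive exactly on `(0, 1)`, and with
maximum `1` attained exactly on `[1/3, 2/3]`. -/
structure IsTunnelProfile (w : ℝ → ℝ) : Prop where
  contDiff : ContDiff ℝ (⊤ : ℕ∞) w
  le_one : ∀ s, w s ≤ 1
  pos_iff : ∀ s, 0 < w s ↔ 0 < s ∧ s < 1
  eq_zero_iff : ∀ s, w s = 0 ↔ s = 0 ∨ s = 1
  eq_one_iff : ∀ s, w s = 1 ↔ 1 / 3 ≤ s ∧ s ≤ 2 / 3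
  strictMonoOn : StrictMonoOn w (Iic (1 / 3))
  symm : ∀ s, w (1 - s) = w s
  deriv_ne_zero : ∀ s, w s ≠ 1 → deriv w s ≠ 0

/-- A smooth nonnegative decreasing function, with value `2` at the origin and vanishing exactly
on `[4, ∞)`. -/
structure IsTunnelBump (h : ℝ → ℝ) : Prop where
  contDiff : ContDiff ℝ (⊤ : ℕ∞) h
  nonneg : ∀ r, 0 ≤ h r
  antitone : Antitone h
  strictAntiOn : StrictAntiOn h (Iic 4)
  eq_zero_iff : ∀ r, h r = 0 ↔ 4 ≤ r
  deriv_ne_zero : ∀ r < 4, deriv h r ≠ 0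
  map_zero : h 0 = 2

theorem exists_isTunnelBump : ∃ h, IsTunnelBump h := by
  have h4 : 0 < expNegInvGlue 4 := expNegInvGlue.pos_of_pos (by norm_num)
  refine ⟨fun r => 2 / expNegInvGlue 4 * expNegInvGlue (4 - r), ?_, fun r => ?_, ?_, ?_,
    fun r => ?_, fun r hr => ?_, ?_⟩
  · exact contDiff_const.mul (expNegInvGlue.contDiff.comp (contDiff_const.sub contDiff_id))
  · exact mul_nonneg (by positivity) (expNegInvGlue.nonneg _)
  · intro r r' hrr
    exact mul_le_mul_of_nonneg_left (expNegInvGlue.monotone (by linarith)) (by positivity)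
  · intro r hr r' hr' hrr
    refine mul_lt_mul_of_pos_left (strictMonoOn_expNegInvGlue ?_ ?_ ?_) (by positivity)
    · exact mem_Ici.2 (sub_nonneg.2 (mem_Iic.1 hr'))
    · exact mem_Ici.2 (sub_nonneg.2 (mem_Iic.1 hr))
    · linarith
  · rw [mul_eq_zero, or_iff_right (by positivity), expNegInvGlue.zero_iff_nonpos, sub_nonpos]
  · obtain ⟨c, hc, h⟩ := hasDerivAt_expNegInvGlue (sub_pos.2 hr)
    have h1 : HasDerivAt (fun r => 2 / expNegInvGlue 4 * expNegInvGlue (4 - r))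
        (2 / expNegInvGlue 4 * (c * (-1))) r :=
      (h.comp r ((hasDerivAt_id r).const_sub 4)).const_mul _
    rw [h1.deriv]
    exact mul_ne_zero (by positivity) (mul_ne_zero hc.ne' (by norm_num))
  · simp only [sub_zero]
    field_simp

theorem exists_isTunnelProfile : ∃ w, IsTunnelProfile w := by
  set e : ℝ → ℝ := expNegInvGlue with he
  have hk : 0 < e (1 / 3) := expNegInvGlue.pos_of_pos (by norm_num)
  set κ := (e (1 / 3))⁻¹ with hκ
  have hκ0 : 0 < κ := inv_pos.2 hk
  have hκ1 : κ * e (1 / 3) = 1 := inv_mul_cancel₀ hk.ne'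
  let w : ℝ → ℝ := fun s => 1 - κ * e (1 / 3 - s) - κ * e (s - 2 / 3)
  have hw : ∀ s, w s = 1 - κ * e (1 / 3 - s) - κ * e (s - 2 / 3) := fun s => rfl
  have hsymm : ∀ s, w (1 - s) = w s := by
    intro s
    rw [hw, hw, show (1 : ℝ) / 3 - (1 - s) = s - 2 / 3 by ring,
      show 1 - s - (2 : ℝ) / 3 = 1 / 3 - s by ring]
    ring
  have hleft : ∀ s ≤ 1 / 2, w s = 1 - κ * e (1 / 3 - s) := by
    intro s hs
    rw [hw, he, expNegInvGlue.zero_of_nonpos (x := s - 2 / 3) (by linarith)]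
    ring
  have hmono : StrictMonoOn w (Iic (1 / 3)) := by
    intro s hs t ht hst
    have hs' : s ≤ 1 / 3 := hs
    have ht' : t ≤ 1 / 3 := ht
    rw [hleft s (by linarith), hleft t (by linarith)]
    have := mul_lt_mul_of_pos_left (strictMonoOn_expNegInvGlue (a := 1 / 3 - t) (b := 1 / 3 - s)
      (mem_Ici.2 (by linarith)) (mem_Ici.2 (by linarith)) (by linarith)) hκ0
    linarith
  have hw0 : w 0 = 0 := by
    rw [hleft 0 (by norm_num), sub_zero, hκ1, sub_self]
  have hone : ∀ s, 1 / 3 ≤ s → s ≤ 1 / 2 → w s = 1 := by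
    intro s h1 h2
    rw [hleft s h2, he, expNegInvGlue.zero_of_nonpos (by linarith)]
    ring
  have hreduce : ∀ Q : ℝ → Prop, (∀ s ≤ 1 / 2, Q s) → (∀ s, Q (1 - s) → Q s) → ∀ s, Q s := by
    intro Q h1 h2 s
    rcases le_total s (1 / 2) with h | h
    · exact h1 s h
    · exact h2 s (h1 _ (by linarith))
  have hpos : ∀ s ≤ 1 / 2, (0 < w s ↔ 0 < s ∧ s < 1) ∧ (w s = 0 ↔ s = 0 ∨ s = 1) := by
    intro s hs
    rcases lt_trichotomy s 0 with h | h | h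
    · have : w s < 0 := hw0 ▸ hmono (show s ≤ 1 / 3 by linarith)
        (show (0 : ℝ) ≤ 1 / 3 by norm_num) h
      exact ⟨⟨fun h' => by linarith, fun h' => by linarith⟩,
        ⟨fun h' => by linarith, by rintro (h' | h') <;> linarith⟩⟩
    · subst h
      simp [hw0]
    · have : 0 < w s := by
        rcases le_total s (1 / 3) with h3 | h3
        · exact hw0 ▸ hmono (show (0 : ℝ) ≤ 1 / 3 by norm_num) (show s ≤ 1 / 3 from h3) h
        · rw [hone s h3 hs]; norm_num
      exact ⟨⟨fun h' => ⟨h, by linarith⟩, fun h' => this⟩,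
        ⟨fun h' => by linarith, by rintro (h' | h') <;> linarith⟩⟩
  have hcd : ContDiff ℝ (⊤ : ℕ∞) w :=
    (contDiff_const.sub (contDiff_const.mul (expNegInvGlue.contDiff.comp
      (contDiff_const.sub contDiff_id)))).sub (contDiff_const.mul (expNegInvGlue.contDiff.comp
      (contDiff_id.sub contDiff_const)))
  have hdiff : Differentiable ℝ w := hcd.differentiable (by simp)
  refine ⟨w, hcd, fun s => ?_, hreduce _ (fun s hs => (hpos s hs).1) fun s hs => ?_,
    hreduce _ (fun s hs => (hpos s hs).2) fun s hs => ?_, hreduce _ (fun s hs => ?_) fun s hs => ?_,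
    hmono, hsymm, hreduce _ (fun s hs h1 => ?_) fun s hs h1 => ?_⟩
  · have h1 := mul_nonneg hκ0.le (expNegInvGlue.nonneg (1 / 3 - s))
    have h2 := mul_nonneg hκ0.le (expNegInvGlue.nonneg (s - 2 / 3))
    rw [hw]; linarith
  · rw [← hsymm, hs]
    constructor <;> rintro ⟨h1, h2⟩ <;> constructor <;> linarith
  · rw [← hsymm, hs]
    constructor
    · rintro (h | h)
      · right; linarith
      · left; linarith
    · rintro (h | h)
      · right; linarith
      · left; linarith
  · refine ⟨fun h => ⟨?_, by linarith⟩, fun h => hone s h.1 hs⟩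
    by_contra! h3
    have := hmono (show s ≤ 1 / 3 from h3.le) (show (1 / 3 : ℝ) ≤ 1 / 3 from le_rfl) h3
    rw [hone (1 / 3) le_rfl (by norm_num)] at this
    linarith
  · rw [← hsymm, hs]
    constructor <;> rintro ⟨h1, h2⟩ <;> constructor <;> linarith
  · have h3 : s < 1 / 3 := by
      by_contra! h3
      exact h1 (hone s h3 hs)
    obtain ⟨c, hc, h⟩ := hasDerivAt_expNegInvGlue (sub_pos.2 h3)
    have h4 : HasDerivAt (fun s => 1 - κ * e (1 / 3 - s)) (-(κ * (c * (-1)))) s :=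
      ((h.comp s ((hasDerivAt_id s).const_sub (1 / 3))).const_mul κ).const_sub 1
    have h5 : w =ᶠ[𝓝 s] fun s => 1 - κ * e (1 / 3 - s) := by
      filter_upwards [Iio_mem_nhds (show s < 1 / 2 by linarith)] with t ht
      exact hleft t (le_of_lt ht)
    rw [h5.deriv_eq, h4.deriv]
    have := mul_pos hκ0 hc
    intro h6
    linarith
  · have h2 := hs (by rwa [hsymm])
    have h3 : HasDerivAt (fun t => w (1 - t)) (deriv w (1 - s) * (-1)) s :=
      (hdiff (1 - s)).hasDerivAt.comp s ((hasDerivAt_id s).const_sub 1)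
    have h4 : (fun t => w (1 - t)) = w := funext hsymm
    rw [h4] at h3
    rw [h3.deriv]
    exact mul_ne_zero h2 (by norm_num)

end Profile

section Model

variable {w h : ℝ → ℝ}

theorem IsTunnelProfile.le_of_abs_le (hw : IsTunnelProfile w) {s t : ℝ}
    (hst : |t - 1 / 2| ≤ |s - 1 / 2|) : w s ≤ w t := by
  have key : ∀ s t : ℝ, s ≤ t → t ≤ 1 / 2 → w s ≤ w t := by
    intro s t h1 h2
    rcases le_total t (1 / 3) with h3 | h3
    · exact hw.strictMonoOn.monotoneOn (show s ≤ 1 / 3 from h1.trans h3) (show t ≤ 1 / 3 from h3) h1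
    · rw [(hw.eq_one_iff t).2 ⟨h3, by linarith⟩]
      exact hw.le_one s
  rcases le_total s (1 / 2) with h1 | h1 <;> rcases le_total t (1 / 2) with h2 | h2
  · rw [abs_of_nonpos (by linarith), abs_of_nonpos (by linarith)] at hst
    exact key s t (by linarith) h2
  · rw [abs_of_nonneg (by linarith), abs_of_nonpos (by linarith)] at hst
    rw [← hw.symm t]
    exact key s _ (by linarith) (by linarith)
  · rw [abs_of_nonpos (by linarith), abs_of_nonneg (by linarith)] at hst
    rw [← hw.symm s]
    exact key _ t (by linarith) (by linarith)
  · rw [abs_of_nonneg (by linarith), abs_of_nonneg (by linarith)] at hst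
    rw [← hw.symm s, ← hw.symm t]
    exact key _ _ (by linarith) (by linarith)

theorem IsTunnelProfile.mem_Icc (hw : IsTunnelProfile w) {s : ℝ} (hs : 0 ≤ w s) :
    0 ≤ s ∧ s ≤ 1 := by
  rcases hs.lt_or_eq with h | h
  · have := (hw.pos_iff s).1 h
    exact ⟨this.1.le, this.2.le⟩
  · rcases (hw.eq_zero_iff s).1 h.symm with h | h <;> rw [h] <;> norm_num

theorem IsTunnelBump.eq_zero_of_eq (hh : IsTunnelBump h) {r r' : ℝ} (hr : r < r')
    (he : h r = h r') : h r = 0 := by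
  rcases le_or_gt 4 r with h4 | h4
  · exact (hh.eq_zero_iff r).2 h4
  · exfalso
    rcases le_total r' 4 with h5 | h5
    · exact (hh.strictAntiOn (show r ≤ 4 from h4.le) (show r' ≤ 4 from h5) hr).ne' he
    · rw [(hh.eq_zero_iff r').2 h5, hh.eq_zero_iff] at he
      linarith

theorem IsTunnelBump.eq_zero_of_norm (hh : IsTunnelBump h) {δ r : ℝ} (hδ : 0 < δ)
    (hr : 2 * δ ≤ r) : h (r ^ 2 / δ ^ 2) = 0 := by
  rw [hh.eq_zero_iff, le_div_iff₀ (by positivity)]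
  nlinarith

theorem IsTunnelBump.mono (hh : IsTunnelBump h) {δ r r' : ℝ} (hr : 0 ≤ r) (hrr : r ≤ r') :
    h (r' ^ 2 / δ ^ 2) ≤ h (r ^ 2 / δ ^ 2) :=
  hh.antitone (by gcongr)

/-- A compact set on which a continuous function is injective is preconnected as soon as its image
is. -/
theorem IsCompact.isPreconnected_of_injOn {α β : Type*} [TopologicalSpace α] [TopologicalSpace β]
    [T2Space β] {s : Set α} (hs : IsCompact s) {f : α → β} (hf : ContinuousOn f s)
    (hinj : InjOn f s) (hc : IsPreconnected (f '' s)) : IsPreconnected s := by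
  have : CompactSpace s := isCompact_iff_compactSpace.1 hs
  have hcont : Continuous (s.domRestrict f) := hf.domRestrict
  have h1 := hc.preimage_of_isClosedMap (injOn_iff_injective.1 hinj) hcont.isClosedMap
    (by rw [range_domRestrict])
  have h2 : s.domRestrict f ⁻¹' (f '' s) = univ := by
    ext x
    simp only [mem_preimage, mem_univ, iff_true]
    exact ⟨x, x.2, rfl⟩
  rw [h2] at h1
  have h3 := h1.image _ continuous_subtype_val.continuousOn
  rwa [image_univ, Subtype.range_coe] at h3

theorem isPreconnected_profile_region (hw : IsTunnelProfile w) (hh : IsTunnelBump h) {δ R : ℝ}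
    (hδ : 0 < δ) (hR : 2 * δ < R) :
    IsPreconnected {z : ℝ × ℝ | 0 ≤ z.1 ∧ z.1 < R ∧ h (z.1 ^ 2 / δ ^ 2) < w z.2} := by
  have hhalf : w (1 / 2) = 1 := (hw.eq_one_iff _).2 (by norm_num)
  refine isPreconnected_of_forall (2 * δ, 1 / 2) fun z ⟨h1, h2, h3⟩ => ?_
  refine ⟨({z.1} ×ˢ uIcc z.2 (1 / 2)) ∪ (uIcc z.1 (2 * δ) ×ˢ {1 / 2}), ?_, Or.inr
    ⟨right_mem_uIcc, rfl⟩, Or.inl ⟨rfl, left_mem_uIcc⟩, ?_⟩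
  · rintro ⟨r, s⟩ (⟨hr, hs⟩ | ⟨hr, hs⟩)
    · rw [mem_singleton_iff] at hr
      simp only at hr hs
      subst hr
      refine ⟨h1, h2, h3.trans_le (hw.le_of_abs_le ?_)⟩
      rw [mem_uIcc] at hs
      simp only
      rcases hs with hs | hs
      · rw [abs_of_nonpos (by linarith), abs_of_nonpos (by linarith)]; linarith
      · rw [abs_of_nonneg (by linarith), abs_of_nonneg (by linarith)]; linarith
    · rw [mem_singleton_iff] at hs
      simp only at hr hs
      subst hs
      rw [mem_uIcc] at hr
      have hr0 : 0 ≤ r := by rcases hr with hr | hr <;> linarith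
      refine ⟨hr0, by rcases hr with hr | hr <;> simp only <;> linarith, ?_⟩
      simp only [hhalf]
      rcases hr with hr | hr
      · exact (hh.mono h1 hr.1).trans_lt (h3.trans_le (hw.le_one _))
      · rw [hh.eq_zero_of_norm hδ hr.1]; norm_num
  · refine IsPreconnected.union (z.1, 1 / 2) ⟨rfl, right_mem_uIcc⟩ ⟨left_mem_uIcc, rfl⟩ ?_ ?_
    · exact isPreconnected_singleton.prod isPreconnected_uIcc
    · exact isPreconnected_uIcc.prod isPreconnected_singleton

theorem isPreconnected_profile_curve (hw : IsTunnelProfile w) (hh : IsTunnelBump h) {δ R : ℝ}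
    (hδ : 0 < δ) (hR : 2 * δ < R) :
    IsPreconnected {z : ℝ × ℝ | 0 ≤ z.1 ∧ z.1 < R ∧ w z.2 = h (z.1 ^ 2 / δ ^ 2)} := by
  have hwc := hw.contDiff.continuous
  have hhc := hh.contDiff.continuous
  set Γ : Set (ℝ × ℝ) := {z | w z.2 = h (z.1 ^ 2 / δ ^ 2)} ∩ Icc 0 (2 * δ) ×ˢ Icc 0 1 with hΓ
  have hΓc : IsCompact Γ := by
    refine (isCompact_Icc.prod isCompact_Icc).inter_left (isClosed_eq ?_ ?_)
    · exact hwc.comp continuous_snd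
    · exact hhc.comp (by fun_prop)
  have hle : ∀ r, r ≤ 2 * δ → 0 ≤ r → r ^ 2 / δ ^ 2 ≤ 4 := by
    intro r h1 h2
    rw [div_le_iff₀ (by positivity)]
    nlinarith
  have hΓp : IsPreconnected Γ := by
    refine hΓc.isPreconnected_of_injOn (f := Prod.snd) continuousOn_snd ?_ ?_
    · rintro ⟨r, s⟩ ⟨h1, h2, -⟩ ⟨r', s'⟩ ⟨h1', h2', -⟩ (hs : s = s')
      subst hs
      simp only [mem_ofPred_eq] at h1 h1' h2 h2'
      have h3 := hh.strictAntiOn.injOn (hle r h2.2 h2.1) (hle r' h2'.2 h2'.1) (h1.symm.trans h1')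
      rw [div_left_inj' (by positivity), sq_eq_sq₀ h2.1 h2'.1] at h3
      rw [h3]
    · have : Prod.snd '' Γ = Icc (0 : ℝ) 1 := by
        refine subset_antisymm ?_ fun s hs => ?_
        · rintro _ ⟨z, hz, rfl⟩
          exact hz.2.2
        · have hs0 : 0 ≤ w s := by
            rcases hs.1.eq_or_lt with h1 | h1
            · exact ((hw.eq_zero_iff s).2 (Or.inl h1.symm)).ge
            · rcases hs.2.eq_or_lt with h2 | h2
              · exact ((hw.eq_zero_iff s).2 (Or.inr h2)).ge
              · exact ((hw.pos_iff s).2 ⟨h1, h2⟩).le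
          have hmem : w s ∈ Icc (h ((2 * δ) ^ 2 / δ ^ 2)) (h (0 ^ 2 / δ ^ 2)) := by
            rw [hh.eq_zero_of_norm hδ le_rfl, zero_pow two_ne_zero, zero_div, hh.map_zero]
            exact ⟨hs0, (hw.le_one s).trans one_le_two⟩
          obtain ⟨r, hr, hrs⟩ := intermediate_value_Icc' (f := fun r => h (r ^ 2 / δ ^ 2))
            (by positivity : (0 : ℝ) ≤ 2 * δ) (hhc.comp (by fun_prop)).continuousOn hmem
          exact ⟨(r, s), ⟨hrs.symm, hr, hs⟩, rfl⟩
      rw [this]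
      exact isPreconnected_Icc
  have hend : ∀ s, w s = 0 → 0 ≤ s → s ≤ 1 → IsPreconnected (Γ ∪ Ico (2 * δ) R ×ˢ {s}) := by
    intro s hs h0 h1
    refine IsPreconnected.union (2 * δ, s) ⟨?_, ⟨by positivity, le_rfl⟩, h0, h1⟩
      ⟨⟨le_rfl, hR⟩, rfl⟩ hΓp (isPreconnected_Ico.prod isPreconnected_singleton)
    simp only [mem_ofPred_eq]
    rw [hs, hh.eq_zero_of_norm hδ le_rfl]
  have hw0 : w 0 = 0 := (hw.eq_zero_iff 0).2 (Or.inl rfl)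
  have hw1 : w 1 = 0 := (hw.eq_zero_iff 1).2 (Or.inr rfl)
  have hmem : ((2 * δ, 0) : ℝ × ℝ) ∈ Γ := by
    refine ⟨?_, ⟨by positivity, le_rfl⟩, le_rfl, zero_le_one⟩
    simp only [mem_ofPred_eq]
    rw [hw0, hh.eq_zero_of_norm hδ le_rfl]
  have hfin := IsPreconnected.union (2 * δ, 0) (Or.inl hmem) (Or.inl hmem)
    (hend 0 hw0 le_rfl zero_le_one) (hend 1 hw1 zero_le_one le_rfl)
  · convert hfin using 1
    ext ⟨r, s⟩
    simp only [mem_ofPred_eq, mem_union, hΓ, mem_inter_iff, mem_prod, mem_Icc, mem_Ico,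
      mem_singleton_iff]
    constructor
    · rintro ⟨h1, h2, h3⟩
      have hs := hw.mem_Icc (h3 ▸ hh.nonneg _)
      rcases le_or_gt r (2 * δ) with h4 | h4
      · exact Or.inl (Or.inl ⟨h3, ⟨h1, h4⟩, hs⟩)
      · rw [hh.eq_zero_of_norm hδ h4.le, hw.eq_zero_iff] at h3
        rcases h3 with h3 | h3
        · exact Or.inl (Or.inr ⟨⟨h4.le, h2⟩, h3⟩)
        · exact Or.inr (Or.inr ⟨⟨h4.le, h2⟩, h3⟩)
    · have hz : ∀ s, w s = 0 → 2 * δ ≤ r → w s = h (r ^ 2 / δ ^ 2) := fun s hs hr => by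
        rw [hs, hh.eq_zero_of_norm hδ hr]
      rintro ((⟨h1, h2, h3⟩ | ⟨h1, h2⟩) | (⟨h1, h2, h3⟩ | ⟨h1, h2⟩))
      · exact ⟨h2.1, by linarith, h1⟩
      · exact ⟨by linarith, h1.2, hz s (by rw [h2, hw0]) h1.1⟩
      · exact ⟨h2.1, by linarith, h1⟩
      · exact ⟨by linarith, h1.2, hz s (by rw [h2, hw1]) h1.1⟩

variable {X : Type*} [NormedAddCommGroup X] [InnerProductSpace ℝ X] [FiniteDimensional ℝ X]

/-- A subset of `X × ℝ` that is rotationally symmetric about the axis is preconnected as soon as its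
planar section is. -/
theorem isPreconnected_of_section (hd : 2 ≤ Module.finrank ℝ X) {Γ : Set (ℝ × ℝ)}
    (hΓ : IsPreconnected Γ) {p : ℝ → ℝ → Prop} (hp : Γ = {z | 0 ≤ z.1 ∧ p z.1 z.2}) :
    IsPreconnected {y : X × ℝ | p ‖y.1‖ y.2} := by
  have : Nontrivial X := Module.nontrivial_of_finrank_pos (R := ℝ) (by omega)
  have hrank : 1 < Module.rank ℝ X := by
    rw [← Module.finrank_eq_rank]
    exact_mod_cast hd
  have hs : IsPreconnected (sphere (0 : X) 1) := isPreconnected_sphere hrank 0 1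
  have hcont : Continuous fun z : X × ℝ × ℝ => (z.2.1 • z.1, z.2.2) := by fun_prop
  convert (hs.prod hΓ).image _ hcont.continuousOn using 1
  ext ⟨x, s⟩
  simp only [mem_ofPred_eq, mem_image, mem_prod, mem_sphere_zero_iff_norm, Prod.exists, hp,
    Prod.mk.injEq]
  constructor
  · intro hx
    rcases eq_or_ne x 0 with rfl | h0
    · obtain ⟨u, hu⟩ := NormedSpace.sphere_nonempty (x := (0 : X)) (r := 1) |>.2 zero_le_one
      exact ⟨u, 0, s, ⟨by simpa using hu, le_rfl, by simpa using hx⟩, by simp, rfl⟩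
    · refine ⟨‖x‖⁻¹ • x, ‖x‖, s, ⟨?_, norm_nonneg _, hx⟩, ?_, rfl⟩
      · rw [norm_smul, norm_inv, norm_norm, inv_mul_cancel₀ (norm_ne_zero_iff.2 h0)]
      · rw [smul_smul, mul_inv_cancel₀ (norm_ne_zero_iff.2 h0), one_smul]
  · rintro ⟨u, r, s', ⟨hu, hr, hp'⟩, rfl, rfl⟩
    rwa [norm_smul, hu, mul_one, Real.norm_of_nonneg hr]

theorem isPreconnected_tunnel_region (hd : 2 ≤ Module.finrank ℝ X) (hw : IsTunnelProfile w)
    (hh : IsTunnelBump h) {δ R : ℝ} (hδ : 0 < δ) (hR : 2 * δ < R) :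
    IsPreconnected {y : X × ℝ | ‖y.1‖ < R ∧ h (‖y.1‖ ^ 2 / δ ^ 2) < w y.2} :=
  isPreconnected_of_section hd (isPreconnected_profile_region hw hh hδ hR)
    (p := fun r s => r < R ∧ h (r ^ 2 / δ ^ 2) < w s) rfl

theorem isPreconnected_tunnel_surface (hd : 2 ≤ Module.finrank ℝ X) (hw : IsTunnelProfile w)
    (hh : IsTunnelBump h) {δ R : ℝ} (hδ : 0 < δ) (hR : 2 * δ < R) :
    IsPreconnected {y : X × ℝ | ‖y.1‖ < R ∧ w y.2 = h (‖y.1‖ ^ 2 / δ ^ 2)} :=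
  isPreconnected_of_section hd (isPreconnected_profile_curve hw hh hδ hR)
    (p := fun r s => r < R ∧ w s = h (r ^ 2 / δ ^ 2)) rfl

end Model

section TunnelTrace

variable {w h : ℝ → ℝ} {X : Type*} [NormedAddCommGroup X] [InnerProductSpace ℝ X]
  [FiniteDimensional ℝ X]

theorem exists_finset_cone_cover [Nontrivial X] :
    ∃ t : Finset X, (∀ v ∈ t, ‖v‖ = 1) ∧ ∀ x : X, ∃ v ∈ t, ‖x‖ / 2 ≤ inner ℝ x v := by
  obtain ⟨t, hts, htf, hcov⟩ :=
    (isCompact_sphere (0 : X) 1).finite_cover_balls (e := 1 / 2) (by norm_num)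
  have hts' : ∀ v ∈ t, ‖v‖ = 1 := fun v hv => by simpa using hts hv
  have key : ∀ u ∈ sphere (0 : X) 1, ∃ v ∈ t, 1 / 2 ≤ inner ℝ u v := by
    intro u hu
    obtain ⟨v, hv, huv⟩ := mem_iUnion₂.1 (hcov hu)
    refine ⟨v, hv, ?_⟩
    have h1 : ‖u‖ = 1 := by simpa using hu
    have h2 := norm_sub_sq_real u v
    rw [h1, hts' v hv] at h2
    rw [mem_ball, dist_eq_norm] at huv
    nlinarith [norm_nonneg (u - v)]
  refine ⟨htf.toFinset, fun v hv => hts' v (by simpa using hv), fun x => ?_⟩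
  rcases eq_or_ne x 0 with rfl | hx
  · obtain ⟨u, hu⟩ := NormedSpace.sphere_nonempty (x := (0 : X)) (r := 1) |>.2 zero_le_one
    obtain ⟨v, hv, -⟩ := key u hu
    exact ⟨v, by simpa using hv, by simp⟩
  · have hx' := norm_pos_iff.2 hx
    obtain ⟨v, hv, hv2⟩ := key (‖x‖⁻¹ • x) (by
      rw [mem_sphere_zero_iff_norm, norm_smul, norm_inv, norm_norm, inv_mul_cancel₀ hx'.ne'])
    refine ⟨v, by simpa using hv, ?_⟩
    rw [real_inner_smul_left, inv_mul_eq_div, le_div_iff₀ hx'] at hv2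
    linarith

theorem norm_lt_of_cone {Y : Type*} [NormedAddCommGroup Y] [InnerProductSpace ℝ Y] {x₁ x₂ v : Y}
    {τ : ℝ} (hv : ‖v‖ = 1) (hx : ‖x₁‖ / 2 ≤ inner ℝ x₁ v) (hτ : 0 < τ)
    (h : ‖x₂ - x₁ - τ • v‖ ≤ 1 / 4 * τ) : ‖x₁‖ < ‖x₂‖ := by
  set e := x₂ - x₁ - τ • v with he
  have h2 : x₂ = x₁ + (τ • v + e) := by rw [he]; abel
  have h3 : ‖x₂‖ ^ 2 = ‖x₁‖ ^ 2 + 2 * inner ℝ x₁ (τ • v + e) + ‖τ • v + e‖ ^ 2 := by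
    rw [h2]; exact norm_add_sq_real _ _
  have h4 : inner ℝ x₁ (τ • v + e) = τ * inner ℝ x₁ v + inner ℝ x₁ e := by
    rw [inner_add_right, real_inner_smul_right]
  have h5 := neg_le_of_abs_le (abs_real_inner_le_norm x₁ e)
  have h6 : 3 / 4 * τ ≤ ‖τ • v + e‖ := by
    have h7 := norm_sub_norm_le (τ • v) (-e)
    rw [norm_smul, hv, norm_neg, Real.norm_of_nonneg hτ.le, sub_neg_eq_add] at h7
    linarith
  have h8 : 0 < ‖τ • v + e‖ ^ 2 := pow_pos (by linarith) 2
  have h9 : ‖x₁‖ * ‖e‖ ≤ ‖x₁‖ * (1 / 4 * τ) := by gcongr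
  have h10 : τ * (‖x₁‖ / 2) ≤ τ * inner ℝ x₁ v := by gcongr
  have h11 : 0 ≤ ‖x₁‖ * τ := by positivity
  refine lt_of_pow_lt_pow_left₀ 2 (norm_nonneg _) ?_
  rw [h3, h4]
  linarith

/-- The trace inequality for the boundary of the tunnel. -/
theorem exists_tunnel_trace_le [MeasurableSpace X] [BorelSpace X]
    (ν : Measure X) [ν.IsAddHaarMeasure] (hd2 : 2 ≤ Module.finrank ℝ X)
    (Y : Type*) [EMetricSpace Y] [MeasurableSpace Y]
    [BorelSpace Y] {d : ℝ} (hd : (Module.finrank ℝ X : ℝ) = d)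
    (hw : IsTunnelProfile w) (hh : IsTunnelBump h) (L : ℝ≥0) :
    ∃ C : ℝ≥0, ∀ (Θ : X × ℝ → Y) (ρ : ℝ≥0), 0 < ρ → ρ ≤ 1 / 6 → ∀ δ : ℝ, 0 < δ →
      LipschitzOnWith L Θ {y | ‖y.1‖ ≤ ρ ∧ w y.2 = h (‖y.1‖ ^ 2 / δ ^ 2)} →
      ∀ f : Y → ℝ, Measurable f → ∀ F : X × ℝ → ℝ, ContDiff ℝ 1 F → (∀ y, f (Θ y) = F y) →
        ∫⁻ y in Θ '' {y | ‖y.1‖ ≤ ρ ∧ w y.2 = h (‖y.1‖ ^ 2 / δ ^ 2)}, ‖f y‖ₑ ^ 2 ∂μH[d] ≤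
          C * ((ρ : ℝ≥0∞)⁻¹ *
            (∫⁻ y in {y | h (‖y.1‖ ^ 2 / δ ^ 2) < w y.2} ∩ {y | ‖y.1‖ ≤ 2 * ρ},
              ‖F y‖ₑ ^ 2 ∂(ν.prod volume)) +
            ρ * ∫⁻ y in {y | h (‖y.1‖ ^ 2 / δ ^ 2) < w y.2} ∩ {y | ‖y.1‖ ≤ 2 * ρ},
              ‖fderiv ℝ F y‖ₑ ^ 2 ∂(ν.prod volume)) := by
  have : Nontrivial X := Module.nontrivial_of_finrank_pos (R := ℝ) (by omega)
  obtain ⟨t, ht1, htc⟩ := exists_finset_cone_cover (X := X)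
  let sgn : Bool → ℝ := fun b => if b then 1 else -1
  have hsgn : ∀ b, sgn b = 1 ∨ sgn b = -1 := by
    intro b
    cases b
    · exact Or.inr (by simp [sgn])
    · exact Or.inl (by simp [sgn])
  choose C hC using fun i : t × Bool =>
    exists_trace_le ν Y hd (i.1 : X) (hsgn i.2) (c := 1 / 4) (by norm_num) L
  have hwc := hw.contDiff.continuous
  have hhc := hh.contDiff.continuous
  refine ⟨∑ i, C i, fun Θ ρ hρ hρ6 δ hδ hΘ f hf F hF hfF => ?_⟩
  have hρ0 : (0 : ℝ) < ρ := hρ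
  have hρ6' : (ρ : ℝ) ≤ 1 / 6 := by exact_mod_cast hρ6
  set S : Set (X × ℝ) := {y | ‖y.1‖ ≤ ρ ∧ w y.2 = h (‖y.1‖ ^ 2 / δ ^ 2)} with hS
  set Q : Set (X × ℝ) := {y | h (‖y.1‖ ^ 2 / δ ^ 2) < w y.2} ∩ {y | ‖y.1‖ ≤ 2 * ρ} with hQ
  have hhc' : Continuous fun y : X × ℝ => h (‖y.1‖ ^ 2 / δ ^ 2) := hhc.comp (by fun_prop)
  have hwc' : Continuous fun y : X × ℝ => w y.2 := hwc.comp continuous_snd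
  have hQm : MeasurableSet Q := ((isOpen_lt hhc' hwc').measurableSet).inter
    (isClosed_le (by fun_prop) continuous_const).measurableSet
  have hSc : IsCompact S := by
    have hcl : IsClosed S :=
      (isClosed_le (f := fun y : X × ℝ => ‖y.1‖) (by fun_prop) continuous_const).inter
        (isClosed_eq hwc' hhc')
    refine ((isCompact_closedBall (0 : X) ρ).prod
      (isCompact_Icc (a := (0 : ℝ)) (b := 1))).of_isClosed_subset hcl ?_
    rintro y ⟨h1, h2⟩
    exact ⟨by simpa using h1, hw.mem_Icc (h2 ▸ hh.nonneg _)⟩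
  let P : t × Bool → Set (X × ℝ) := fun i =>
    {y | ‖y.1‖ / 2 ≤ inner ℝ y.1 (i.1 : X)} ∩ {y | 0 ≤ sgn i.2 * (1 / 2 - y.2)}
  have hPcl : ∀ i, IsClosed (P i) := fun i =>
    (isClosed_le (by fun_prop) (by fun_prop)).inter (isClosed_le (by fun_prop) (by fun_prop))
  have hcover : Θ '' S = ⋃ i, Θ '' (S ∩ P i) := by
    rw [← image_iUnion, ← inter_iUnion]
    congr 1
    refine (inter_eq_left.2 fun y _ => ?_).symm
    obtain ⟨v, hv, hyv⟩ := htc y.1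
    rcases le_total y.2 (1 / 2) with h1 | h1
    · exact mem_iUnion.2 ⟨(⟨v, hv⟩, true), hyv, by simp [sgn]; linarith⟩
    · exact mem_iUnion.2 ⟨(⟨v, hv⟩, false), hyv, by simp [sgn]; linarith⟩
  have hclose : ∀ (i : t × Bool) (s s' τ : ℝ), 0 < τ → s' - s = sgn i.2 * τ →
      0 ≤ sgn i.2 * (1 / 2 - s) → 0 ≤ sgn i.2 * (1 / 2 - s') → |s' - 1 / 2| < |s - 1 / 2| := by
    intro i s s' τ hτ h1 h2 h3
    rcases hsgn i.2 with h4 | h4 <;> rw [h4] at h1 h2 h3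
    · rw [abs_of_nonpos (by linarith), abs_of_nonpos (by linarith)]; linarith
    · rw [abs_of_nonneg (by linarith), abs_of_nonneg (by linarith)]; linarith
  -- a point on the tunnel boundary cannot be moved to another one along the cone
  have hkey : ∀ (i : t × Bool) (y₁ : X × ℝ) (x₂ : X) (s₂ τ : ℝ), y₁ ∈ S ∩ P i → 0 < τ →
      s₂ - y₁.2 = sgn i.2 * τ → (0 ≤ sgn i.2 * (1 / 2 - s₂) ∨ w s₂ = 1) → ‖y₁.1‖ < ‖x₂‖ →
      h (‖x₂‖ ^ 2 / δ ^ 2) < w s₂ := by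
    rintro i ⟨x₁, s₁⟩ x₂ s₂ τ ⟨⟨-, h1⟩, ⟨-, h2⟩⟩ hτ h3 h4 h5
    simp only [mem_ofPred_eq] at h1 h2 h3 h4 h5
    have h6 : h (‖x₂‖ ^ 2 / δ ^ 2) ≤ h (‖x₁‖ ^ 2 / δ ^ 2) := hh.mono (norm_nonneg _) h5.le
    have h7 : w s₁ ≤ w s₂ := by
      rcases h4 with h4 | h4
      · exact hw.le_of_abs_le (hclose i _ _ τ hτ h3 h2 h4).le
      · rw [h4]; exact hw.le_one _
    refine lt_of_le_of_ne (h6.trans (h1 ▸ h7)) fun h8 => ?_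
    have h9 : h (‖x₁‖ ^ 2 / δ ^ 2) = h (‖x₂‖ ^ 2 / δ ^ 2) :=
      le_antisymm (by rw [h8, ← h1]; exact h7) h6
    have h10 := hh.eq_zero_of_eq (by gcongr) h9
    have h11 : w s₁ = 0 := h1.trans h10
    have h12 : w s₂ = 0 := by rw [← h8, ← h9, h10]
    rw [h12] at h4
    have h4' := h4.resolve_right (by norm_num)
    have h13 := hclose i _ _ τ hτ h3 h2 h4'
    rcases (hw.eq_zero_iff _).1 h11 with e1 | e1 <;> rcases (hw.eq_zero_iff _).1 h12 with e2 | e2 <;>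
      rw [e1, e2] at h13 <;> norm_num [abs_of_pos, abs_of_neg] at h13
  rw [hcover]
  refine (lintegral_iUnion_le _ _).trans ?_
  rw [tsum_fintype, ENNReal.ofNNReal_finsetSum, Finset.sum_mul]
  refine Finset.sum_le_sum fun i _ => ?_
  have hv := ht1 _ i.1.2
  refine hC i Θ (S ∩ P i) (hSc.inter_right (hPcl i)) (hΘ.mono inter_subset_left) ?_ Q hQm ρ hρ ?_ f
    hf F hF fun y _ => hfF y
  · intro y₁ h1 y₂ h2 τ hτ h3 h4
    by_contra hne
    have hτ' : 0 < τ := lt_of_le_of_ne hτ (Ne.symm hne)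
    have h5 := hkey i y₁ y₂.1 y₂.2 τ h1 hτ' h3 (Or.inl h2.2.2) (norm_lt_of_cone hv h1.2.1 hτ' h4)
    exact h5.ne' h2.1.2
  · intro y hy τ hτ
    have h1 : ‖y.1‖ < ‖y.1 + τ • (i.1 : X)‖ :=
      norm_lt_of_cone hv hy.2.1 hτ.1 (by simp; linarith [hτ.1])
    have h2 := hw.mem_Icc (hy.1.2 ▸ hh.nonneg _)
    have h3 : 0 ≤ sgn i.2 * (1 / 2 - (y.2 + τ * sgn i.2)) ∨ w (y.2 + τ * sgn i.2) = 1 := by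
      have h4 := hy.2.2
      rw [mem_ofPred_eq] at h4
      have h5 := hτ.2
      have h6 := hτ.1
      rw [hw.eq_one_iff]
      by_contra! h7
      rcases hsgn i.2 with h8 | h8 <;> rw [h8] at h4 h7
      · have := h7.2 (by linarith)
        linarith
      · have := h7.2 (by linarith)
        linarith
    refine ⟨?_, ?_⟩
    · simp only [Prod.smul_mk, Prod.fst_add, Prod.snd_add, smul_eq_mul, mem_ofPred_eq]
      exact hkey i y _ _ τ hy hτ.1 (by ring) h3 h1
    · simp only [Prod.smul_mk, Prod.fst_add, mem_ofPred_eq]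
      refine (norm_add_le _ _).trans ?_
      rw [norm_smul, hv, Real.norm_of_nonneg hτ.1.le]
      linarith [hy.1.1, hτ.2]

end TunnelTrace

section Surgery

theorem mem_frontier_iff_of_eqOn {α : Type*} [TopologicalSpace α] {A B U : Set α} (hU : IsOpen U)
    (hAB : ∀ x ∈ U, x ∈ A ↔ x ∈ B) {x : α} (hx : x ∈ U) : x ∈ frontier A ↔ x ∈ frontier B := by
  have h : A ∩ U = B ∩ U := by
    ext y
    exact ⟨fun hy => ⟨(hAB y hy.2).1 hy.1, hy.2⟩, fun hy => ⟨(hAB y hy.2).2 hy.1, hy.2⟩⟩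
  have h1 := frontier_inter_open_inter (s := A) hU
  have h2 := frontier_inter_open_inter (s := B) hU
  rw [h] at h1
  have h3 : x ∈ frontier A ∩ U ↔ x ∈ frontier B ∩ U := by rw [← h1, ← h2]
  simpa [hx] using h3

theorem frontier_pos_eq {V : Type*} [NormedAddCommGroup V] [NormedSpace ℝ V] {G : V → ℝ}
    (hG : Continuous G) (hd : ∀ y, G y = 0 → fderiv ℝ G y ≠ 0) :
    frontier {y | 0 < G y} = {y | G y = 0} := by
  refine subset_antisymm ?_ fun y hy => ?_
  · refine (frontier_lt_subset_eq continuous_const hG).trans fun y hy => ?_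
    exact Eq.symm hy
  · rw [(isOpen_lt continuous_const hG).frontier_eq]
    refine ⟨?_, fun h => (ne_of_gt h) hy⟩
    by_contra hcl
    refine hd y hy (IsLocalMax.fderiv_eq_zero ?_)
    filter_upwards [isClosed_closure.isOpen_compl.mem_nhds hcl] with z hz
    rw [show G y = 0 from hy]
    exact not_lt.1 fun h => hz (subset_closure h)

variable {X : Type*} [NormedAddCommGroup X] {w h : ℝ → ℝ} {δ a : ℝ}

/-- The coordinate domain of a tube chart. -/
def tubeDomain (X : Type*) [NormedAddCommGroup X] (a : ℝ) : Set (X × ℝ) :=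
  {y | ‖y.1‖ < 2 ∧ -a < y.2 ∧ y.2 < 1 + a}

/-- The tunnel that is removed, in straightened coordinates. -/
def tunnelSet (X : Type*) [NormedAddCommGroup X] (w h : ℝ → ℝ) (δ : ℝ) : Set (X × ℝ) :=
  {y | ‖y.1‖ ≤ 2 * δ ∧ (0 ≤ y.2 ∧ y.2 ≤ 1) ∧ w y.2 ≤ h (‖y.1‖ ^ 2 / δ ^ 2)}

/-- The defining function of the tunnel boundary. -/
noncomputable def tunnelFun (X : Type*) [NormedAddCommGroup X] (w h : ℝ → ℝ) (δ : ℝ)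
    (y : X × ℝ) : ℝ :=
  w y.2 - h (‖y.1‖ ^ 2 / δ ^ 2)

theorem isOpen_tubeDomain (a : ℝ) : IsOpen (tubeDomain X a) :=
  (isOpen_lt (f := fun y : X × ℝ => ‖y.1‖) (by fun_prop) continuous_const).inter
    ((isOpen_lt (g := fun y : X × ℝ => y.2) continuous_const (by fun_prop)).inter
      (isOpen_lt (f := fun y : X × ℝ => y.2) (by fun_prop) continuous_const))

theorem IsTunnelProfile.isClosed_tunnelSet (hw : IsTunnelProfile w) (hh : IsTunnelBump h) (δ : ℝ) :
    IsClosed (tunnelSet X w h δ) := by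
  have h1 : Continuous fun y : X × ℝ => h (‖y.1‖ ^ 2 / δ ^ 2) :=
    hh.contDiff.continuous.comp (by fun_prop)
  have h2 : Continuous fun y : X × ℝ => w y.2 := hw.contDiff.continuous.comp continuous_snd
  exact (isClosed_le (f := fun y : X × ℝ => ‖y.1‖) (by fun_prop) continuous_const).inter
    (((isClosed_le (g := fun y : X × ℝ => y.2) continuous_const (by fun_prop)).inter
      (isClosed_le (f := fun y : X × ℝ => y.2) (by fun_prop) continuous_const)).inter
      (isClosed_le h2 h1))

theorem tunnelSet_subset (ha : 0 < a) (hδ1 : δ < 1) : tunnelSet X w h δ ⊆ tubeDomain X a :=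
  fun y hy => ⟨by linarith [hy.1], by linarith [hy.2.1.1], by linarith [hy.2.1.2]⟩

variable [InnerProductSpace ℝ X]

/-- A straightening of a tube around a segment joining two boundary points of `Ω` through `Ω`. -/
structure IsTubeChart {E : Type*} [NormedAddCommGroup E] [NormedSpace ℝ E] (Ω : Set E)
    (Θ : X × ℝ → E) (Φ : E → X × ℝ) (a : ℝ) : Prop where
  contDiff : ContDiff ℝ (⊤ : ℕ∞) Θ
  contDiff_inv : ContDiff ℝ (⊤ : ℕ∞) Φ
  left_inv : ∀ y, Φ (Θ y) = y
  right_inv : ∀ x, Θ (Φ x) = x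
  pos : 0 < a
  mem_iff : ∀ y : X × ℝ, ‖y.1‖ < 2 → -a < y.2 → y.2 < 1 + a → (Θ y ∈ Ω ↔ 0 < y.2 ∧ y.2 < 1)
  mem_frontier_iff : ∀ y : X × ℝ, ‖y.1‖ < 2 → -a < y.2 → y.2 < 1 + a →
    (Θ y ∈ frontier Ω ↔ y.2 = 0 ∨ y.2 = 1)

theorem IsTunnelProfile.tunnelFun_contDiff (hw : IsTunnelProfile w) (hh : IsTunnelBump h) (δ : ℝ) :
    ContDiff ℝ (⊤ : ℕ∞) (tunnelFun X w h δ) := by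
  refine (hw.contDiff.comp contDiff_snd).sub (hh.contDiff.comp ?_)
  exact ((contDiff_norm_sq ℝ).comp contDiff_fst).div_const _

theorem IsTunnelProfile.fderiv_tunnelFun_ne_zero (hw : IsTunnelProfile w) (hh : IsTunnelBump h)
    (hδ : 0 < δ) {y : X × ℝ} (hy : tunnelFun X w h δ y = 0) :
    fderiv ℝ (tunnelFun X w h δ) y ≠ 0 := by
  intro h0
  have hd : HasFDerivAt (tunnelFun X w h δ) (0 : X × ℝ →L[ℝ] ℝ) y := by
    rw [← h0]
    exact ((hw.tunnelFun_contDiff hh δ).differentiable (by simp) y).hasFDerivAt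
  have hline : ∀ v : X × ℝ, HasDerivAt (fun t : ℝ => tunnelFun X w h δ (y + t • v)) 0 0 := by
    intro v
    have h1 : HasDerivAt (fun t : ℝ => y + t • v) v 0 := by
      simpa using ((hasDerivAt_id (0 : ℝ)).smul_const v).const_add y
    have h2 : HasFDerivAt (tunnelFun X w h δ) (0 : X × ℝ →L[ℝ] ℝ) (y + (0 : ℝ) • v) := by
      simpa using hd
    have h3 := h2.comp_hasDerivAt (0 : ℝ) h1
    rwa [zero_apply] at h3
  rw [tunnelFun, sub_eq_zero] at hy
  by_cases h1 : w y.2 = 1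
  · -- on the lateral part, use the radial direction
    have hx : ‖y.1‖ ≠ 0 := by
      intro h2
      rw [h1, h2, zero_pow two_ne_zero, zero_div, hh.map_zero] at hy
      norm_num at hy
    have hr : ‖y.1‖ ^ 2 / δ ^ 2 < 4 := by
      by_contra! h2
      rw [(hh.eq_zero_iff _).2 h2, h1] at hy
      norm_num at hy
    have h2 := hline (y.1, 0)
    have h3 : (fun t : ℝ => tunnelFun X w h δ (y + t • (y.1, (0 : ℝ)))) =
        fun t => w y.2 - h ((1 + t) ^ 2 * (‖y.1‖ ^ 2 / δ ^ 2)) := by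
      funext t
      have : y.1 + t • y.1 = (1 + t) • y.1 := by rw [add_smul, one_smul]
      simp only [tunnelFun, Prod.smul_mk, smul_zero, Prod.fst_add, Prod.snd_add, add_zero, this,
        norm_smul, mul_pow, Real.norm_eq_abs, sq_abs, mul_div_assoc]
    rw [h3] at h2
    have h4 : HasDerivAt (fun t : ℝ => (1 + t) ^ 2 * (‖y.1‖ ^ 2 / δ ^ 2))
        (2 * (‖y.1‖ ^ 2 / δ ^ 2)) 0 := by
      have := (((hasDerivAt_id (0 : ℝ)).const_add 1).pow 2).mul_const (‖y.1‖ ^ 2 / δ ^ 2)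
      simpa using this
    have h5 : HasDerivAt h (deriv h (‖y.1‖ ^ 2 / δ ^ 2))
        ((1 + (0 : ℝ)) ^ 2 * (‖y.1‖ ^ 2 / δ ^ 2)) := by
      rw [add_zero, one_pow, one_mul]
      exact (hh.contDiff.differentiable (by simp) _).hasDerivAt
    have h6 := (h5.comp (0 : ℝ) h4).const_sub (w y.2)
    have h7 := h6.unique h2
    have h8 := hh.deriv_ne_zero _ hr
    have h9 : 0 < ‖y.1‖ ^ 2 / δ ^ 2 := by positivity
    rw [neg_eq_zero, mul_eq_zero] at h7
    rcases h7 with h7 | h7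
    · exact h8 h7
    · linarith
  · have h2 := hline (0, 1)
    have h3 : (fun t : ℝ => tunnelFun X w h δ (y + t • ((0 : X), (1 : ℝ)))) =
        fun t => w (y.2 + t) - h (‖y.1‖ ^ 2 / δ ^ 2) := by
      funext t
      simp [tunnelFun]
    rw [h3] at h2
    have h4 : HasDerivAt w (deriv w y.2) (y.2 + 0) := by
      rw [add_zero]
      exact (hw.contDiff.differentiable (by simp) _).hasDerivAt
    have h5 := (h4.comp (0 : ℝ) ((hasDerivAt_id (0 : ℝ)).const_add y.2)).sub_const
      (h (‖y.1‖ ^ 2 / δ ^ 2))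
    have h6 := h5.unique h2
    rw [mul_one] at h6
    exact hw.deriv_ne_zero _ h1 h6

section Topological

variable {E : Type*} [NormedAddCommGroup E] [NormedSpace ℝ E] {Ω : Set E} {Θ : X × ℝ → E}
  {Φ : E → X × ℝ}

/-- The homeomorphism underlying a tube chart. -/
def IsTubeChart.homeomorph (hc : IsTubeChart Ω Θ Φ a) : X × ℝ ≃ₜ E where
  toFun := Θ
  invFun := Φ
  left_inv := hc.left_inv
  right_inv := hc.right_inv
  continuous_toFun := hc.contDiff.continuous
  continuous_invFun := hc.contDiff_inv.continuous

theorem IsTubeChart.image_eq (hc : IsTubeChart Ω Θ Φ a) (s : Set (X × ℝ)) : Θ '' s = Φ ⁻¹' s :=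
  congrFun (image_eq_preimage_of_inverse hc.left_inv hc.right_inv) s

theorem IsTubeChart.mem_frontier_comp_iff (hc : IsTubeChart Ω Θ Φ a) (A : Set E) (y : X × ℝ) :
    Θ y ∈ frontier A ↔ y ∈ frontier (Θ ⁻¹' A) := by
  rw [← show Θ ⁻¹' frontier A = frontier (Θ ⁻¹' A) from hc.homeomorph.preimage_frontier A]
  rfl

theorem IsTubeChart.isOpen_sdiff (hc : IsTubeChart Ω Θ Φ a) (hw : IsTunnelProfile w)
    (hh : IsTunnelBump h) (hΩ : IsOpen Ω) : IsOpen (Ω \ Φ ⁻¹' tunnelSet X w h δ) :=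
  hΩ.sdiff ((hw.isClosed_tunnelSet hh δ).preimage hc.contDiff_inv.continuous)

theorem IsTubeChart.mem_sdiff_iff (hc : IsTubeChart Ω Θ Φ a) (hw : IsTunnelProfile w)
    (hh : IsTunnelBump h) (hδ : 0 < δ) {y : X × ℝ} (hy : y ∈ tubeDomain X a) :
    Θ y ∈ Ω \ Φ ⁻¹' tunnelSet X w h δ ↔ 0 < tunnelFun X w h δ y := by
  rw [Set.mem_sdiff, hc.mem_iff y hy.1 hy.2.1 hy.2.2, mem_preimage, hc.left_inv, tunnelFun, sub_pos]
  constructor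
  · rintro ⟨⟨h1, h2⟩, h3⟩
    by_contra! h4
    rcases le_or_gt ‖y.1‖ (2 * δ) with h5 | h5
    · exact h3 ⟨h5, ⟨h1.le, h2.le⟩, h4⟩
    · rw [hh.eq_zero_of_norm hδ h5.le] at h4
      exact h4.not_gt ((hw.pos_iff _).2 ⟨h1, h2⟩)
  · intro h1
    exact ⟨(hw.pos_iff _).1 ((hh.nonneg _).trans_lt h1), fun h2 => h2.2.2.not_gt h1⟩

theorem IsTubeChart.mem_frontier_sdiff_iff (hc : IsTubeChart Ω Θ Φ a) (hw : IsTunnelProfile w)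
    (hh : IsTunnelBump h) (hδ : 0 < δ) {y : X × ℝ} (hy : y ∈ tubeDomain X a) :
    Θ y ∈ frontier (Ω \ Φ ⁻¹' tunnelSet X w h δ) ↔ tunnelFun X w h δ y = 0 := by
  rw [hc.mem_frontier_comp_iff, mem_frontier_iff_of_eqOn
    (A := Θ ⁻¹' (Ω \ Φ ⁻¹' tunnelSet X w h δ)) (B := {y | 0 < tunnelFun X w h δ y})
    (isOpen_tubeDomain a) (fun z hz => hc.mem_sdiff_iff hw hh hδ hz) hy,
    frontier_pos_eq (hw.tunnelFun_contDiff hh δ).continuous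
      fun z hz => hw.fderiv_tunnelFun_ne_zero hh hδ hz]
  rfl

theorem IsTubeChart.mem_frontier_sdiff_iff_of_notMem (hc : IsTubeChart Ω Θ Φ a)
    (hw : IsTunnelProfile w) (hh : IsTunnelBump h) {x : E} (hx : Φ x ∉ tunnelSet X w h δ) :
    x ∈ frontier (Ω \ Φ ⁻¹' tunnelSet X w h δ) ↔ x ∈ frontier Ω :=
  mem_frontier_iff_of_eqOn (U := (Φ ⁻¹' tunnelSet X w h δ)ᶜ)
    ((hw.isClosed_tunnelSet hh δ).preimage hc.contDiff_inv.continuous).isOpen_compl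
    (fun _ hz => and_iff_left hz) hx

end Topological

theorem IsTubeChart.hasSmoothBoundary_sdiff {n : ℕ} {Ω : Set (EuclideanSpace ℝ (Fin n))}
    {Θ : X × ℝ → EuclideanSpace ℝ (Fin n)} {Φ : EuclideanSpace ℝ (Fin n) → X × ℝ}
    (hc : IsTubeChart Ω Θ Φ a) (hw : IsTunnelProfile w) (hh : IsTunnelBump h) (hδ : 0 < δ)
    (hδ1 : δ < 1) (hs : HasSmoothBoundary Ω) :
    HasSmoothBoundary (Ω \ Φ ⁻¹' tunnelSet X w h δ) := by
  intro x hx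
  have hΦ := hc.contDiff_inv
  by_cases hxZ : Φ x ∈ tubeDomain X a
  · have hG := hw.tunnelFun_contDiff (X := X) hh δ
    set g : EuclideanSpace ℝ (Fin n) → ℝ := fun z => -tunnelFun X w h δ (Φ z) with hg
    have hgs : ContDiff ℝ (⊤ : ℕ∞) g := (hG.comp hΦ).neg
    have hcont : Continuous (fderiv ℝ g) := hgs.continuous_fderiv (by simp)
    have hr : ∀ z, Θ (Φ z) = z := hc.right_inv
    refine ⟨Φ ⁻¹' tubeDomain X a ∩ {z | fderiv ℝ g z ≠ 0},
      ((isOpen_tubeDomain a).preimage hΦ.continuous).inter (isOpen_ne_fun hcont continuous_const),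
      ⟨hxZ, ?_⟩, g, hgs, fun y hy h0 => hy.2 ?_, ?_, ?_⟩
    · rw [← hr x, hc.mem_frontier_sdiff_iff hw hh hδ hxZ] at hx
      intro h0
      refine hw.fderiv_tunnelFun_ne_zero hh hδ hx ?_
      have h1 : tunnelFun X w h δ = fun y => -g (Θ y) := by
        funext y
        simp only [hg, hc.left_inv, neg_neg]
      have h2 : HasFDerivAt g (0 : EuclideanSpace ℝ (Fin n) →L[ℝ] ℝ) (Θ (Φ x)) := by
        rw [hr, ← h0]
        exact (hgs.differentiable (by simp) x).hasFDerivAt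
      have h3 := ((h2.comp (Φ x) (hc.contDiff.differentiable (by simp) (Φ x)).hasFDerivAt)).neg
      rw [ContinuousLinearMap.zero_comp, neg_zero] at h3
      rw [h1]
      exact h3.fderiv
    · rw [← norm_eq_zero, ← norm_gradient_eq, h0, norm_zero]
    · ext z
      simp only [mem_inter_iff, and_congr_left_iff, and_imp]
      intro hz _
      have := hc.mem_sdiff_iff hw hh hδ hz
      rw [hr] at this
      rw [this, mem_ofPred_eq, hg, neg_lt_zero]
    · ext z
      simp only [mem_inter_iff, and_congr_left_iff, and_imp]
      intro hz _
      have := hc.mem_frontier_sdiff_iff hw hh hδ hz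
      rw [hr] at this
      rw [this, mem_ofPred_eq, hg, neg_eq_zero]
  · have hxK : Φ x ∉ tunnelSet X w h δ := fun hK => hxZ (tunnelSet_subset hc.pos hδ1 hK)
    obtain ⟨U, hU, hxU, g, hg, hg0, h1, h2⟩ :=
      hs x ((hc.mem_frontier_sdiff_iff_of_notMem hw hh hxK).1 hx)
    refine ⟨U ∩ (Φ ⁻¹' tunnelSet X w h δ)ᶜ, hU.inter ((hw.isClosed_tunnelSet hh δ).preimage
      hΦ.continuous).isOpen_compl, ⟨hxU, hxK⟩, g, hg, fun y hy => hg0 y hy.1, ?_, ?_⟩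
    · ext z
      have h3 := Set.ext_iff.1 h1 z
      simp only [mem_inter_iff, Set.mem_sdiff, mem_compl_iff] at h3 ⊢
      tauto
    · ext z
      have h3 := Set.ext_iff.1 h2 z
      simp only [mem_inter_iff, mem_compl_iff] at h3 ⊢
      constructor
      · rintro ⟨h4, h5, h6⟩
        have := (hc.mem_frontier_sdiff_iff_of_notMem hw hh h6).1 h4
        tauto
      · rintro ⟨h4, h5, h6⟩
        exact ⟨(hc.mem_frontier_sdiff_iff_of_notMem hw hh h6).2 (h3.2 ⟨h4, h5⟩).1, h5, h6⟩

end Surgery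

section ChartEstimates

theorem exists_lipschitzOnWith_of_contDiff {V W : Type*} [NormedAddCommGroup V] [NormedSpace ℝ V]
    [NormedAddCommGroup W] [NormedSpace ℝ W] {Ψ : V → W} (hΨ : ContDiff ℝ 1 Ψ) {s : Set V}
    (hs : IsCompact s) :
    ∃ L : ℝ≥0, LipschitzOnWith L Ψ s ∧ ∀ y ∈ s, ‖fderiv ℝ Ψ y‖ₑ ≤ L := by
  obtain ⟨L₁, hL₁⟩ := LocallyLipschitzOn.exists_lipschitzOnWith_of_compact hs
    (hΨ.locallyLipschitz.locallyLipschitzOn (s := s))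
  obtain ⟨L₂, hL₂⟩ := hs.exists_bound_of_continuousOn
    (hΨ.continuous_fderiv one_ne_zero).continuousOn
  refine ⟨max L₁ L₂.toNNReal, hL₁.weaken (le_max_left _ _), fun y hy => ?_⟩
  refine le_trans ?_ (ENNReal.coe_le_coe.2 (le_max_right _ _))
  rw [← ofReal_norm]
  exact ENNReal.ofReal_le_ofReal (hL₂ y hy)

theorem setLIntegral_le_of_forall_eq_zero {α : Type*} [MeasurableSpace α] {μ : Measure α}
    {s t : Set α} (hs : MeasurableSet s) (ht : MeasurableSet t) {g : α → ℝ≥0∞}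
    (h : ∀ x ∈ s, x ∉ t → g x = 0) : ∫⁻ x in s, g x ∂μ ≤ ∫⁻ x in t, g x ∂μ := by
  rw [← lintegral_indicator hs, ← lintegral_indicator ht]
  refine lintegral_mono fun x => ?_
  by_cases hxs : x ∈ s
  · by_cases hxt : x ∈ t
    · simp [hxs, hxt]
    · simp [hxs, hxt, h x hxs hxt]
  · simp [hxs]

def tubeCore (X : Type*) [NormedAddCommGroup X] : Set (X × ℝ) :=
  {y | ‖y.1‖ ≤ 1 ∧ 0 ≤ y.2 ∧ y.2 ≤ 1}

theorem isCompact_tubeCore {X : Type*} [NormedAddCommGroup X] [InnerProductSpace ℝ X]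
    [FiniteDimensional ℝ X] : IsCompact (tubeCore X) := by
  have h1 : tubeCore X = closedBall (0 : X) 1 ×ˢ Icc (0 : ℝ) 1 := by
    ext y
    simp [tubeCore]
  rw [h1]
  exact (isCompact_closedBall _ _).prod isCompact_Icc

variable {X : Type*} [NormedAddCommGroup X] [InnerProductSpace ℝ X] [FiniteDimensional ℝ X]
  [MeasurableSpace X] [BorelSpace X] {w h : ℝ → ℝ}

theorem IsTubeChart.exists_energy_le {E : Type*} [NormedAddCommGroup E] [NormedSpace ℝ E]
    [FiniteDimensional ℝ E] [MeasurableSpace E] [BorelSpace E] {Ω : Set E} {Θ : X × ℝ → E}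
    {Φ : E → X × ℝ} {a : ℝ} (hc : IsTubeChart Ω Θ Φ a) (ν : Measure X) [ν.IsAddHaarMeasure]
    (ν' : Measure E) [ν'.IsAddHaarMeasure]
    (hd : Module.finrank ℝ X + 1 = Module.finrank ℝ E) :
    ∃ C : ℝ≥0, ∀ S ⊆ tubeCore X, MeasurableSet S → ∀ f : E → ℝ, ContDiff ℝ 1 f →
      (∫⁻ y in S, ‖f (Θ y)‖ₑ ^ 2 ∂(ν.prod volume)) +
          ∫⁻ y in S, ‖fderiv ℝ (fun y => f (Θ y)) y‖ₑ ^ 2 ∂(ν.prod volume) ≤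
        C * ((∫⁻ x in Θ '' S, ‖f x‖ₑ ^ 2 ∂ν') +
          ∫⁻ x in Θ '' S, ‖fderiv ℝ f x‖ₑ ^ 2 ∂ν') := by
  have hΘ1 : ContDiff ℝ 1 Θ := hc.contDiff.of_le (by exact_mod_cast le_top)
  have hΦ1 : ContDiff ℝ 1 Φ := hc.contDiff_inv.of_le (by exact_mod_cast le_top)
  obtain ⟨L, -, hL⟩ := exists_lipschitzOnWith_of_contDiff hΘ1 (isCompact_tubeCore (X := X))
  obtain ⟨L', hL', -⟩ := exists_lipschitzOnWith_of_contDiff hΦ1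
    ((isCompact_tubeCore (X := X)).image hΘ1.continuous)
  obtain ⟨C, hC⟩ := exists_lintegral_image_haar_le ν' (ν.prod (volume : Measure ℝ)) L'
    (by rw [Module.finrank_prod, Module.finrank_self, hd])
  have key : ∀ S ⊆ tubeCore X, MeasurableSet S → ∀ g : X × ℝ → ℝ≥0∞, Measurable g →
      ∫⁻ y in S, g y ∂(ν.prod volume) ≤ C * ∫⁻ x in Θ '' S, g (Φ x) ∂ν' := by
    intro S hS hSm g hg
    have h1 := hC Φ (Θ '' S) (hc.image_eq S ▸ hc.contDiff_inv.continuous.measurable hSm)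
      (hL'.mono (image_mono hS)) g hg
    rwa [image_image, show (fun x => Φ (Θ x)) = id from funext hc.left_inv, image_id] at h1
  refine ⟨C * (1 + L ^ 2), fun S hS hSm f hf => ?_⟩
  have hdf : Continuous (fderiv ℝ f) := hf.continuous_fderiv one_ne_zero
  have hA := key S hS hSm (fun y => ‖f (Θ y)‖ₑ ^ 2)
    ((hf.continuous.comp hΘ1.continuous).enorm.measurable.pow_const 2)
  have hB := key S hS hSm (fun y => (L : ℝ≥0∞) ^ 2 * ‖fderiv ℝ f (Θ y)‖ₑ ^ 2)
    (((hdf.comp hΘ1.continuous).enorm.measurable.pow_const 2).const_mul _)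
  simp only [hc.right_inv] at hA hB
  have hB2 : ∫⁻ y in S, ‖fderiv ℝ (fun y => f (Θ y)) y‖ₑ ^ 2 ∂(ν.prod volume) ≤
      ∫⁻ y in S, (L : ℝ≥0∞) ^ 2 * ‖fderiv ℝ f (Θ y)‖ₑ ^ 2 ∂(ν.prod volume) := by
    refine setLIntegral_mono' hSm fun y hy => ?_
    have h1 : fderiv ℝ (fun y => f (Θ y)) y = (fderiv ℝ f (Θ y)).comp (fderiv ℝ Θ y) :=
      fderiv_comp y (hf.differentiable one_ne_zero _) (hΘ1.differentiable one_ne_zero _)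
    rw [h1, ← mul_pow, mul_comm]
    refine pow_le_pow_left' ((ContinuousLinearMap.opENorm_comp_le _ _).trans ?_) 2
    exact mul_le_mul_right (hL y (hS hy)) _
  refine (add_le_add hA (hB2.trans hB)).trans ?_
  rw [lintegral_const_mul' _ _ (by simp), ← mul_add, ENNReal.coe_mul, mul_assoc]
  refine mul_le_mul_right ?_ _
  push_cast
  rw [mul_add]
  refine add_le_add ?_ ?_
  · exact le_mul_of_one_le_left' (by simp)
  · exact mul_le_mul_left (by simp) _

theorem tendsto_pow_two_inv_mul_log :
    Tendsto (fun K : ℕ => ((2 : ℝ) ^ K)⁻¹ * (1 + Real.log (2 ^ K))) atTop (𝓝 0) := by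
  have h1 := tendsto_pow_atTop_nhds_zero_of_lt_one (r := (2 : ℝ)⁻¹) (by norm_num) (by norm_num)
  have h2 := (tendsto_self_mul_const_pow_of_lt_one (r := (2 : ℝ)⁻¹)
    (by norm_num) (by norm_num)).mul_const (Real.log 2)
  have h3 := h1.add h2
  rw [zero_mul, zero_add] at h3
  refine h3.congr fun K => ?_
  rw [Real.log_pow, inv_pow]
  ring

theorem exists_tunnel_trace_small (ν : Measure X) [ν.IsAddHaarMeasure]
    (hd2 : 2 ≤ Module.finrank ℝ X)
    (Y : Type*) [EMetricSpace Y] [MeasurableSpace Y]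
    [BorelSpace Y] {d : ℝ} (hd : (Module.finrank ℝ X : ℝ) = d)
    (hw : IsTunnelProfile w) (hh : IsTunnelBump h) (L : ℝ≥0) {ε : ℝ≥0} (hε : 0 < ε) :
    ∀ᶠ K : ℕ in atTop, ∀ (Θ : X × ℝ → Y) (δ : ℝ), 0 < δ →
      LipschitzOnWith L Θ {y | ‖y.1‖ ≤ ((2 : ℝ) ^ (K + 1))⁻¹ ∧ w y.2 = h (‖y.1‖ ^ 2 / δ ^ 2)} →
      ∀ f : Y → ℝ, Measurable f → ∀ F : X × ℝ → ℝ, ContDiff ℝ 1 F → (∀ y, f (Θ y) = F y) →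
        ∫⁻ y in Θ '' {y | ‖y.1‖ ≤ ((2 : ℝ) ^ (K + 1))⁻¹ ∧ w y.2 = h (‖y.1‖ ^ 2 / δ ^ 2)},
            ‖f y‖ₑ ^ 2 ∂μH[d] ≤
          ε * ((∫⁻ y in {y | h (‖y.1‖ ^ 2 / δ ^ 2) < w y.2} ∩ {y | ‖y.1‖ ≤ 1},
              ‖F y‖ₑ ^ 2 ∂(ν.prod volume)) +
            ∫⁻ y in {y | h (‖y.1‖ ^ 2 / δ ^ 2) < w y.2} ∩ {y | ‖y.1‖ ≤ 1},
              ‖fderiv ℝ F y‖ₑ ^ 2 ∂(ν.prod volume)) := by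
  obtain ⟨C, hC⟩ := exists_tunnel_trace_le ν hd2 Y hd hw hh L
  have hlim : Tendsto (fun K : ℕ => (5 * C : ℝ) * (((2 : ℝ) ^ K)⁻¹ * (1 + Real.log (2 ^ K))))
      atTop (𝓝 0) := by
    simpa using tendsto_pow_two_inv_mul_log.const_mul (5 * C : ℝ)
  filter_upwards [hlim.eventually_lt_const (show (0 : ℝ) < ε from hε), eventually_ge_atTop 3]
    with K hK hK3 Θ δ hδ hLip f hf F hF hfF
  set b : ℝ := 2 ^ K with hb
  have hb8 : (8 : ℝ) ≤ b := by
    calc (8 : ℝ) = 2 ^ 3 := by norm_num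
      _ ≤ b := pow_le_pow_right₀ (by norm_num) hK3
  have hb0 : 0 < b := by linarith
  have hlog : 0 ≤ Real.log b := Real.log_nonneg (by linarith)
  set ρ : ℝ≥0 := (2 * b.toNNReal)⁻¹ with hρ
  have hρr : (ρ : ℝ) = ((2 : ℝ) ^ (K + 1))⁻¹ := by
    rw [hρ]
    push_cast
    rw [Real.coe_toNNReal _ hb0.le, pow_succ, mul_comm]
  have hρb : 2 * (ρ : ℝ) = b⁻¹ := by
    rw [hρr, pow_succ, mul_inv, ← hb]
    ring
  have hρ0 : 0 < ρ := by
    rw [← NNReal.coe_pos, hρr]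
    positivity
  have hρ6 : ρ ≤ 1 / 6 := by
    rw [← NNReal.coe_le_coe]
    have h1 : b⁻¹ ≤ 8⁻¹ := inv_anti₀ (by norm_num) hb8
    push_cast
    linarith
  rw [← hρr] at hLip ⊢
  refine (hC Θ ρ hρ0 hρ6 δ hδ hLip f hf F hF hfF).trans ?_
  have hDm : MeasurableSet {y : X × ℝ | h (‖y.1‖ ^ 2 / δ ^ 2) < w y.2} :=
    (isOpen_lt (f := fun y : X × ℝ => h (‖y.1‖ ^ 2 / δ ^ 2)) (g := fun y : X × ℝ => w y.2)
      (hh.contDiff.continuous.comp (by fun_prop))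
      (hw.contDiff.continuous.comp (by fun_prop))).measurableSet
  have hax := lintegral_near_axis_le ν hd2 hDm (fun y hy l hl _ => by
    refine lt_of_le_of_lt (hh.mono (norm_nonneg _) ?_) hy
    rw [norm_smul, Real.norm_of_nonneg (by linarith)]
    exact le_mul_of_one_le_left (norm_nonneg _) hl) hF (b := b) (by linarith)
  rw [← hρb] at hax
  set D : Set (X × ℝ) := {y | h (‖y.1‖ ^ 2 / δ ^ 2) < w y.2}
  set N := ∫⁻ y in D ∩ {y | ‖y.1‖ ≤ 1}, ‖F y‖ₑ ^ 2 ∂(ν.prod volume)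
  set A := ∫⁻ y in D ∩ {y | ‖y.1‖ ≤ 1}, ‖fderiv ℝ F y‖ₑ ^ 2 ∂(ν.prod volume)
  set κ : ℝ≥0 := (b⁻¹ * (1 + Real.log b)).toNNReal with hκ
  have hκ0 : 0 ≤ b⁻¹ * (1 + Real.log b) := by positivity
  have hA : ∫⁻ y in D ∩ {y | ‖y.1‖ ≤ 2 * ρ}, ‖fderiv ℝ F y‖ₑ ^ 2 ∂(ν.prod volume) ≤ A := by
    refine lintegral_mono_set (inter_subset_inter_right _ fun y hy => ?_)
    refine le_trans (show ‖y.1‖ ≤ 2 * ρ from hy) ?_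
    rw [hρb]
    exact inv_le_one_of_one_le₀ (by linarith)
  have hρκ : ρ ≤ κ := by
    rw [← NNReal.coe_le_coe, hκ, Real.coe_toNNReal _ hκ0, mul_add, mul_one]
    have h1 : 0 ≤ b⁻¹ * Real.log b := by positivity
    have h2 : 0 ≤ (ρ : ℝ) := ρ.2
    linarith
  have hfirst : (ρ : ℝ≥0∞)⁻¹ *
      (∫⁻ y in D ∩ {y | ‖y.1‖ ≤ 2 * ρ}, ‖F y‖ₑ ^ 2 ∂(ν.prod volume)) ≤
        4 * κ * (N + A) := by
    refine (mul_le_mul_right hax _).trans ?_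
    have h1 : N + ENNReal.ofReal (Real.log b) * A ≤
        ENNReal.ofReal (1 + Real.log b) * (N + A) := by
      rw [mul_add]
      refine add_le_add (le_mul_of_one_le_left' ?_) (mul_le_mul_left ?_ _)
      · rw [ENNReal.one_le_ofReal]
        linarith
      · exact ENNReal.ofReal_le_ofReal (by linarith)
    refine (mul_le_mul_right (mul_le_mul_right h1 _) _).trans (le_of_eq ?_)
    rw [← mul_assoc, ← mul_assoc]
    congr 1
    have h2 : (ρ : ℝ≥0∞)⁻¹ = ENNReal.ofReal (2 * b) := by
      rw [← ENNReal.coe_inv hρ0.ne', hρ, inv_inv, ENNReal.ofReal, ENNReal.coe_inj,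
        Real.toNNReal_mul (by norm_num)]
      simp
    have h3 : (2 : ℝ≥0∞) = ENNReal.ofReal 2 := by simp
    have h4 : (4 : ℝ≥0∞) = ENNReal.ofReal 4 := by simp
    rw [h2, h4, hκ, h3, ← ENNReal.ofReal_mul (by norm_num), ← ENNReal.ofReal_mul (by positivity),
      ← ENNReal.ofReal_mul (by positivity)]
    change _ = ENNReal.ofReal 4 * ENNReal.ofReal _
    rw [← ENNReal.ofReal_mul (by norm_num)]
    congr 1
    field_simp
    ring
  have hsecond : ρ * ∫⁻ y in D ∩ {y | ‖y.1‖ ≤ 2 * ρ}, ‖fderiv ℝ F y‖ₑ ^ 2 ∂(ν.prod volume) ≤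
      κ * (N + A) :=
    mul_le_mul' (ENNReal.coe_le_coe.2 hρκ) (hA.trans le_add_self)
  refine (mul_le_mul_right (add_le_add hfirst hsecond) _).trans ?_
  rw [← add_mul, ← mul_assoc]
  refine mul_le_mul_left ?_ _
  have h5 : C * (4 * κ + κ) ≤ ε := by
    rw [← NNReal.coe_le_coe]
    push_cast
    rw [hκ, Real.coe_toNNReal _ hκ0]
    linarith
  exact_mod_cast h5

end ChartEstimates

section ChartModification

variable {X : Type*} [NormedAddCommGroup X] [InnerProductSpace ℝ X] [FiniteDimensional ℝ X]
  [MeasurableSpace X] [BorelSpace X] {w h : ℝ → ℝ}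

theorem eventually_measure_closedBall_le (ν : Measure X) [ν.IsAddHaarMeasure]
    (hd : 1 ≤ Module.finrank ℝ X) {ε : ℝ≥0∞} (hε : 0 < ε) :
    ∀ᶠ K : ℕ in atTop, ν (closedBall 0 (((2 : ℝ) ^ (K + 1))⁻¹)) ≤ ε := by
  have : Nontrivial X := Module.nontrivial_of_finrank_pos (R := ℝ) (by omega)
  have h1 : Tendsto (fun K : ℕ => ((2 : ℝ) ^ (K + 1))⁻¹) atTop (𝓝 0) := by
    have h2 := (tendsto_pow_atTop_nhds_zero_of_lt_one (r := (2 : ℝ)⁻¹)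
      (by norm_num) (by norm_num)).comp (tendsto_add_atTop_nat 1)
    exact h2.congr fun K => by simp
  have h3 : Tendsto (fun r : ℝ => ENNReal.ofReal (r ^ Module.finrank ℝ X) * ν (closedBall 0 1))
      (𝓝 0) (𝓝 0) := by
    have h4 : Tendsto (fun r : ℝ => ENNReal.ofReal (r ^ Module.finrank ℝ X)) (𝓝 0) (𝓝 0) := by
      have h5 : Continuous fun r : ℝ => ENNReal.ofReal (r ^ Module.finrank ℝ X) :=
        ENNReal.continuous_ofReal.comp (by fun_prop)
      simpa [show Module.finrank ℝ X ≠ 0 by omega] using h5.tendsto 0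
    simpa using ENNReal.Tendsto.mul_const h4
      (Or.inr (isCompact_closedBall (0 : X) 1).measure_lt_top.ne)
  filter_upwards [(h3.comp h1).eventually_lt_const hε] with K hK
  rw [Measure.addHaar_closedBall' ν _ (by positivity)]
  exact hK.le

theorem IsTubeChart.exists_isSmallModification {m : ℕ} {Ω : Set (EuclideanSpace ℝ (Fin (m + 1)))}
    {Θ : X × ℝ → EuclideanSpace ℝ (Fin (m + 1))} {Φ : EuclideanSpace ℝ (Fin (m + 1)) → X × ℝ}
    {a : ℝ} (hc : IsTubeChart Ω Θ Φ a) (hm : 2 ≤ m) (hX : Module.finrank ℝ X = m)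
    (hΩ : IsOpen Ω) (hw : IsTunnelProfile w) (hh : IsTunnelBump h) {ε : ℝ≥0} (hε : 0 < ε) :
    ∃ δ : ℝ, 0 < δ ∧ δ < 1 ∧
      ∃ P, IsSmallModification Ω (Ω \ Φ ⁻¹' tunnelSet X w h δ) P ε := by
  set ν : Measure X := Measure.addHaar
  have hd2 : 2 ≤ Module.finrank ℝ X := hX ▸ hm
  have hE : Module.finrank ℝ X + 1 = Module.finrank ℝ (EuclideanSpace ℝ (Fin (m + 1))) := by
    simp [hX]
  have hXm : (Module.finrank ℝ X : ℝ) = (m : ℝ) := by rw [hX]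
  have hΘ1 : ContDiff ℝ 1 Θ := hc.contDiff.of_le (by exact_mod_cast le_top)
  have hΦ1 : ContDiff ℝ 1 Φ := hc.contDiff_inv.of_le (by exact_mod_cast le_top)
  have ha := hc.pos
  obtain ⟨L, hL, -⟩ := exists_lipschitzOnWith_of_contDiff hΘ1 (isCompact_tubeCore (X := X))
  obtain ⟨L', -, hL'⟩ := exists_lipschitzOnWith_of_contDiff hΦ1
    ((isCompact_tubeCore (X := X)).image hΘ1.continuous)
  obtain ⟨C₁, hC₁⟩ := exists_lintegral_image_haar_le (ν.prod (volume : Measure ℝ))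
    (volume : Measure (EuclideanSpace ℝ (Fin (m + 1)))) L
    (by rw [Module.finrank_prod, Module.finrank_self, hE])
  obtain ⟨C₂, hC₂⟩ := hc.exists_energy_le ν
    (volume : Measure (EuclideanSpace ℝ (Fin (m + 1)))) hE
  obtain ⟨C₃, hC₃⟩ := exists_lintegral_image_le ν (EuclideanSpace ℝ (Fin (m + 1))) L hXm
  have hdiv : ∀ c : ℝ≥0, 0 < ε / (c + 1) ∧ c * (ε / (c + 1)) ≤ ε := by
    intro c
    refine ⟨by positivity, ?_⟩
    rw [mul_div_assoc', div_le_iff₀ (by positivity), mul_comm]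
    exact mul_le_mul_right (by simp) _
  have htrace := exists_tunnel_trace_small ν hd2 (EuclideanSpace ℝ (Fin (m + 1))) hXm hw hh L
    (hdiv C₂).1
  have hball := eventually_measure_closedBall_le ν (by omega)
    (ENNReal.coe_pos.2 (hdiv (2 * C₃)).1)
  obtain ⟨K, hKt, hKb⟩ := (htrace.and hball).exists
  set ρ : ℝ := ((2 : ℝ) ^ (K + 1))⁻¹ with hρ
  have hρ1 : ρ ≤ 1 := inv_le_one_of_one_le₀ (one_le_pow₀ (by norm_num))
  set ε₁ : ℝ≥0 := ε / (C₁ * L' ^ 2 * C₂ + 1) with hε₁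
  obtain ⟨η, ρ', hρ'0, hη, hη0, hη1, hηin, hηout, hηe⟩ :=
    exists_axis_cutoff ν hd2 (K + 1) (hdiv (C₁ * L' ^ 2 * C₂)).1
  set δ : ℝ := min (ρ' / 2) (1 / 2) with hδ
  have hδ0 : 0 < δ := by positivity
  have hδ1 : δ < 1 := (min_le_right _ _).trans_lt (by norm_num)
  have hδρ : 2 * δ ≤ ρ' := by
    have := min_le_left (ρ' / 2) (1 / 2)
    linarith
  let θ : ContDiffBump (1 / 2 : ℝ) := ⟨1 / 2 + a / 2, 1 / 2 + a, by linarith, by linarith⟩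
  have hθin : ∀ s : ℝ, -(a / 2) ≤ s → s ≤ 1 + a / 2 → θ s = 1 := fun s h1 h2 =>
    θ.one_of_mem_closedBall (by
      rw [mem_closedBall, Real.dist_eq, abs_le]
      constructor <;> simp only [θ] <;> linarith)
  have hθout : ∀ s : ℝ, θ s ≠ 0 → -a < s ∧ s < 1 + a := by
    intro s hs
    have h1 : s ∈ ball (1 / 2 : ℝ) (1 / 2 + a) := by
      rw [show (1 / 2 + a) = θ.rOut from rfl, ← θ.support_eq]
      exact hs
    rw [mem_ball, Real.dist_eq, abs_lt] at h1
    constructor <;> linarith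
  set P : EuclideanSpace ℝ (Fin (m + 1)) → ℝ :=
    fun x => 1 - θ (Φ x).2 * (1 - η (Φ x).1) with hP
  have hPc : ContDiff ℝ (⊤ : ℕ∞) P :=
    contDiff_const.sub ((θ.contDiff.comp (contDiff_snd.comp hc.contDiff_inv)).mul
      (contDiff_const.sub (hη.comp (contDiff_fst.comp hc.contDiff_inv))))
  have hP0 : ∀ x, 0 ≤ P x := fun x => by
    have h1 := mul_le_one₀ (θ.le_one (x := (Φ x).2)) (sub_nonneg.2 (hη1 (Φ x).1))
      (by linarith [hη0 (Φ x).1])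
    simp only [hP]
    linarith
  have hP1 : ∀ x, P x ≤ 1 := fun x => by
    have h1 := mul_nonneg (θ.nonneg (x := (Φ x).2)) (sub_nonneg.2 (hη1 (Φ x).1))
    simp only [hP]
    linarith
  have hPne : ∀ x, P x ≠ 1 → (-a < (Φ x).2 ∧ (Φ x).2 < 1 + a) ∧ ‖(Φ x).1‖ ≤ ρ := by
    intro x hx
    refine ⟨hθout _ fun h0 => hx (by simp [hP, h0]), ?_⟩
    by_contra! hlt
    exact hx (by simp [hP, hηout _ hlt])
  have hPtun : ∀ x, P x ≠ 0 → Φ x ∉ tunnelSet X w h δ := by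
    intro x hx hmem
    refine hx ?_
    simp only [hP]
    rw [hηin _ (hmem.1.trans hδρ), hθin _ (by linarith [hmem.2.1.1]) (by linarith [hmem.2.1.2])]
    ring
  set Ω' := Ω \ Φ ⁻¹' tunnelSet X w h δ with hΩ'
  have hΩ'o : IsOpen Ω' := hc.isOpen_sdiff hw hh hΩ
  set D : Set (X × ℝ) := {y | h (‖y.1‖ ^ 2 / δ ^ 2) < w y.2} with hD
  have hDo : IsOpen D := isOpen_lt (f := fun y : X × ℝ => h (‖y.1‖ ^ 2 / δ ^ 2))
    (g := fun y : X × ℝ => w y.2) (hh.contDiff.continuous.comp (by fun_prop))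
    (hw.contDiff.continuous.comp (by fun_prop))
  have hDdil : ∀ y ∈ D, ∀ l : ℝ, 1 ≤ l → l * ‖y.1‖ ≤ 1 → (l • y.1, y.2) ∈ D := by
    intro y hy l hl _
    refine lt_of_le_of_lt (hh.mono (norm_nonneg _) ?_) hy
    rw [norm_smul, Real.norm_of_nonneg (by linarith)]
    exact le_mul_of_one_le_left (norm_nonneg _) hl
  set S : Set (X × ℝ) := D ∩ {y | ‖y.1‖ ≤ 1} with hS
  have hSm : MeasurableSet S :=
    hDo.measurableSet.inter (measurableSet_le (by fun_prop) (by fun_prop))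
  have hDpos : ∀ y ∈ D, 0 < y.2 ∧ y.2 < 1 := fun y hy =>
    (hw.pos_iff _).1 ((hh.nonneg _).trans_lt hy)
  have hScore : S ⊆ tubeCore X := fun y hy =>
    ⟨hy.2, (hDpos y hy.1).1.le, (hDpos y hy.1).2.le⟩
  have htd : ∀ y : X × ℝ, ‖y.1‖ ≤ 1 → -a < y.2 → y.2 < 1 + a → y ∈ tubeDomain X a :=
    fun y h1 h2 h3 => ⟨lt_of_le_of_lt h1 (by norm_num), h2, h3⟩
  have hΘS : MeasurableSet (Θ '' S) := hc.image_eq S ▸ hΦ1.continuous.measurable hSm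
  have hΘSsub : Θ '' S ⊆ Ω' := by
    rintro _ ⟨y, hy, rfl⟩
    have h1 := hDpos y hy.1
    rw [hΩ', hc.mem_sdiff_iff hw hh hδ0 (htd y hy.2 (by linarith) (by linarith))]
    exact sub_pos.2 hy.1
  have henergy : ∀ f : EuclideanSpace ℝ (Fin (m + 1)) → ℝ, ContDiff ℝ (⊤ : ℕ∞) f →
      (∫⁻ y in S, ‖f (Θ y)‖ₑ ^ 2 ∂(ν.prod volume)) +
          ∫⁻ y in S, ‖fderiv ℝ (fun y => f (Θ y)) y‖ₑ ^ 2 ∂(ν.prod volume) ≤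
        C₂ * ((∫⁻ x in Ω', ‖f x‖ₑ ^ 2) + ∫⁻ x in Ω', ‖fderiv ℝ f x‖ₑ ^ 2) := by
    intro f hf
    refine (hC₂ S hScore hSm f (hf.of_le (by exact_mod_cast le_top))).trans
      (mul_le_mul_right (add_le_add ?_ ?_) _) <;> exact lintegral_mono_set hΘSsub
  have hcomp : ∀ f : EuclideanSpace ℝ (Fin (m + 1)) → ℝ, ContDiff ℝ (⊤ : ℕ∞) f →
      ContDiff ℝ 1 fun y => f (Θ y) := fun f hf =>
    (hf.comp hc.contDiff).of_le (by exact_mod_cast le_top)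
  refine ⟨δ, hδ0, hδ1, P, ⟨hΩ'o, sdiff_subset, hPc, hP0, hP1, fun x hx hPx => ⟨hx, hPtun x hPx⟩,
    fun x hPx => (hc.mem_frontier_sdiff_iff_of_notMem hw hh (hPtun x hPx)).symm, ?_, ?_, ?_⟩⟩
  · intro f hf
    have hzero : ∀ x ∈ Ω', x ∉ Θ '' S → (‖f x‖ₑ * ‖fderiv ℝ P x‖ₑ) ^ 2 = 0 := by
      intro x hx hxS
      have h1 : P x = 1 := by
        by_contra hne
        obtain ⟨⟨h2, h3⟩, h4⟩ := hPne x hne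
        refine hxS ⟨Φ x, ⟨?_, h4.trans hρ1⟩, hc.right_inv x⟩
        rw [← hc.right_inv x, hΩ', hc.mem_sdiff_iff hw hh hδ0 (htd _ (h4.trans hρ1) h2 h3)] at hx
        exact sub_pos.1 hx
      have h2 : fderiv ℝ P x = 0 :=
        IsLocalMax.fderiv_eq_zero (Eventually.of_forall fun y => by rw [h1]; exact hP1 y)
      rw [h2, show ‖(0 : EuclideanSpace ℝ (Fin (m + 1)) →L[ℝ] ℝ)‖ₑ = 0 by
        rw [← ofReal_norm, norm_zero, ENNReal.ofReal_zero], mul_zero, zero_pow two_ne_zero]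
    have hder : ∀ y ∈ S, ‖fderiv ℝ P (Θ y)‖ₑ ≤ L' * ‖fderiv ℝ η y.1‖ₑ := by
      intro y hy
      have hy2 := hDpos y hy.1
      have hev : P =ᶠ[𝓝 (Θ y)] fun x => η (Φ x).1 := by
        have h1 : ∀ᶠ x in 𝓝 (Θ y), (Φ x).2 ∈ Ioo (0 : ℝ) 1 := by
          refine (continuous_snd.comp hΦ1.continuous).continuousAt.eventually_mem
            (Ioo_mem_nhds ?_ ?_) <;> simp [hc.left_inv, hy2]
        filter_upwards [h1] with x hx
        simp only [hP]
        rw [hθin _ (by linarith [hx.1]) (by linarith [hx.2])]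
        ring
      have h2 : HasFDerivAt (fun x => η (Φ x).1)
          ((fderiv ℝ η y.1).comp ((ContinuousLinearMap.fst ℝ X ℝ).comp (fderiv ℝ Φ (Θ y))))
          (Θ y) := by
        have h3 : HasFDerivAt η (fderiv ℝ η y.1) (Φ (Θ y)).1 := by
          rw [hc.left_inv]
          exact (hη.differentiable (by simp) _).hasFDerivAt
        exact h3.comp (Θ y) (hasFDerivAt_fst.comp (Θ y)
          (hΦ1.differentiable one_ne_zero _).hasFDerivAt)
      rw [hev.fderiv_eq, h2.fderiv, mul_comm]
      refine (ContinuousLinearMap.opENorm_comp_le _ _).trans (mul_le_mul_right ?_ _)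
      refine (ContinuousLinearMap.opENorm_comp_le _ _).trans ?_
      refine (mul_le_mul' ?_ (hL' _ (mem_image_of_mem _ (hScore hy)))).trans (one_mul _).le
      rw [← ofReal_norm, ENNReal.ofReal_le_one]
      exact ContinuousLinearMap.norm_fst_le _ _ _
    have hdP : Continuous (fderiv ℝ P) := hPc.continuous_fderiv (by simp)
    calc ∫⁻ x in Ω', (‖f x‖ₑ * ‖fderiv ℝ P x‖ₑ) ^ 2
        ≤ ∫⁻ x in Θ '' S, (‖f x‖ₑ * ‖fderiv ℝ P x‖ₑ) ^ 2 :=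
          setLIntegral_le_of_forall_eq_zero hΩ'o.measurableSet hΘS hzero
      _ ≤ C₁ * ∫⁻ y in S, (‖f (Θ y)‖ₑ * ‖fderiv ℝ P (Θ y)‖ₑ) ^ 2 ∂(ν.prod volume) :=
          hC₁ Θ S hSm (hL.mono hScore) _
            ((hf.continuous.enorm.measurable.mul hdP.enorm.measurable).pow_const 2)
      _ ≤ C₁ * ∫⁻ y in S, (L' : ℝ≥0∞) ^ 2 * (‖f (Θ y)‖ₑ * ‖fderiv ℝ η y.1‖ₑ) ^ 2
            ∂(ν.prod volume) := by
          refine mul_le_mul_right (setLIntegral_mono' hSm fun y hy => ?_) _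
          rw [← mul_pow]
          refine pow_le_pow_left' ((mul_le_mul_right (hder y hy) _).trans (le_of_eq ?_)) 2
          ring
      _ ≤ C₁ * ((L' : ℝ≥0∞) ^ 2 * (ε₁ *
            (C₂ * ((∫⁻ x in Ω', ‖f x‖ₑ ^ 2) + ∫⁻ x in Ω', ‖fderiv ℝ f x‖ₑ ^ 2)))) := by
          rw [lintegral_const_mul' _ _ (by simp)]
          refine mul_le_mul_right (mul_le_mul_right ?_ _) _
          refine (lintegral_mono_set inter_subset_left).trans ?_
          exact (hηe D hDo.measurableSet hDdil _ (hcomp f hf)).trans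
            (mul_le_mul_right (henergy f hf) _)
      _ ≤ ε * ((∫⁻ x in Ω', ‖f x‖ₑ ^ 2) + ∫⁻ x in Ω', ‖fderiv ℝ f x‖ₑ ^ 2) := by
          simp only [← mul_assoc]
          refine mul_le_mul_left ?_ _
          refine le_trans (le_of_eq ?_) (ENNReal.coe_le_coe.2 (hdiv (C₁ * L' ^ 2 * C₂)).2)
          push_cast
          ring
  · intro f hf
    have hsub : frontier Ω' ∩ {x | P x ≠ 1} ⊆
        Θ '' {y | ‖y.1‖ ≤ ρ ∧ w y.2 = h (‖y.1‖ ^ 2 / δ ^ 2)} := by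
      rintro x ⟨hx, hPx⟩
      obtain ⟨⟨h2, h3⟩, h4⟩ := hPne x hPx
      refine ⟨Φ x, ⟨h4, ?_⟩, hc.right_inv x⟩
      rw [← hc.right_inv x, hΩ',
        hc.mem_frontier_sdiff_iff hw hh hδ0 (htd _ (h4.trans hρ1) h2 h3)] at hx
      exact sub_eq_zero.1 hx
    have hLip : LipschitzOnWith L Θ {y | ‖y.1‖ ≤ ρ ∧ w y.2 = h (‖y.1‖ ^ 2 / δ ^ 2)} := by
      refine hL.mono fun y hy => ⟨hy.1.trans hρ1, ?_⟩
      exact hw.mem_Icc (hy.2 ▸ hh.nonneg _)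
    refine (lintegral_mono_set hsub).trans ?_
    refine (hKt Θ δ hδ0 hLip f hf.continuous.measurable _ (hcomp f hf) fun _ => rfl).trans ?_
    refine (mul_le_mul_right (henergy f hf) _).trans ?_
    rw [← mul_assoc]
    refine mul_le_mul_left ?_ _
    rw [mul_comm]
    exact_mod_cast (hdiv C₂).2
  · have hdisk : ∀ s ∈ Icc (0 : ℝ) 1,
        μH[(m : ℝ)] ((fun x => Θ (x, s)) '' closedBall 0 ρ) ≤ C₃ * ν (closedBall 0 ρ) := by
      intro s hs
      have hLip : LipschitzOnWith L (fun x : X => Θ (x, s)) (closedBall 0 ρ) := by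
        intro x hx x' hx'
        have hmem : ∀ z ∈ closedBall (0 : X) ρ, ((z, s) : X × ℝ) ∈ tubeCore X := fun z hz =>
          ⟨(mem_closedBall_zero_iff.1 hz).trans hρ1, hs⟩
        have h1 := hL (hmem x hx) (hmem x' hx')
        simpa [Prod.edist_eq] using h1
      have h1 := hC₃ (fun x => Θ (x, s)) (closedBall 0 ρ) measurableSet_closedBall hLip
        (fun _ => 1) measurable_const
      simpa using h1
    have hsub : frontier Ω ∩ {x | P x ≠ 1} ⊆
        (fun x => Θ (x, 0)) '' closedBall 0 ρ ∪ (fun x => Θ (x, 1)) '' closedBall 0 ρ := by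
      rintro x ⟨hx, hPx⟩
      obtain ⟨⟨h2, h3⟩, h4⟩ := hPne x hPx
      rw [← hc.right_inv x, hc.mem_frontier_iff _
        (lt_of_le_of_lt (h4.trans hρ1) (by norm_num)) h2 h3] at hx
      rcases hx with h0 | h0
      · refine Or.inl ⟨(Φ x).1, mem_closedBall_zero_iff.2 h4, ?_⟩
        dsimp only
        rw [← h0, hc.right_inv]
      · refine Or.inr ⟨(Φ x).1, mem_closedBall_zero_iff.2 h4, ?_⟩
        dsimp only
        rw [← h0, hc.right_inv]
    refine (measure_mono hsub).trans ((measure_union_le _ _).trans ?_)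
    refine (add_le_add (hdisk 0 (by simp)) (hdisk 1 (by simp))).trans ?_
    rw [← two_mul, ← mul_assoc]
    refine (mul_le_mul_right hKb _).trans ?_
    exact_mod_cast (hdiv (2 * C₃)).2

end ChartModification

section LocalGraph

variable {X : Type*} [NormedAddCommGroup X] [InnerProductSpace ℝ X] [FiniteDimensional ℝ X]

theorem exists_contDiff_implicit {G : X × ℝ → ℝ} (hG : ContDiff ℝ (⊤ : ℕ∞) G) (h0 : G 0 = 0)
    (hd : fderiv ℝ G 0 (0, 1) < 0) :
    ∃ (k : X → ℝ) (W : Set X), IsOpen W ∧ (0 : X) ∈ W ∧ (∀ x ∈ W, ContDiffAt ℝ (⊤ : ℕ∞) k x) ∧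
      k 0 = 0 ∧ ∀ x ∈ W, G (x, k x) = 0 := by
  have hdG : Differentiable ℝ G := hG.differentiable (by simp)
  set F : X × ℝ → X × ℝ := fun y => (y.1, G y) with hF
  have hFc : ContDiff ℝ (⊤ : ℕ∞) F := contDiff_fst.prodMk hG
  have hF' : ∀ y : X × ℝ, fderiv ℝ G y (0, 1) < 0 →
      ∃ e : (X × ℝ) ≃L[ℝ] (X × ℝ), HasFDerivAt F (e : (X × ℝ) →L[ℝ] X × ℝ) y := by
    intro y hy
    set c := fderiv ℝ G y (0, 1) with hc
    have hsplit : ∀ u : X, ∀ s : ℝ, fderiv ℝ G y (u, s) = fderiv ℝ G y (u, 0) + s * c := by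
      intro u s
      have h1 : ((u, s) : X × ℝ) = (u, 0) + s • ((0 : X), (1 : ℝ)) := by ext <;> simp
      rw [h1, map_add, map_smul, smul_eq_mul]
    refine ⟨ContinuousLinearEquiv.equivOfInverse
      ((ContinuousLinearMap.fst ℝ X ℝ).prod (fderiv ℝ G y))
      ((ContinuousLinearMap.fst ℝ X ℝ).prod (c⁻¹ • (ContinuousLinearMap.snd ℝ X ℝ -
        (fderiv ℝ G y).comp ((ContinuousLinearMap.inl ℝ X ℝ).comp
          (ContinuousLinearMap.fst ℝ X ℝ))))) ?_ ?_, ?_⟩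
    · rintro ⟨u, s⟩
      ext
      · simp
      · simp [hsplit u s, hy.ne, mul_comm]
    · rintro ⟨u, s⟩
      ext
      · simp
      · simp only [ContinuousLinearMap.prod_apply, ContinuousLinearMap.coe_fst']
        rw [hsplit]
        simp [mul_comm _ c, mul_inv_cancel_left₀ hy.ne]
    · exact hasFDerivAt_fst.prodMk (hdG y).hasFDerivAt
  obtain ⟨e₀, he₀⟩ := hF' 0 hd
  set e := hFc.contDiffAt.toOpenPartialHomeomorph F he₀ (by simp) with he
  have hcoe : ∀ y, e y = F y := fun y => by
    rw [he, ContDiffAt.toOpenPartialHomeomorph_coe]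
  have hsrc : (0 : X × ℝ) ∈ e.source := ContDiffAt.mem_toOpenPartialHomeomorph_source _ _ _
  have hF0 : F 0 = 0 := by ext <;> simp [hF, h0]
  have htgt : (0 : X × ℝ) ∈ e.target := by
    have h1 := e.map_source hsrc
    rwa [hcoe, hF0] at h1
  have hs0 : e.symm 0 = 0 := by
    have h1 := e.left_inv hsrc
    rwa [hcoe, hF0] at h1
  have hN : IsOpen {y : X × ℝ | fderiv ℝ G y (0, 1) < 0} :=
    isOpen_lt ((hG.continuous_fderiv (by simp)).clm_apply continuous_const) continuous_const
  have hO := e.symm.isOpen_inter_preimage hN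
  refine ⟨fun x => (e.symm (x, 0)).2,
    (fun x : X => ((x, 0) : X × ℝ)) ⁻¹' (e.symm.source ∩ e.symm ⁻¹' {y | fderiv ℝ G y (0, 1) < 0}),
    hO.preimage (by fun_prop), ⟨htgt, ?_⟩, ?_, ?_, ?_⟩
  · change fderiv ℝ G (e.symm 0) (0, 1) < 0
    rwa [hs0]
  · rintro x ⟨hx1, hx2⟩
    obtain ⟨e₁, he₁⟩ := hF' _ hx2
    have h1 : ContDiffAt ℝ (⊤ : ℕ∞) e.symm (x, 0) := by
      refine e.contDiffAt_symm (f₀' := e₁) hx1 ?_ ?_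
      · exact he₁.congr_of_eventuallyEq (Eventually.of_forall hcoe)
      · exact hFc.contDiffAt.congr_of_eventuallyEq (Eventually.of_forall hcoe)
    exact contDiffAt_snd.comp x (h1.comp x (contDiffAt_id.prodMk contDiffAt_const))
  · change (e.symm 0).2 = 0
    rw [hs0]
    rfl
  · rintro x ⟨hx1, -⟩
    have h1 : F (e.symm (x, 0)) = (x, 0) := by rw [← hcoe]; exact e.right_inv hx1
    have h2 : (e.symm (x, 0)).1 = x := congrArg Prod.fst h1
    have h3 : G (e.symm (x, 0)) = 0 := congrArg Prod.snd h1
    have h4 : ((x, (e.symm (x, 0)).2) : X × ℝ) = e.symm (x, 0) := Prod.ext h2.symm rfl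
    rwa [← h4] at h3

theorem exists_contDiff_graph {G : X × ℝ → ℝ} (hG : ContDiff ℝ (⊤ : ℕ∞) G) (h0 : G 0 = 0)
    (hd : fderiv ℝ G 0 (0, 1) < 0) :
    ∃ (k : X → ℝ) (r : ℝ), 0 < r ∧ ContDiff ℝ (⊤ : ℕ∞) k ∧ k 0 = 0 ∧ (∀ x, |k x| ≤ 1 / 4) ∧
      ∀ x t, ‖x‖ < r → |t| < r → (G (x, t) < 0 ↔ k x < t) ∧ (G (x, t) = 0 ↔ t = k x) := by
  obtain ⟨k, W, hW, hW0, hk, hk0, hkG⟩ := exists_contDiff_implicit hG h0 hd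
  have hdG : Differentiable ℝ G := hG.differentiable (by simp)
  have hN : {y : X × ℝ | fderiv ℝ G y (0, 1) < 0} ∈ 𝓝 (0 : X × ℝ) :=
    (isOpen_lt ((hG.continuous_fderiv (by simp)).clm_apply continuous_const)
      continuous_const).mem_nhds hd
  obtain ⟨r₁, hr₁, hball⟩ := Metric.mem_nhds_iff.1 hN
  have hneg : ∀ x t, ‖x‖ < r₁ → |t| < r₁ → fderiv ℝ G (x, t) (0, 1) < 0 := by
    intro x t hx ht
    exact hball (by simpa [Prod.norm_def] using ⟨hx, ht⟩)
  have hanti : ∀ x, ‖x‖ < r₁ → StrictAntiOn (fun t => G (x, t)) (Ioo (-r₁) r₁) := by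
    intro x hx
    have hder : ∀ t, HasDerivAt (fun t => G (x, t)) (fderiv ℝ G (x, t) (0, 1)) t := fun t =>
      (hdG (x, t)).hasFDerivAt.comp_hasDerivAt t
        ((hasDerivAt_const t x).prodMk (hasDerivAt_id t))
    refine strictAntiOn_of_deriv_neg (convex_Ioo _ _)
      (fun t _ => (hder t).continuousAt.continuousWithinAt) fun t ht => ?_
    rw [interior_Ioo] at ht
    rw [(hder t).deriv]
    exact hneg x t hx (abs_lt.2 ht)
  have hev : ∀ᶠ x in 𝓝 (0 : X), x ∈ W ∧ |k x| < min r₁ (1 / 4) := by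
    refine Eventually.and (hW.mem_nhds hW0) ?_
    have h1 : Tendsto (fun x => |k x|) (𝓝 0) (𝓝 0) := by
      have h2 := (hk 0 hW0).continuousAt.abs.tendsto
      simpa [hk0] using h2
    exact h1.eventually_lt_const (by positivity)
  obtain ⟨r₂, hr₂, hball₂⟩ := Metric.nhds_basis_closedBall.eventually_iff.1 hev
  let φ : ContDiffBump (0 : X) := ⟨r₂ / 2, r₂, by positivity, by linarith⟩
  have hφs : tsupport φ = closedBall 0 r₂ := φ.tsupport_eq
  refine ⟨fun x => φ x * k x, min r₁ (r₂ / 2), by positivity, ?_, by simp [hk0], ?_, ?_⟩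
  · refine contDiff_iff_contDiffAt.2 fun x => ?_
    by_cases hx : x ∈ closedBall (0 : X) r₂
    · exact φ.contDiff.contDiffAt.mul (hk x (hball₂ hx).1)
    · refine contDiffAt_const (c := (0 : ℝ)) |>.congr_of_eventuallyEq ?_
      filter_upwards [isClosed_closedBall.isOpen_compl.mem_nhds hx] with z hz
      rw [← hφs] at hz
      rw [image_eq_zero_of_notMem_tsupport hz, zero_mul]
  · intro x
    rw [abs_mul, abs_of_nonneg φ.nonneg]
    by_cases hx : x ∈ closedBall (0 : X) r₂
    · exact (mul_le_of_le_one_left (abs_nonneg _) φ.le_one).trans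
        (((hball₂ hx).2.le).trans (min_le_right _ _))
    · rw [← hφs] at hx
      rw [image_eq_zero_of_notMem_tsupport hx, zero_mul]
      norm_num
  · intro x t hx ht
    have hx1 : ‖x‖ < r₁ := hx.trans_le (min_le_left _ _)
    have hx2 : ‖x‖ ≤ r₂ / 2 := (hx.trans_le (min_le_right _ _)).le
    have hφ1 : φ x = 1 := φ.one_of_mem_closedBall (by simpa using hx2)
    have hxm := hball₂ (show x ∈ closedBall (0 : X) r₂ by
      rw [mem_closedBall_zero_iff]
      linarith)
    have ht' : t ∈ Ioo (-r₁) r₁ := abs_lt.1 (ht.trans_le (min_le_left _ _))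
    have hk' : k x ∈ Ioo (-r₁) r₁ := abs_lt.1 (hxm.2.trans_le (min_le_left _ _))
    simp only [hφ1, one_mul]
    rw [← hkG x hxm.1]
    exact ⟨(hanti x hx1).lt_iff_gt ht' hk', ((hanti x hx1).injOn.eq_iff ht' hk')⟩

theorem exists_frontier_graph {E : Type*} [NormedAddCommGroup E] [NormedSpace ℝ E] {Ω U : Set E}
    {g : E → ℝ} {p : E} (A : (X × ℝ) ≃L[ℝ] E) (hU : IsOpen U) (hp : p ∈ U)
    (hpf : p ∈ frontier Ω) (hg : ContDiff ℝ (⊤ : ℕ∞) g) (hΩ : Ω ∩ U = {y | g y < 0} ∩ U)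
    (hfr : frontier Ω ∩ U = {y | g y = 0} ∩ U) (hA : fderiv ℝ g p (A (0, 1)) < 0) :
    ∃ (k : X → ℝ) (r : ℝ), 0 < r ∧ ContDiff ℝ (⊤ : ℕ∞) k ∧ k 0 = 0 ∧ (∀ x, |k x| ≤ 1 / 4) ∧
      ∀ x t, ‖x‖ < r → |t| < r →
        p + A (x, t) ∈ U ∧ (p + A (x, t) ∈ Ω ↔ k x < t) ∧
          (p + A (x, t) ∈ frontier Ω ↔ t = k x) := by
  have hgp : g p = 0 := (hfr.subset ⟨hpf, hp⟩).1
  have hAc : ContDiff ℝ (⊤ : ℕ∞) fun y : X × ℝ => p + A y := contDiff_const.add A.contDiff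
  obtain ⟨k, r, hr, hk, hk0, hk4, hkr⟩ := exists_contDiff_graph
    (G := fun y : X × ℝ => g (p + A y)) (hg.comp hAc) (by simp [hgp]) (by
      have h1 : HasFDerivAt (fun y : X × ℝ => p + A y) (A : (X × ℝ) →L[ℝ] E) 0 :=
        A.hasFDerivAt.const_add p
      have h2 : HasFDerivAt g (fderiv ℝ g p) (p + A 0) := by
        rw [map_zero, add_zero]
        exact (hg.differentiable (by simp) p).hasFDerivAt
      have h3 : HasFDerivAt (fun y : X × ℝ => g (p + A y)) _ 0 := h2.comp (0 : X × ℝ) h1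
      rw [h3.fderiv]
      exact hA)
  have hev : ∀ᶠ y in 𝓝 (0 : X × ℝ), p + A y ∈ U :=
    hAc.continuous.continuousAt.eventually_mem (by simpa using hU.mem_nhds hp)
  obtain ⟨r', hr', hball⟩ := Metric.eventually_nhds_iff_ball.1 hev
  refine ⟨k, min r r', by positivity, hk, hk0, hk4, fun x t hx ht => ?_⟩
  have hmem : p + A (x, t) ∈ U := hball _ (by
    simpa [Prod.norm_def] using ⟨hx.trans_le (min_le_right _ _), ht.trans_le (min_le_right _ _)⟩)
  obtain ⟨h1, h2⟩ := hkr x t (hx.trans_le (min_le_left _ _)) (ht.trans_le (min_le_left _ _))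
  refine ⟨hmem, ?_, ?_⟩
  · rw [← h1]
    have h3 := Set.ext_iff.1 hΩ (p + A (x, t))
    simpa [hmem] using h3
  · rw [← h2]
    have h3 := Set.ext_iff.1 hfr (p + A (x, t))
    simpa [hmem] using h3

end LocalGraph

section Straightening

variable {X : Type*} [NormedAddCommGroup X] [InnerProductSpace ℝ X] {E : Type*}
  [NormedAddCommGroup E] [NormedSpace ℝ E]

theorem exists_isTubeChart {Ω : Set E} (hΩ : IsOpen Ω) {p : E} (A : (X × ℝ) ≃L[ℝ] E)
    {k₁ k₂ : X → ℝ} {r : ℝ} (hr : 0 < r) (hk₁ : ContDiff ℝ (⊤ : ℕ∞) k₁)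
    (hk₂ : ContDiff ℝ (⊤ : ℕ∞) k₂) (hk₁0 : k₁ 0 = 0) (hk₂0 : k₂ 0 = 0)
    (hk₁4 : ∀ x, |k₁ x| ≤ 1 / 4) (hk₂4 : ∀ x, |k₂ x| ≤ 1 / 4)
    (h₁ : ∀ x t, ‖x‖ < r → |t| < r → (p + A (x, t) ∈ Ω ↔ k₁ x < t) ∧
      (p + A (x, t) ∈ frontier Ω ↔ t = k₁ x))
    (h₂ : ∀ x t, ‖x‖ < r → |t| < r → (p + A (x, 1 - t) ∈ Ω ↔ k₂ x < t) ∧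
      (p + A (x, 1 - t) ∈ frontier Ω ↔ t = k₂ x))
    (hseg : ∀ t ∈ Ioo (0 : ℝ) 1, p + A (0, t) ∈ Ω) :
    ∃ (Θ : X × ℝ → E) (Φ : E → X × ℝ) (a : ℝ), IsTubeChart Ω Θ Φ a ∧
      ∀ t, Θ (0, t) = p + A (0, t) := by
  set r₀ : ℝ := min r (1 / 4) with hr₀
  have hr₀0 : 0 < r₀ := by positivity
  have hr₀r : r₀ ≤ r := min_le_left _ _
  have hr₀4 : r₀ ≤ 1 / 4 := min_le_right _ _
  have hmid : ∀ᶠ x in 𝓝 (0 : X), ∀ t ∈ Icc (r₀ / 2) (1 - r₀ / 2), p + A (x, t) ∈ Ω := by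
    refine isCompact_Icc.eventually_forall_of_forall_eventually fun t ht => ?_
    have hcont : Continuous fun y : X × ℝ => p + A (y.1, y.2) :=
      continuous_const.add A.continuous
    exact hcont.continuousAt.eventually_mem
      (hΩ.mem_nhds (hseg t ⟨by linarith [ht.1], by linarith [ht.2]⟩))
  have hsmall : ∀ k : X → ℝ, ContDiff ℝ (⊤ : ℕ∞) k → k 0 = 0 →
      ∀ᶠ x in 𝓝 (0 : X), |k x| < r₀ / 2 := by
    intro k hk hk0
    have h := hk.continuous.abs.tendsto 0
    rw [hk0, abs_zero] at h
    exact h.eventually_lt_const (by positivity)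
  obtain ⟨R, hR, hball⟩ := Metric.eventually_nhds_iff_ball.1
    (((hsmall k₁ hk₁ hk₁0).and (hsmall k₂ hk₂ hk₂0)).and (hmid.and (ball_mem_nhds 0 hr₀0)))
  have core : ∀ x t, ‖x‖ < R → -r₀ < t → t < 1 + r₀ →
      (p + A (x, t) ∈ Ω ↔ k₁ x < t ∧ t < 1 - k₂ x) ∧
      (p + A (x, t) ∈ frontier Ω ↔ t = k₁ x ∨ t = 1 - k₂ x) := by
    intro x t hx ht0 ht1
    obtain ⟨⟨hb1, hb2⟩, hb3, hb4⟩ := hball x (by simpa using hx)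
    have hxr : ‖x‖ < r := (mem_ball_zero_iff.1 hb4).trans_le hr₀r
    rw [abs_lt] at hb1 hb2
    by_cases c1 : t < r₀
    · obtain ⟨e1, e2⟩ := h₁ x t hxr (abs_lt.2 ⟨by linarith, by linarith⟩)
      have h3 : t < 1 - k₂ x := by linarith
      rw [e1, e2]
      exact ⟨(and_iff_left h3).symm, (or_iff_left h3.ne).symm⟩
    by_cases c2 : 1 - r₀ < t
    · obtain ⟨e1, e2⟩ := h₂ x (1 - t) hxr (abs_lt.2 ⟨by linarith, by linarith⟩)
      have h3 : k₁ x < t := by linarith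
      rw [sub_sub_cancel] at e1 e2
      rw [e1, e2, and_iff_right h3, or_iff_right h3.ne']
      refine ⟨?_, ?_⟩ <;> constructor <;> intro h <;> linarith
    · have hin := hb3 t ⟨by linarith, by linarith⟩
      have h3 : k₁ x < t := by linarith
      have h4 : t < 1 - k₂ x := by linarith
      refine ⟨iff_of_true hin ⟨h3, h4⟩, iff_of_false (fun h => ?_) ?_⟩
      · rw [hΩ.frontier_eq] at h
        exact h.2 hin
      · rintro (h | h) <;> linarith
  have hden : ∀ x, 1 / 2 ≤ 1 - k₁ x - k₂ x ∧ 1 - k₁ x - k₂ x ≤ 3 / 2 := fun x => by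
    have e1 := abs_le.1 (hk₁4 x)
    have e2 := abs_le.1 (hk₂4 x)
    constructor <;> linarith
  set ρ : ℝ := R / 2 with hρ
  have hρ0 : 0 < ρ := by positivity
  set T : X × ℝ → ℝ := fun y => k₁ (ρ • y.1) + y.2 * (1 - k₁ (ρ • y.1) - k₂ (ρ • y.1)) with hT
  have hsc : ContDiff ℝ (⊤ : ℕ∞) fun y : X × ℝ => ρ • y.1 := contDiff_const.smul contDiff_fst
  have hTk : ∀ y : X × ℝ, ‖y.1‖ < 2 → -(r₀ / 3) < y.2 → y.2 < 1 + r₀ / 3 →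
      ‖ρ • y.1‖ < R ∧ -r₀ < T y ∧ T y < 1 + r₀ ∧ (k₁ (ρ • y.1) < T y ↔ 0 < y.2) ∧
        (T y < 1 - k₂ (ρ • y.1) ↔ y.2 < 1) ∧ (T y = k₁ (ρ • y.1) ↔ y.2 = 0) ∧
          (T y = 1 - k₂ (ρ • y.1) ↔ y.2 = 1) := by
    intro y h1 h2 h3
    have hn : ‖ρ • y.1‖ < R := by
      rw [norm_smul, Real.norm_of_nonneg hρ0.le]
      nlinarith
    obtain ⟨⟨hb1, hb2⟩, -, -⟩ := hball (ρ • y.1) (by simpa using hn)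
    obtain ⟨hd1, hd2⟩ := hden (ρ • y.1)
    rw [abs_lt] at hb1 hb2
    simp only [hT]
    set u := k₁ (ρ • y.1)
    set v := k₂ (ρ • y.1)
    set c := 1 - u - v with hc
    have hc0 : 0 < c := by linarith
    have e1 : u + y.2 * c - (1 - v) = (y.2 - 1) * c := by rw [hc]; ring
    refine ⟨hn, ?_, ?_, ?_, ?_, ?_, ?_⟩
    · nlinarith
    · nlinarith
    · rw [lt_add_iff_pos_right]
      exact ⟨fun h => pos_of_mul_pos_left h hc0.le, fun h => mul_pos h hc0⟩
    · rw [← sub_neg, e1]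
      constructor
      · intro h
        by_contra! h'
        nlinarith
      · intro h
        nlinarith
    · simp [hc0.ne']
    · rw [← sub_eq_zero, e1, mul_eq_zero, or_iff_left hc0.ne', sub_eq_zero]
  refine ⟨fun y => p + A (ρ • y.1, T y),
    fun z => (ρ⁻¹ • (A.symm (z - p)).1, ((A.symm (z - p)).2 - k₁ (A.symm (z - p)).1) /
      (1 - k₁ (A.symm (z - p)).1 - k₂ (A.symm (z - p)).1)), r₀ / 3,
    ⟨?_, ?_, ?_, ?_, by positivity, ?_, ?_⟩, ?_⟩
  · refine contDiff_const.add (A.contDiff.comp (hsc.prodMk ?_))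
    exact (hk₁.comp hsc).add (contDiff_snd.mul
      ((contDiff_const.sub (hk₁.comp hsc)).sub (hk₂.comp hsc)))
  · have hA : ContDiff ℝ (⊤ : ℕ∞) fun z => A.symm (z - p) :=
      A.symm.contDiff.comp (contDiff_id.sub contDiff_const)
    have hA1 := contDiff_fst.comp hA
    refine (contDiff_const.smul hA1).prodMk (((contDiff_snd.comp hA).sub (hk₁.comp hA1)).div
      ((contDiff_const.sub (hk₁.comp hA1)).sub (hk₂.comp hA1)) fun z => ?_)
    exact ne_of_gt (by linarith [(hden (A.symm (z - p)).1).1])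
  · intro y
    have hd := (hden (ρ • y.1)).1
    have hd0 : 1 - k₁ (ρ • y.1) - k₂ (ρ • y.1) ≠ 0 := by linarith
    simp only [add_sub_cancel_left, ContinuousLinearEquiv.symm_apply_apply]
    refine Prod.ext ?_ ?_
    · simp [smul_smul, hρ0.ne']
    · simp [hT, hd0]
  · intro z
    have hd := (hden (A.symm (z - p)).1).1
    have hd0 : 1 - k₁ (A.symm (z - p)).1 - k₂ (A.symm (z - p)).1 ≠ 0 := by linarith
    simp only [hT, smul_smul, mul_inv_cancel₀ hρ0.ne', one_smul, div_mul_cancel₀ _ hd0,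
      add_sub_cancel, Prod.mk.eta, ContinuousLinearEquiv.apply_symm_apply]
  · intro y hy1 hy2 hy3
    obtain ⟨e1, e2, e3, e4, e5, -, -⟩ := hTk y hy1 hy2 hy3
    rw [(core _ _ e1 e2 e3).1, e4, e5]
  · intro y hy1 hy2 hy3
    obtain ⟨e1, e2, e3, -, -, e4, e5⟩ := hTk y hy1 hy2 hy3
    rw [(core _ _ e1 e2 e3).2, e4, e5]
  · intro t
    simp [hT, hk₁0, hk₂0]

end Straightening

section Transversality

variable {E : Type*} [NormedAddCommGroup E] [InnerProductSpace ℝ E]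

theorem fderiv_neg_of_nonpos_on_ball {g : E → ℝ} {p q x : E} {r : ℝ}
    (hg : DifferentiableAt ℝ g p) (hne : fderiv ℝ g p ≠ 0) (hgp : g p = 0)
    (hball : ∀ᶠ y in 𝓝 p, y ∈ ball x r → g y ≤ 0) (hp : dist x p = r) (hq : dist x q = r)
    (hpq : p ≠ q) : fderiv ℝ g p (q - p) < 0 := by
  have hle : ∀ u : E, 0 < inner ℝ (x - p) u → fderiv ℝ g p u ≤ 0 := by
    intro u hu
    have hcurve : HasDerivAt (fun t : ℝ => p + t • u) u 0 := by
      simpa using ((hasDerivAt_id (0 : ℝ)).smul_const u).const_add p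
    have hd : HasDerivAt (fun t : ℝ => g (p + t • u)) (fderiv ℝ g p u) 0 := by
      have h1 : HasFDerivAt g (fderiv ℝ g p) (p + (0 : ℝ) • u) := by
        simpa using hg.hasFDerivAt
      exact h1.comp_hasDerivAt (0 : ℝ) hcurve
    refine le_of_tendsto hd.tendsto_slope_zero_right ?_
    have h2 : ∀ᶠ t in 𝓝 (0 : ℝ), p + t • u ∈ ball x r → g (p + t • u) ≤ 0 := by
      have h3 := hcurve.continuousAt.tendsto
      simp only [zero_smul, add_zero] at h3
      exact h3.eventually hball
    have h4 : ∀ᶠ t in 𝓝 (0 : ℝ), t * ‖u‖ ^ 2 < 2 * inner ℝ (x - p) u := by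
      have h5 : Continuous fun t : ℝ => t * ‖u‖ ^ 2 := by fun_prop
      refine (h5.tendsto 0).eventually_lt_const ?_
      simpa using hu
    filter_upwards [nhdsWithin_le_nhds h2, nhdsWithin_le_nhds h4, self_mem_nhdsWithin]
      with t ht1 ht2 ht3
    have ht0 : 0 < t := ht3
    have hmem : p + t • u ∈ ball x r := by
      rw [mem_ball, dist_eq_norm, show p + t • u - x = t • u - (x - p) by abel]
      have h6 : ‖t • u - (x - p)‖ ^ 2 < r ^ 2 := by
        rw [norm_sub_sq_real, norm_smul, inner_smul_left, real_inner_comm, ← dist_eq_norm x p, hp,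
          Real.norm_of_nonneg ht0.le]
        simp only [conj_trivial]
        nlinarith
      exact lt_of_pow_lt_pow_left₀ 2 (hp ▸ dist_nonneg) h6
    simp only [zero_add, zero_smul, add_zero, hgp, sub_zero, smul_eq_mul]
    exact mul_nonpos_of_nonneg_of_nonpos (inv_nonneg.2 ht0.le) (ht1 hmem)
  have hpos : 0 < inner ℝ (x - p) (q - p) := by
    have h1 : ‖(x - p) - (q - p)‖ = ‖x - p‖ := by
      rw [sub_sub_sub_cancel_right, ← dist_eq_norm, ← dist_eq_norm, hp, hq]
    have h2 := norm_sub_sq_real (x - p) (q - p)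
    rw [h1] at h2
    have h3 : 0 < ‖q - p‖ := norm_pos_iff.2 (sub_ne_zero.2 hpq.symm)
    nlinarith
  refine lt_of_le_of_ne (hle _ hpos) fun h0 => ?_
  obtain ⟨v, hv⟩ : ∃ v, fderiv ℝ g p v ≠ 0 := by
    by_contra! hall
    exact hne (ContinuousLinearMap.ext hall)
  obtain ⟨z, hz⟩ : ∃ z, 0 < fderiv ℝ g p z := by
    rcases hv.lt_or_gt with h | h
    · exact ⟨-v, by simpa using h⟩
    · exact ⟨v, h⟩
  have hev : ∀ᶠ t in 𝓝[>] (0 : ℝ), 0 < inner ℝ (x - p) (q - p + t • z) := by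
    refine nhdsWithin_le_nhds ?_
    have h1 : Continuous fun t : ℝ => inner ℝ (x - p) (q - p + t • z) := by fun_prop
    exact (h1.tendsto 0).eventually_const_lt (by simpa using hpos)
  obtain ⟨t, ht, ht0⟩ := (hev.and self_mem_nhdsWithin).exists
  have h1 := hle _ ht
  rw [map_add, h0, zero_add, map_smul, smul_eq_mul] at h1
  have h2 : 0 < t * fderiv ℝ g p z := mul_pos ht0 hz
  linarith

theorem exists_ball_touching {Ω A B : Set E} (hΩ : IsOpen Ω) (hc : IsPreconnected Ω)
    (hf : IsCompact (frontier Ω)) (hA : IsClosed A) (hB : IsClosed B) (hA0 : A.Nonempty)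
    (hB0 : B.Nonempty) (hAB : Disjoint A B) (hU : A ∪ B = frontier Ω) :
    ∃ (x : E) (r : ℝ) (p q : E), p ∈ A ∧ q ∈ B ∧ dist x p = r ∧ dist x q = r ∧
      ball x r ⊆ Ω := by
  have hAf : A ⊆ frontier Ω := hU ▸ subset_union_left
  have hBf : B ⊆ frontier Ω := hU ▸ subset_union_right
  have hAc : IsCompact A := hf.of_isClosed_subset hA hAf
  have hBc : IsCompact B := hf.of_isClosed_subset hB hBf
  have hcont : Continuous fun y => infDist y A - infDist y B :=
    (continuous_infDist_pt A).sub (continuous_infDist_pt B)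
  obtain ⟨a, ha⟩ := hA0
  obtain ⟨b, hb⟩ := hB0
  have hapos : 0 < infDist a B :=
    (hB.notMem_iff_infDist_pos ⟨b, hb⟩).1 (disjoint_left.1 hAB ha)
  have hbpos : 0 < infDist b A :=
    (hA.notMem_iff_infDist_pos ⟨a, ha⟩).1 (disjoint_right.1 hAB hb)
  obtain ⟨a', ha'⟩ : ∃ y ∈ Ω, infDist y A - infDist y B ≤ 0 := by
    obtain ⟨y, hy, hyΩ⟩ := mem_closure_iff.1 (frontier_subset_closure (hAf ha))
      {y | infDist y A - infDist y B < 0} (isOpen_lt hcont continuous_const)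
      (by simp [infDist_zero_of_mem ha, hapos])
    exact ⟨y, hyΩ, le_of_lt hy⟩
  obtain ⟨b', hb'⟩ : ∃ y ∈ Ω, 0 ≤ infDist y A - infDist y B := by
    obtain ⟨y, hy, hyΩ⟩ := mem_closure_iff.1 (frontier_subset_closure (hBf hb))
      {y | 0 < infDist y A - infDist y B} (isOpen_lt continuous_const hcont)
      (by simp [infDist_zero_of_mem hb, hbpos])
    exact ⟨y, hyΩ, le_of_lt hy⟩
  obtain ⟨x, hxΩ, hx⟩ := hc.intermediate_value ha'.1 hb'.1 hcont.continuousOn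
    ⟨ha'.2, hb'.2⟩
  have hxe : infDist x A = infDist x B := sub_eq_zero.1 hx
  obtain ⟨p, hp, hxp⟩ := hAc.exists_infDist_eq_dist ⟨a, ha⟩ x
  obtain ⟨q, hq, hxq⟩ := hBc.exists_infDist_eq_dist ⟨b, hb⟩ x
  refine ⟨x, infDist x A, p, q, hp, hq, hxp.symm, by rw [hxe, hxq], ?_⟩
  have hr : 0 < infDist x A := by
    refine (hA.notMem_iff_infDist_pos ⟨a, ha⟩).1 fun hxA => ?_
    have h1 := hAf hxA
    rw [hΩ.frontier_eq] at h1
    exact h1.2 hxΩ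
  by_contra hsub
  obtain ⟨y, hy, hyΩ⟩ := not_subset.1 hsub
  have h1 : (ball x (infDist x A) ∩ frontier Ω).Nonempty := by
    by_contra hem
    have hcov : ∀ z ∈ ball x (infDist x A), z ∉ Ω → z ∉ closure Ω := fun z hz hzΩ hzc =>
      hem ⟨z, hz, by rw [hΩ.frontier_eq]; exact ⟨hzc, hzΩ⟩⟩
    obtain ⟨z, -, hz1, hz2⟩ := (convex_ball x (infDist x A)).isPreconnected Ω (closure Ω)ᶜ hΩ
      isClosed_closure.isOpen_compl (fun z hz => or_iff_not_imp_left.2 (hcov z hz))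
      ⟨x, mem_ball_self hr, hxΩ⟩ ⟨y, hy, hcov y hy hyΩ⟩
    exact hz2 (subset_closure hz1)
  obtain ⟨z, hz, hzf⟩ := h1
  rw [mem_ball, dist_comm] at hz
  rw [← hU] at hzf
  rcases hzf with h | h
  · exact absurd hz (not_lt.2 (infDist_le_dist_of_mem h))
  · exact absurd hz (not_lt.2 (hxe ▸ infDist_le_dist_of_mem h))

end Transversality

section ExistsTube

theorem HasSmoothBoundary.exists_tubeChart {m : ℕ} {Ω : Set (EuclideanSpace ℝ (Fin (m + 1)))}
    (hs : HasSmoothBoundary Ω) (hΩ : IsOpen Ω) {x p q : EuclideanSpace ℝ (Fin (m + 1))} {r : ℝ}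
    (hp : p ∈ frontier Ω) (hq : q ∈ frontier Ω) (hpq : p ≠ q) (hxp : dist x p = r)
    (hxq : dist x q = r) (hball : ball x r ⊆ Ω) :
    ∃ (Θ : EuclideanSpace ℝ (Fin m) × ℝ → EuclideanSpace ℝ (Fin (m + 1)))
      (Φ : EuclideanSpace ℝ (Fin (m + 1)) → EuclideanSpace ℝ (Fin m) × ℝ) (a : ℝ),
      IsTubeChart Ω Θ Φ a ∧ Θ (0, 0) = p ∧ Θ (0, 1) = q := by
  have htrans : ∀ p q : EuclideanSpace ℝ (Fin (m + 1)), p ∈ frontier Ω → p ≠ q → dist x p = r →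
      dist x q = r → ∃ U : Set (EuclideanSpace ℝ (Fin (m + 1))), IsOpen U ∧ p ∈ U ∧
        ∃ g : EuclideanSpace ℝ (Fin (m + 1)) → ℝ, ContDiff ℝ (⊤ : ℕ∞) g ∧
          Ω ∩ U = {y | g y < 0} ∩ U ∧ frontier Ω ∩ U = {y | g y = 0} ∩ U ∧
            fderiv ℝ g p (q - p) < 0 := by
    intro p q hp hpq hxp hxq
    obtain ⟨U, hU, hpU, g, hg, hgr, h1, h2⟩ := hs p hp
    refine ⟨U, hU, hpU, g, hg, h1, h2, fderiv_neg_of_nonpos_on_ball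
      (hg.differentiable (by simp) p) (fun h0 => hgr p hpU ?_) (h2.subset ⟨hp, hpU⟩).1 ?_
      hxp hxq hpq⟩
    · simp [gradient, h0]
    · filter_upwards [hU.mem_nhds hpU] with y hy hyb
      exact le_of_lt (h1.subset ⟨hball hyb, hy⟩).1
  obtain ⟨U₁, hU₁, hpU₁, g₁, hg₁, h₁, hf₁, hd₁⟩ := htrans p q hp hpq hxp hxq
  obtain ⟨U₂, hU₂, hqU₂, g₂, hg₂, h₂, hf₂, hd₂⟩ := htrans q p hq hpq.symm hxq hxp
  obtain ⟨A, hA⟩ : ∃ A : (EuclideanSpace ℝ (Fin m) × ℝ) ≃L[ℝ] EuclideanSpace ℝ (Fin (m + 1)),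
      A (0, 1) = q - p := by
    have A₀ : (EuclideanSpace ℝ (Fin m) × ℝ) ≃L[ℝ] EuclideanSpace ℝ (Fin (m + 1)) :=
      ContinuousLinearEquiv.ofFinrankEq (by simp)
    obtain ⟨B, hB⟩ := SeparatingDual.exists_continuousLinearEquiv_apply_eq (R := ℝ)
      (x := A₀ (0, 1)) (y := q - p) (by simp) (sub_ne_zero.2 hpq.symm)
    exact ⟨A₀.trans B, hB⟩
  let A' := ((ContinuousLinearEquiv.refl ℝ (EuclideanSpace ℝ (Fin m))).prodCongr
    (ContinuousLinearEquiv.neg ℝ)).trans A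
  have hA' : ∀ x t, q + A' (x, t) = p + A (x, 1 - t) := by
    intro x t
    have h1 : A (x, 1 - t) = A (0, 1) + A (x, -t) := by
      rw [← map_add]
      congr 1
      ext <;> simp [sub_eq_add_neg]
    rw [h1, hA]
    simp only [A', ContinuousLinearEquiv.trans_apply, ContinuousLinearEquiv.prodCongr_apply,
      ContinuousLinearEquiv.refl_apply, ContinuousLinearEquiv.neg_apply]
    abel
  obtain ⟨k₁, r₁, hr₁, hk₁, hk₁0, hk₁4, hkr₁⟩ :=
    exists_frontier_graph A hU₁ hpU₁ hp hg₁ h₁ hf₁ (by rwa [hA])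
  obtain ⟨k₂, r₂, hr₂, hk₂, hk₂0, hk₂4, hkr₂⟩ :=
    exists_frontier_graph A' hU₂ hqU₂ hq hg₂ h₂ hf₂ (by
      have h3 : A' (0, 1) = p - q := by
        have := hA' 0 1
        rw [sub_self, show ((0 : EuclideanSpace ℝ (Fin m)), (0 : ℝ)) = 0 from rfl, map_zero,
          add_zero] at this
        rw [← this]
        abel
      rwa [h3])
  have hseg : ∀ t ∈ Ioo (0 : ℝ) 1, p + A (0, t) ∈ Ω := by
    intro t ht
    refine hball (openSegment_subset_ball_of_ne (x := p) (y := q) ?_ ?_ hpq ?_)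
    · rw [mem_closedBall, dist_comm, hxp]
    · rw [mem_closedBall, dist_comm, hxq]
    · rw [openSegment_eq_image']
      refine ⟨t, ht, ?_⟩
      have h3 : ((0 : EuclideanSpace ℝ (Fin m)), t) = t • (0, 1) := by ext <;> simp
      simp only [h3, map_smul, hA]
  obtain ⟨Θ, Φ, a, hc, hΘ⟩ := exists_isTubeChart hΩ A (r := min r₁ r₂) (by positivity) hk₁ hk₂
    hk₁0 hk₂0 hk₁4 hk₂4
    (fun x t hx ht => (hkr₁ x t (hx.trans_le (min_le_left _ _)) (ht.trans_le (min_le_left _ _))).2)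
    (fun x t hx ht => by
      rw [← hA']
      exact (hkr₂ x t (hx.trans_le (min_le_right _ _)) (ht.trans_le (min_le_right _ _))).2)
    hseg
  refine ⟨Θ, Φ, a, hc, ?_, ?_⟩
  · rw [hΘ, show ((0 : EuclideanSpace ℝ (Fin m)), (0 : ℝ)) = 0 from rfl, map_zero, add_zero]
  · rw [hΘ, hA, add_sub_cancel]

end ExistsTube

section ClopenParts

variable {α : Type*} [TopologicalSpace α]

/-- The relatively clopen subsets of a set `X`, when `X` is closed. -/
def clopenParts (X : Set α) : Set (Set α) :=
  {A | A ⊆ X ∧ IsClosed A ∧ IsClosed (X \ A)}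

theorem sdiff_mem_clopenParts {X A : Set α} (hA : A ∈ clopenParts X) : X \ A ∈ clopenParts X :=
  ⟨sdiff_subset, hA.2.2, by rw [sdiff_sdiff_cancel_left hA.1]; exact hA.2.1⟩

theorem IsPreconnected.subset_or_of_mem_clopenParts {X Y A : Set α} (hY : IsPreconnected Y)
    (hYX : Y ⊆ X) (hA : A ∈ clopenParts X) : Y ⊆ A ∨ Y ⊆ X \ A := by
  refine isPreconnected_iff_subset_of_disjoint_closed.1 hY _ _ hA.2.1 hA.2.2 ?_ ?_
  · rw [union_sdiff_cancel hA.1]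
    exact hYX
  · rw [inter_sdiff_self, inter_empty]

theorem finite_clopenParts {X : Set α} (hX : IsCompact X)
    (hloc : ∀ x ∈ X, ∃ U, IsOpen U ∧ x ∈ U ∧ IsPreconnected (X ∩ U)) :
    (clopenParts X).Finite := by
  classical
  choose! U hU hxU hpre using hloc
  obtain ⟨t, htX, ht⟩ := hX.elim_nhds_subcover U fun x hx => (hU x hx).mem_nhds (hxU x hx)
  refine Set.Finite.of_injOn (f := fun A => t.filter fun x => X ∩ U x ⊆ A)
    (t := (t.powerset : Set (Finset α))) (fun A _ => ?_) ?_ (Finset.finite_toSet _)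
  · exact Finset.mem_coe.2 (Finset.mem_powerset.2 (Finset.filter_subset _ _))
  · have key : ∀ A ∈ clopenParts X, ∀ B : Set α, (t.filter fun x => X ∩ U x ⊆ A) =
        (t.filter fun x => X ∩ U x ⊆ B) → A ⊆ B := by
      intro A hA B hAB y hy
      have hyX := hA.1 hy
      obtain ⟨x, hxt, hyx⟩ := mem_iUnion₂.1 (ht hyX)
      have h1 : X ∩ U x ⊆ A := by
        refine ((hpre x (htX x hxt)).subset_or_of_mem_clopenParts
          inter_subset_left hA).resolve_right fun h => (h ⟨hyX, hyx⟩).2 hy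
      have h2 : x ∈ t.filter fun x => X ∩ U x ⊆ A := Finset.mem_filter.2 ⟨hxt, h1⟩
      rw [hAB] at h2
      exact (Finset.mem_filter.1 h2).2 ⟨hyX, hyx⟩
    intro A hA B hB hAB
    exact (key A hA B hAB).antisymm (key B hB A hAB.symm)

theorem ncard_clopenParts_lt {X X' Z K : Set α} (hX : IsClosed X)
    (hfin : (clopenParts X).Finite) (hZ : IsOpen Z) (hK : IsClosed K) (hKZ : K ⊆ Z)
    (heq : X \ K = X' \ K) (hpre : IsPreconnected (X' ∩ Z)) (hne : (X' ∩ Z).Nonempty)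
    {A₀ : Set α} (hA₀ : A₀ ∈ clopenParts X) {p q : α} (hp : p ∈ A₀) (hpZ : p ∈ Z) (hqX : q ∈ X)
    (hq : q ∉ A₀) (hqZ : q ∈ Z) : (clopenParts X').ncard < (clopenParts X).ncard := by
  have heqx : ∀ x, x ∉ K → (x ∈ X ↔ x ∈ X') := by
    intro x hx
    have h1 := Set.ext_iff.1 heq x
    simpa [hx] using h1
  set φ : Set α → Set α := fun A => A \ Z ∪ {x | (x ∈ X ∧ x ∈ Z) ∧ X' ∩ Z ⊆ A} with hφ
  have hdich : ∀ A ∈ clopenParts X', X' ∩ Z ⊆ A ∨ X' ∩ Z ⊆ X' \ A := fun A hA =>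
    hpre.subset_or_of_mem_clopenParts inter_subset_left hA
  obtain ⟨y₀, hy₀⟩ := hne
  have hsub : ∀ A ∈ clopenParts X', φ A ⊆ X := by
    rintro A hA x (hx | hx)
    · exact (heqx x fun h => hx.2 (hKZ h)).2 (hA.1 hx.1)
    · exact hx.1.1
  have hoff : ∀ A ∈ clopenParts X', ∀ x ∉ K, (x ∈ φ A ↔ x ∈ A) := by
    intro A hA x hxK
    by_cases hxZ : x ∈ Z
    · rcases hdich A hA with h | h
      · constructor
        · rintro (hx | hx)
          · exact hx.1
          · exact h ⟨(heqx x hxK).1 hx.1.1, hxZ⟩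
        · exact fun hx => Or.inr ⟨⟨(heqx x hxK).2 (hA.1 hx), hxZ⟩, h⟩
      · constructor
        · rintro (hx | hx)
          · exact hx.1
          · exact absurd (hx.2 hy₀) (h hy₀).2
        · exact fun hx => absurd hx (h ⟨hA.1 hx, hxZ⟩).2
    · constructor
      · rintro (hx | hx)
        · exact hx.1
        · exact absurd hx.1.2 hxZ
      · exact fun hx => Or.inl ⟨hx, hxZ⟩
  have hclosed : ∀ A ∈ clopenParts X', IsClosed (φ A) := by
    intro A hA
    rw [← isOpen_compl_iff, isOpen_iff_mem_nhds]
    intro x hx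
    by_cases hxK : x ∈ K
    · have hxZ := hKZ hxK
      rcases hdich A hA with h | h
      · have hxX : x ∉ X := fun hxX => hx (Or.inr ⟨⟨hxX, hxZ⟩, h⟩)
        exact mem_of_superset (hX.isOpen_compl.mem_nhds hxX)
          (compl_subset_compl.2 (hsub A hA))
      · refine mem_of_superset (hZ.mem_nhds hxZ) fun y hy hyφ => ?_
        rcases hyφ with hy' | hy'
        · exact hy'.2 hy
        · exact (h hy₀).2 (hy'.2 hy₀)
    · have hxA : x ∉ A := fun h => hx ((hoff A hA x hxK).2 h)
      filter_upwards [hK.isOpen_compl.mem_nhds hxK, hA.2.1.isOpen_compl.mem_nhds hxA]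
        with y hyK hyA hyφ
      exact hyA ((hoff A hA y hyK).1 hyφ)
  have hcompl : ∀ A ∈ clopenParts X', X \ φ A = φ (X' \ A) := by
    intro A hA
    have hA' := sdiff_mem_clopenParts hA
    ext x
    by_cases hxK : x ∈ K
    · have hxZ := hKZ hxK
      have h1 : ∀ B, x ∈ φ B ↔ x ∈ X ∧ X' ∩ Z ⊆ B := by
        intro B
        simp [hφ, hxZ]
      rw [Set.mem_sdiff, h1, h1]
      rcases hdich A hA with h | h
      · have h2 : ¬ X' ∩ Z ⊆ X' \ A := fun h' => (h' hy₀).2 (h hy₀)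
        simp [h, h2]
      · have h2 : ¬ X' ∩ Z ⊆ A := fun h' => (h hy₀).2 (h' hy₀)
        simp [h, h2]
    · rw [Set.mem_sdiff, hoff A hA x hxK, hoff _ hA' x hxK, heqx x hxK, Set.mem_sdiff]
  have hmaps : ∀ A ∈ clopenParts X', φ A ∈ clopenParts X := fun A hA =>
    ⟨hsub A hA, hclosed A hA, by
      rw [hcompl A hA]; exact hclosed _ (sdiff_mem_clopenParts hA)⟩
  have hinj : InjOn φ (clopenParts X') := by
    have key : ∀ A ∈ clopenParts X', ∀ B ∈ clopenParts X', φ A = φ B → A ⊆ B := by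
      intro A hA B hB hAB x hx
      by_cases hxZ : x ∈ Z
      · have h1 : X' ∩ Z ⊆ A := (hdich A hA).resolve_right fun h => (h ⟨hA.1 hx, hxZ⟩).2 hx
        have h2 : p ∈ φ B := hAB ▸ Or.inr ⟨⟨hA₀.1 hp, hpZ⟩, h1⟩
        rcases h2 with h2 | h2
        · exact absurd hpZ h2.2
        · exact h2.2 ⟨hA.1 hx, hxZ⟩
      · have hxK : x ∉ K := fun h => hxZ (hKZ h)
        exact (hoff B hB x hxK).1 (hAB ▸ (hoff A hA x hxK).2 hx)
    exact fun A hA B hB hAB => (key A hA B hB hAB).antisymm (key B hB A hA hAB.symm)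
  rw [← hinj.ncard_image]
  refine ncard_lt_ncard ⟨image_subset_iff.2 hmaps, fun h => ?_⟩ hfin
  obtain ⟨A, -, hA⟩ := h hA₀
  rw [← hA] at hp hq
  rcases hp with hp | hp
  · exact hp.2 hpZ
  · exact hq (Or.inr ⟨⟨hqX, hqZ⟩, hp.2⟩)

theorem IsPreconnected.sdiff_of_inter {W K Z : Set α} (hW : IsPreconnected W) (hWo : IsOpen W)
    (hK : IsClosed K) (hZ : IsOpen Z) (hKZ : K ⊆ Z) (hpre : IsPreconnected ((W \ K) ∩ Z)) :
    IsPreconnected (W \ K) := by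
  have hW' : IsOpen (W \ K) := hWo.sdiff hK
  have key : ∀ u v : Set α, IsOpen u → IsOpen v → W \ K ⊆ u ∪ v → (W \ K) ∩ (u ∩ v) = ∅ →
      (W \ K) ∩ Z ⊆ u → W \ K ⊆ u ∨ W \ K ⊆ v := by
    intro u v hu hv huv hdis hsub
    have hsplit := isPreconnected_iff_subset_of_disjoint.1 hW (u ∩ (W \ K) ∪ W ∩ Z) (v ∩ (W \ K))
      ((hu.inter hW').union (hWo.inter hZ)) (hv.inter hW') ?_ ?_
    · rcases hsplit with h | h
      · left
        intro x hx
        rcases h hx.1 with hx' | hx'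
        · exact hx'.1
        · exact hsub ⟨hx, hx'.2⟩
      · exact Or.inr fun x hx => (h hx.1).1
    · intro x hx
      by_cases hxK : x ∈ K
      · exact Or.inl (Or.inr ⟨hx, hKZ hxK⟩)
      · rcases huv ⟨hx, hxK⟩ with h | h
        · exact Or.inl (Or.inl ⟨h, hx, hxK⟩)
        · exact Or.inr ⟨h, hx, hxK⟩
    · rw [eq_empty_iff_forall_notMem] at hdis ⊢
      rintro x ⟨-, hx1 | hx1, hx2⟩
      · exact hdis x ⟨hx2.2, hx1.1, hx2.1⟩
      · exact hdis x ⟨hx2.2, hsub ⟨hx2.2, hx1.2⟩, hx2.1⟩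
  refine isPreconnected_iff_subset_of_disjoint.2 fun u v hu hv huv hdis => ?_
  rcases isPreconnected_iff_subset_of_disjoint.1 hpre u v hu hv
    (inter_subset_left.trans huv) (subset_eq_empty (inter_subset_inter_left _ inter_subset_left)
      hdis) with h | h
  · exact key u v hu hv huv hdis h
  · exact (key v u hv hu (union_comm u v ▸ huv) (inter_comm u v ▸ hdis) h).symm

end ClopenParts

section Domains

variable {m : ℕ} {Ω : Set (EuclideanSpace ℝ (Fin (m + 1)))}

theorem HasSmoothBoundary.exists_isPreconnected_frontier_inter (hs : HasSmoothBoundary Ω)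
    {p : EuclideanSpace ℝ (Fin (m + 1))} (hp : p ∈ frontier Ω) :
    ∃ U, IsOpen U ∧ p ∈ U ∧ IsPreconnected (frontier Ω ∩ U) := by
  obtain ⟨U, hU, hpU, g, hg, hgr, hΩ, hfr⟩ := hs p hp
  obtain ⟨v, hv⟩ : ∃ v, fderiv ℝ g p v < 0 := by
    obtain ⟨v, hv⟩ : ∃ v, fderiv ℝ g p v ≠ 0 := by
      by_contra! hall
      refine hgr p hpU ?_
      have h0 : fderiv ℝ g p = 0 := ContinuousLinearMap.ext hall
      simp [gradient, h0]
    rcases hv.lt_or_gt with h | h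
    · exact ⟨v, h⟩
    · exact ⟨-v, by simpa using h⟩
  have hv0 : v ≠ 0 := by
    rintro rfl
    simp at hv
  obtain ⟨A, hA⟩ : ∃ A : (EuclideanSpace ℝ (Fin m) × ℝ) ≃L[ℝ] EuclideanSpace ℝ (Fin (m + 1)),
      A (0, 1) = v := by
    have A₀ : (EuclideanSpace ℝ (Fin m) × ℝ) ≃L[ℝ] EuclideanSpace ℝ (Fin (m + 1)) :=
      ContinuousLinearEquiv.ofFinrankEq (by simp)
    obtain ⟨B, hB⟩ := SeparatingDual.exists_continuousLinearEquiv_apply_eq (R := ℝ)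
      (x := A₀ (0, 1)) (y := v) (by simp) hv0
    exact ⟨A₀.trans B, hB⟩
  obtain ⟨k, r, hr, hk, hk0, -, hkr⟩ := exists_frontier_graph A hU hpU hp hg hΩ hfr (hA ▸ hv)
  obtain ⟨ρ, hρ, hρk⟩ : ∃ ρ > 0, ∀ x, ‖x‖ < ρ → |k x| < r := by
    have h1 : ∀ᶠ x in 𝓝 (0 : EuclideanSpace ℝ (Fin m)), |k x| < r :=
      (hk.continuous.abs.tendsto 0).eventually_lt_const (by simpa [hk0] using hr)
    obtain ⟨ρ, hρ, h2⟩ := Metric.eventually_nhds_iff_ball.1 h1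
    exact ⟨ρ, hρ, fun x hx => h2 x (by simpa using hx)⟩
  set s : Set (EuclideanSpace ℝ (Fin m)) := ball 0 (min ρ r) with hsdef
  let T : EuclideanSpace ℝ (Fin (m + 1)) → EuclideanSpace ℝ (Fin m) × ℝ := fun y => A.symm (y - p)
  have hT : Continuous T := A.symm.continuous.comp (continuous_id.sub continuous_const)
  have hTA : ∀ y, p + A ((T y).1, (T y).2) = y := fun y => by
    rw [Prod.mk.eta, A.apply_symm_apply, add_sub_cancel]
  have hAT : ∀ x t, T (p + A (x, t)) = (x, t) := fun x t => by simp [T]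
  refine ⟨T ⁻¹' (s ×ˢ ball 0 r), (isOpen_ball.prod isOpen_ball).preimage hT, ?_, ?_⟩
  · simp [T, s, hρ, hr]
  · have himage : frontier Ω ∩ T ⁻¹' (s ×ˢ ball 0 r) = (fun x => p + A (x, k x)) '' s := by
      ext y
      constructor
      · rintro ⟨hy, hys, hyr⟩
        have h1 : ‖(T y).1‖ < r := by
          have := mem_ball_zero_iff.1 hys
          exact this.trans_le (min_le_right _ _)
        have h2 := (hkr (T y).1 (T y).2 h1 (by simpa using hyr)).2.2
        rw [hTA] at h2
        refine ⟨(T y).1, hys, ?_⟩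
        simp only
        rw [← h2.1 hy, hTA]
      · rintro ⟨x, hx, rfl⟩
        have h1 := mem_ball_zero_iff.1 hx
        have h2 := hρk x (h1.trans_le (min_le_left _ _))
        refine ⟨(hkr x (k x) (h1.trans_le (min_le_right _ _)) h2).2.2.2 rfl, ?_⟩
        simp only [mem_preimage, hAT]
        exact ⟨hx, by simpa using h2⟩
    rw [himage]
    refine (convex_ball _ _).isPreconnected.image _ (Continuous.continuousOn ?_)
    exact continuous_const.add (A.continuous.comp (continuous_id.prodMk hk.continuous))

theorem HasSmoothBoundary.finite_clopenParts (hs : HasSmoothBoundary Ω)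
    (hb : Bornology.IsBounded Ω) : (clopenParts (frontier Ω)).Finite :=
  _root_.finite_clopenParts
    (Metric.isCompact_of_isClosed_isBounded isClosed_frontier
      (hb.closure.subset frontier_subset_closure))
    fun _ hp => hs.exists_isPreconnected_frontier_inter hp

variable {X : Type*} [NormedAddCommGroup X] [InnerProductSpace ℝ X]
  {Θ : X × ℝ → EuclideanSpace ℝ (Fin (m + 1))} {Φ : EuclideanSpace ℝ (Fin (m + 1)) → X × ℝ}
  {w h : ℝ → ℝ} {δ a : ℝ}

theorem IsTubeChart.sdiff_inter_eq (hc : IsTubeChart Ω Θ Φ a) (hw : IsTunnelProfile w)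
    (hh : IsTunnelBump h) (hδ : 0 < δ) :
    (Ω \ Φ ⁻¹' tunnelSet X w h δ) ∩ Φ ⁻¹' tubeDomain X a =
      Θ '' {y | ‖y.1‖ < 2 ∧ h (‖y.1‖ ^ 2 / δ ^ 2) < w y.2} := by
  rw [hc.image_eq]
  ext x
  have key : Φ x ∈ tubeDomain X a → (x ∈ Ω \ Φ ⁻¹' tunnelSet X w h δ ↔
      h (‖(Φ x).1‖ ^ 2 / δ ^ 2) < w (Φ x).2) := by
    intro hx
    have h1 := hc.mem_sdiff_iff hw hh hδ hx
    rwa [hc.right_inv, tunnelFun, sub_pos] at h1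
  constructor
  · rintro ⟨hx, hxZ⟩
    exact ⟨hxZ.1, (key hxZ).1 hx⟩
  · rintro ⟨h1, h2⟩
    have h3 := hw.mem_Icc ((hh.nonneg _).trans h2.le)
    have hxZ : Φ x ∈ tubeDomain X a := ⟨h1, by linarith [hc.pos], by linarith [hc.pos]⟩
    exact ⟨(key hxZ).2 h2, hxZ⟩

theorem IsTubeChart.frontier_sdiff_inter_eq (hc : IsTubeChart Ω Θ Φ a) (hw : IsTunnelProfile w)
    (hh : IsTunnelBump h) (hδ : 0 < δ) :
    frontier (Ω \ Φ ⁻¹' tunnelSet X w h δ) ∩ Φ ⁻¹' tubeDomain X a =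
      Θ '' {y | ‖y.1‖ < 2 ∧ w y.2 = h (‖y.1‖ ^ 2 / δ ^ 2)} := by
  rw [hc.image_eq]
  ext x
  have key : Φ x ∈ tubeDomain X a → (x ∈ frontier (Ω \ Φ ⁻¹' tunnelSet X w h δ) ↔
      w (Φ x).2 = h (‖(Φ x).1‖ ^ 2 / δ ^ 2)) := by
    intro hx
    have h1 := hc.mem_frontier_sdiff_iff hw hh hδ hx
    rwa [hc.right_inv, tunnelFun, sub_eq_zero] at h1
  constructor
  · rintro ⟨hx, hxZ⟩
    exact ⟨hxZ.1, (key hxZ).1 hx⟩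
  · rintro ⟨h1, h2⟩
    have h3 := hw.mem_Icc ((hh.nonneg _).trans h2.ge)
    have hxZ : Φ x ∈ tubeDomain X a := ⟨h1, by linarith [hc.pos], by linarith [hc.pos]⟩
    exact ⟨(key hxZ).2 h2, hxZ⟩

variable [FiniteDimensional ℝ X]

theorem IsTubeChart.isConnected_sdiff (hc : IsTubeChart Ω Θ Φ a) (hX : 2 ≤ Module.finrank ℝ X)
    (hw : IsTunnelProfile w) (hh : IsTunnelBump h) (hδ : 0 < δ) (hδ1 : δ < 1) (hΩ : IsOpen Ω)
    (hcon : IsPreconnected Ω) : IsConnected (Ω \ Φ ⁻¹' tunnelSet X w h δ) := by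
  have hΦ := hc.contDiff_inv.continuous
  constructor
  · have : Nontrivial X := Module.nontrivial_of_finrank_pos (R := ℝ) (by omega)
    obtain ⟨x, hx⟩ := exists_norm_eq X (mul_nonneg zero_le_two hδ.le)
    have h1 : Θ (x, 1 / 2) ∈ (Ω \ Φ ⁻¹' tunnelSet X w h δ) ∩ Φ ⁻¹' tubeDomain X a := by
      rw [hc.sdiff_inter_eq hw hh hδ]
      refine ⟨_, ⟨by simp only [hx]; linarith, ?_⟩, rfl⟩
      simp only
      rw [hh.eq_zero_of_norm hδ hx.ge]
      exact (hw.pos_iff _).2 (by norm_num)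
    exact ⟨_, h1.1⟩
  · refine hcon.sdiff_of_inter hΩ ((hw.isClosed_tunnelSet hh δ).preimage hΦ)
      ((isOpen_tubeDomain a).preimage hΦ) (preimage_mono (tunnelSet_subset hc.pos hδ1)) ?_
    rw [hc.sdiff_inter_eq hw hh hδ]
    exact (isPreconnected_tunnel_region hX hw hh hδ (by linarith)).image _
      hc.contDiff.continuous.continuousOn

theorem IsTubeChart.ncard_clopenParts_lt (hc : IsTubeChart Ω Θ Φ a) (hX : 2 ≤ Module.finrank ℝ X)
    (hw : IsTunnelProfile w) (hh : IsTunnelBump h) (hδ : 0 < δ) (hδ1 : δ < 1)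
    (hfin : (clopenParts (frontier Ω)).Finite) {A : Set (EuclideanSpace ℝ (Fin (m + 1)))}
    (hA : A ∈ clopenParts (frontier Ω)) (hp : Θ (0, 0) ∈ A) (hq : Θ (0, 1) ∈ frontier Ω \ A) :
    (clopenParts (frontier (Ω \ Φ ⁻¹' tunnelSet X w h δ))).ncard <
      (clopenParts (frontier Ω)).ncard := by
  have hΦ := hc.contDiff_inv.continuous
  refine _root_.ncard_clopenParts_lt isClosed_frontier hfin
    ((isOpen_tubeDomain a).preimage hΦ) ((hw.isClosed_tunnelSet hh δ).preimage hΦ)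
    (preimage_mono (tunnelSet_subset hc.pos hδ1)) ?_ ?_ ?_ hA hp ?_ hq.1 hq.2 ?_
  · ext x
    exact and_congr_left fun hx => (hc.mem_frontier_sdiff_iff_of_notMem hw hh hx).symm
  · rw [hc.frontier_sdiff_inter_eq hw hh hδ]
    exact (isPreconnected_tunnel_surface hX hw hh hδ (by linarith)).image _
      hc.contDiff.continuous.continuousOn
  · have : Nontrivial X := Module.nontrivial_of_finrank_pos (R := ℝ) (by omega)
    obtain ⟨x, hx⟩ := exists_norm_eq X (mul_nonneg zero_le_two hδ.le)
    rw [hc.frontier_sdiff_inter_eq hw hh hδ]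
    refine ⟨_, (x, 0), ⟨by simp only [hx]; linarith, ?_⟩, rfl⟩
    simp only
    rw [hh.eq_zero_of_norm hδ hx.ge]
    exact (hw.eq_zero_iff _).2 (Or.inl rfl)
  · rw [mem_preimage, hc.left_inv]
    exact ⟨by simp, by simpa using hc.pos, by linarith [hc.pos]⟩
  · rw [mem_preimage, hc.left_inv]
    exact ⟨by simp, by simp only; linarith [hc.pos], by simp only; linarith [hc.pos]⟩

end Domains

section Assembly

theorem exists_lt_normSigma1_isConnected_frontier {m : ℕ} (hm : 2 ≤ m) {c : ℝ} (hc0 : 0 ≤ c)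
    {Ω : Set (EuclideanSpace ℝ (Fin (m + 1)))} (hΩ : IsOpen Ω) (hb : Bornology.IsBounded Ω)
    (hcon : IsConnected Ω) (hs : HasSmoothBoundary Ω) (hc : c < normSigma1 Ω) :
    ∃ Ω' : Set (EuclideanSpace ℝ (Fin (m + 1))), IsOpen Ω' ∧ Bornology.IsBounded Ω' ∧
      IsConnected Ω' ∧ HasSmoothBoundary Ω' ∧ IsConnected (frontier Ω') ∧ c < normSigma1 Ω' := by
  have hd : (((m + 1 : ℕ) : ℝ) - 1) = m := by push_cast; ring
  have hm0 : (0 : ℝ) < m := by exact_mod_cast (by omega : 0 < m)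
  induction hN : (clopenParts (frontier Ω)).ncard using Nat.strong_induction_on generalizing Ω with
  | _ N ih =>
    have hpos : (μH[(m : ℝ)] (frontier Ω)).toReal ≠ 0 := by
      intro h0
      rw [normSigma1, hd, h0, Real.zero_rpow (one_div_pos.2 hm0).ne', mul_zero] at hc
      exact hc.not_ge hc0
    obtain ⟨h0, hfin⟩ := ENNReal.toReal_ne_zero.1 hpos
    have hne : (frontier Ω).Nonempty := by
      rw [nonempty_iff_ne_empty]
      intro h
      simp [h] at h0
    by_cases hpre : IsPreconnected (frontier Ω)
    · exact ⟨Ω, hΩ, hb, hcon, hs, ⟨hne, hpre⟩, hc⟩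
    obtain ⟨A, B, hA, hB, hU, hA0, hB0, hAB⟩ : ∃ A B : Set (EuclideanSpace ℝ (Fin (m + 1))),
        IsClosed A ∧ IsClosed B ∧ A ∪ B = frontier Ω ∧ A.Nonempty ∧ B.Nonempty ∧ Disjoint A B := by
      rw [isPreconnected_iff_subset_of_disjoint_closed] at hpre
      push Not at hpre
      obtain ⟨u, v, hu, hv, huv, hdis, hnu, hnv⟩ := hpre
      refine ⟨frontier Ω ∩ u, frontier Ω ∩ v, isClosed_frontier.inter hu,
        isClosed_frontier.inter hv, ?_, ?_, ?_, ?_⟩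
      · rw [← inter_union_distrib_left, inter_eq_left]
        exact huv
      · obtain ⟨x, hx, hxv⟩ := not_subset.1 hnv
        exact ⟨x, hx, (huv hx).resolve_right hxv⟩
      · obtain ⟨x, hx, hxu⟩ := not_subset.1 hnu
        exact ⟨x, hx, (huv hx).resolve_left hxu⟩
      · rw [disjoint_iff_inter_eq_empty, ← inter_inter_distrib_left]
        exact hdis
    have hcpt : IsCompact (frontier Ω) := Metric.isCompact_of_isClosed_isBounded isClosed_frontier
      (hb.closure.subset frontier_subset_closure)
    obtain ⟨x, r, p, q, hp, hq, hxp, hxq, hball⟩ :=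
      exists_ball_touching hΩ hcon.isPreconnected hcpt hA hB hA0 hB0 hAB hU
    have hpq : p ≠ q := hAB.ne_of_mem hp hq
    have hqA : q ∉ A := fun h => disjoint_left.1 hAB h hq
    obtain ⟨Θ, Φ, a, hchart, rfl, rfl⟩ := hs.exists_tubeChart hΩ (hU ▸ Or.inl hp) (hU ▸ Or.inr hq)
      hpq hxp hxq hball
    obtain ⟨ε, hε, hmod⟩ := exists_lt_normSigma1 (by omega) hΩ hb h0 hfin hc0 hc
    obtain ⟨w, hw⟩ := exists_isTunnelProfile
    obtain ⟨h, hh⟩ := exists_isTunnelBump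
    obtain ⟨δ, hδ, hδ1, P, hP⟩ := hchart.exists_isSmallModification hm (by simp) hΩ hw hh hε
    have hX : 2 ≤ Module.finrank ℝ (EuclideanSpace ℝ (Fin m)) := by simpa using hm
    have hAX : A ∈ clopenParts (frontier Ω) := by
      refine ⟨hU ▸ subset_union_left, hA, ?_⟩
      rw [← hU, union_sdiff_cancel_left (disjoint_iff_inter_eq_empty.1 hAB).subset]
      exact hB
    exact ih _ (hN ▸ hchart.ncard_clopenParts_lt hX hw hh hδ hδ1 (hs.finite_clopenParts hb) hAX hp
        ⟨hU ▸ Or.inr hq, hqA⟩)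
      (hchart.isOpen_sdiff hw hh hΩ) (hb.subset sdiff_subset)
      (hchart.isConnected_sdiff hX hw hh hδ hδ1 hΩ hcon.isPreconnected)
      (hchart.hasSmoothBoundary_sdiff hw hh hδ hδ1 hs) (hmod _ P hP) rfl

end Assembly

/-- Corollary: for `n ≥ 3`, the supremum of the normalized first Steklov eigenvalue over
smooth bounded connected domains equals the supremum over those with connected boundary,
and both suprema are finite. -/
theorem stmt19 {n : ℕ} (hn : 3 ≤ n) :
    sSup { q : ℝ | ∃ Ω : Set (EuclideanSpace ℝ (Fin n)),
        (IsOpen Ω ∧ Bornology.IsBounded Ω ∧ Ω.Nonempty ∧ IsConnected Ω ∧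
          HasSmoothBoundary Ω) ∧ q = normSigma1 Ω }
      = sSup { q : ℝ | ∃ Ω : Set (EuclideanSpace ℝ (Fin n)),
        (IsOpen Ω ∧ Bornology.IsBounded Ω ∧ Ω.Nonempty ∧ IsConnected Ω ∧
          HasSmoothBoundary Ω ∧ IsConnected (frontier Ω)) ∧ q = normSigma1 Ω } ∧
    BddAbove { q : ℝ | ∃ Ω : Set (EuclideanSpace ℝ (Fin n)),
        (IsOpen Ω ∧ Bornology.IsBounded Ω ∧ Ω.Nonempty ∧ IsConnected Ω ∧
          HasSmoothBoundary Ω) ∧ q = normSigma1 Ω } ∧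
    BddAbove { q : ℝ | ∃ Ω : Set (EuclideanSpace ℝ (Fin n)),
        (IsOpen Ω ∧ Bornology.IsBounded Ω ∧ Ω.Nonempty ∧ IsConnected Ω ∧
          HasSmoothBoundary Ω ∧ IsConnected (frontier Ω)) ∧ q = normSigma1 Ω } := by
  obtain ⟨m, rfl⟩ : ∃ m, n = m + 1 := ⟨n - 1, by omega⟩
  have hm : 2 ≤ m := by omega
  obtain ⟨C, hC⟩ := exists_normSigma1_le (m := m) (by omega)
  set S := { q : ℝ | ∃ Ω : Set (EuclideanSpace ℝ (Fin (m + 1))),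
    (IsOpen Ω ∧ Bornology.IsBounded Ω ∧ Ω.Nonempty ∧ IsConnected Ω ∧
      HasSmoothBoundary Ω) ∧ q = normSigma1 Ω }
  set S₀ := { q : ℝ | ∃ Ω : Set (EuclideanSpace ℝ (Fin (m + 1))),
    (IsOpen Ω ∧ Bornology.IsBounded Ω ∧ Ω.Nonempty ∧ IsConnected Ω ∧
      HasSmoothBoundary Ω ∧ IsConnected (frontier Ω)) ∧ q = normSigma1 Ω }
  have hsub : S₀ ⊆ S := by
    rintro _ ⟨Ω, ⟨h1, h2, h3, h4, h5, -⟩, rfl⟩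
    exact ⟨Ω, ⟨h1, h2, h3, h4, h5⟩, rfl⟩
  have hbdd : BddAbove S := by
    refine ⟨C, ?_⟩
    rintro _ ⟨Ω, ⟨h1, h2, -⟩, rfl⟩
    exact hC Ω h1 h2
  have hbdd₀ : BddAbove S₀ := hbdd.mono hsub
  have hnonneg : ∀ q ∈ S, 0 ≤ q := by
    rintro _ ⟨Ω, -, rfl⟩
    exact normSigma1_nonneg Ω
  have hnonneg₀ : 0 ≤ sSup S₀ := Real.sSup_nonneg fun q hq => hnonneg q (hsub hq)
  refine ⟨le_antisymm (Real.sSup_le ?_ hnonneg₀) (Real.sSup_le (fun q hq => le_csSup hbdd (hsub hq))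
    (Real.sSup_nonneg hnonneg)), hbdd, hbdd₀⟩
  rintro _ ⟨Ω, ⟨h1, h2, -, h4, h5⟩, rfl⟩
  refine le_of_forall_lt fun c hc => ?_
  rcases lt_or_ge c 0 with hc0 | hc0
  · exact hc0.trans_le hnonneg₀
  · obtain ⟨Ω', g1, g2, g4, g5, g6, g7⟩ :=
      exists_lt_normSigma1_isConnected_frontier hm hc0 h1 h2 h4 h5 hc
    exact g7.trans_le (le_csSup hbdd₀ ⟨Ω', ⟨g1, g2, g4.nonempty, g4, g5, g6⟩, rfl⟩)
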